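/- arXiv:1210.0816 — 9 statements merged into one kernel-verified Lean document; each statement's English description precedes it below -/
import Mathlib

section
/- Fix η > 0 and let x ∈ X_η. Then the set S = {s ∈ ℝ : h_s·x ∈ Ω_η} is nonempty, has no accumulation points in ℝ, and is unbounded above. In particular, the h_s-orbit of x meets Ω_η in a nonempty discrete set of times, and for every ω ∈ Ω_η ∩ X_η there exists s' > 0 with h_{s'}·ω ∈ Ω_η, so the first-return map of the flow h_s to Ω_η is defined along the orbit of x. -/
open Matrix MeasureTheory Filter Topology

noncomputable section

/-- `SL(2,ℝ)`. -/
abbrev SL2 := Matrix.SpecialLinearGroup (Fin 2) ℝ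

instance : TopologicalSpace SL2 :=
  inferInstanceAs (TopologicalSpace {A : Matrix (Fin 2) (Fin 2) ℝ // A.det = 1})

/-- The shear `h_s = [[1,0],[-s,1]]` as an element of `SL(2,ℝ)`. -/
def hSL (s : ℝ) : SL2 :=
  ⟨!![1, 0; -s, 1], by simp [Matrix.det_fin_two_of]⟩

/-- The vertical strip `V_η = {(u,v)ᵀ : 0 < u ≤ η, v > 0}`. -/
def Vstrip (η : ℝ) : Set (Fin 2 → ℝ) := {w | 0 < w 0 ∧ w 0 ≤ η ∧ 0 < w 1}

/-- `Ω_η`: the set of `η`-horizontally short points, i.e. those `y` for which `Λ y`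
contains a horizontal vector `(u,0)ᵀ` with `0 < u ≤ η`. -/
def OmegaSet {X : Type} (Λ : X → Set (Fin 2 → ℝ)) (η : ℝ) : Set X :=
  {y | ∃ u : ℝ, 0 < u ∧ u ≤ η ∧ ![u, 0] ∈ Λ y}

/-- `𝕊_η(x)`: the set of slopes `v/u` of vectors `(u,v)ᵀ ∈ Λ x ∩ V_η`. -/
def Slopes {X : Type} (Λ : X → Set (Fin 2 → ℝ)) (η : ℝ) (x : X) : Set ℝ :=
  {t | ∃ w ∈ Λ x ∩ Vstrip η, w 1 / w 0 = t}

/-- `X_η`: the set of non-`η`-exceptional points, i.e. those `x` such that `Λ x` contains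
no vertical vector `(0,v)ᵀ` with `0 < |v| ≤ c x / (4η)`. -/
def Xgood {X : Type} (Λ : X → Set (Fin 2 → ℝ)) (c : X → ℝ) (η : ℝ) : Set X :=
  {x | ¬ ∃ v : ℝ, v ≠ 0 ∧ |v| ≤ c x / (4 * η) ∧ ![0, v] ∈ Λ x}

/-- The return time `R_η(y) = min{s > 0 : h_s • y ∈ Ω_η}` of the horocycle flow
to the transversal `Ω_η`. -/
def Rtime {X : Type} [MulAction SL2 X] (Λ : X → Set (Fin 2 → ℝ)) (η : ℝ) (y : X) : ℝ :=
  sInf {s : ℝ | 0 < s ∧ hSL s • y ∈ OmegaSet Λ η}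

/-- The return map `T_η(y) = h_{R_η(y)} • y`. -/
def Tmap {X : Type} [MulAction SL2 X] (Λ : X → Set (Fin 2 → ℝ)) (η : ℝ) (y : X) : X :=
  hSL (Rtime Λ η y) • y

/-- A closed discrete set meets every compact set in finitely many points. -/
lemma finite_inter_of_isCompact {E : Type*} [TopologicalSpace E] {A K : Set E}
    (hA : IsClosed A) (hd : DiscreteTopology A) (hK : IsCompact K) : (K ∩ A).Finite :=
  (hK.inter_right hA).finite (IsDiscrete.mono ⟨hd⟩ Set.inter_subset_right)

/-- The orbit of `x` meets `Ω_η` exactly at the slopes of the vectors of `Λ x` whose first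
coordinate lies in `(0, η]`. -/
lemma hSL_smul_mem_OmegaSet_iff {X : Type} [MulAction SL2 X] {Λ : X → Set (Fin 2 → ℝ)}
    (hequiv : ∀ (g : SL2) (x : X),
      Λ (g • x) = (fun w => (g : Matrix (Fin 2) (Fin 2) ℝ) *ᵥ w) '' Λ x)
    {η s : ℝ} {x : X} :
    hSL s • x ∈ OmegaSet Λ η ↔ ∃ w ∈ Λ x, 0 < w 0 ∧ w 0 ≤ η ∧ w 1 = s * w 0 := by
  simp only [OmegaSet, Set.mem_ofPred_eq, hequiv, Set.mem_image]
  constructor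
  · rintro ⟨u, hu, huη, w, hw, h⟩
    have h0 := congrFun h 0
    have h1 := congrFun h 1
    simp [hSL, Matrix.mulVec, dotProduct, Fin.sum_univ_two] at h0 h1
    exact ⟨w, hw, h0 ▸ hu, h0 ▸ huη, by linarith⟩
  · rintro ⟨w, hw, hu, huη, h⟩
    refine ⟨w 0, hu, huη, w, hw, ?_⟩
    ext i
    fin_cases i <;> simp [hSL, Matrix.mulVec, dotProduct, Fin.sum_univ_two, h]

/-- A set of slopes of vectors with bounded first coordinate in a closed discrete planar set
has no accumulation points. -/
lemma not_accPt_slopes {A : Set (Fin 2 → ℝ)} (hA : IsClosed A) (hd : DiscreteTopology A)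
    (η t : ℝ) :
    ¬ AccPt t (𝓟 {s : ℝ | ∃ w ∈ A, 0 < w 0 ∧ w 0 ≤ η ∧ w 1 = s * w 0}) := by
  intro hacc
  have hfin : (Set.Icc ![0, -((|t| + 1) * η)] ![η, (|t| + 1) * η] ∩ A).Finite :=
    finite_inter_of_isCompact hA hd isCompact_Icc
  refine Set.Infinite.of_accPt (hacc.nhds_inter (Icc_mem_nhds (sub_one_lt t) (lt_add_one t)))
    ((hfin.image fun w => w 1 / w 0).subset ?_)
  rintro s ⟨⟨hs1, hs2⟩, w, hw, h0, h0η, h1⟩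
  have hs : |s| ≤ |t| + 1 := by
    rw [abs_le]
    constructor <;> linarith [neg_abs_le t, le_abs_self t]
  have hw1 : |w 1| ≤ (|t| + 1) * η := by
    rw [h1, abs_mul, abs_of_pos h0]
    gcongr
  refine ⟨w, ⟨?_, hw⟩, by simp [h1, h0.ne']⟩
  simp only [Set.mem_Icc, Pi.le_def, Fin.forall_fin_two, Matrix.cons_val_zero,
    Matrix.cons_val_one]
  exact ⟨⟨h0.le, (abs_le.1 hw1).1⟩, h0η, (abs_le.1 hw1).2⟩

/-- The sheared box `{(u,v) : |u| ≤ a, |v - m u| ≤ b}` has area `4ab`. -/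
lemma volume_shearedBox (m : ℝ) {a : ℝ} (ha : 0 ≤ a) (b : ℝ) :
    volume {w : Fin 2 → ℝ | |w 0| ≤ a ∧ |w 1 - m * w 0| ≤ b} = ENNReal.ofReal (4 * a * b) := by
  have hpre : {w : Fin 2 → ℝ | |w 0| ≤ a ∧ |w 1 - m * w 0| ≤ b} =
      Matrix.toLin' (hSL m : Matrix (Fin 2) (Fin 2) ℝ) ⁻¹' Set.Icc ![-a, -b] ![a, b] := by
    ext w
    simp only [Set.mem_ofPred_eq, Set.mem_preimage, Set.mem_Icc, Pi.le_def, Fin.forall_fin_two,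
      abs_le]
    simp [hSL, Matrix.mulVec, dotProduct, Fin.sum_univ_two]
    grind
  have hdet : LinearMap.det (Matrix.toLin' (hSL m : Matrix (Fin 2) (Fin 2) ℝ)) = 1 := by
    rw [LinearMap.det_toLin']; exact (hSL m).2
  rw [hpre, Measure.addHaar_preimage_linearMap _ (by simp [hdet]), hdet, Real.volume_Icc_pi]
  simp only [Fin.prod_univ_two, Matrix.cons_val_zero, Matrix.cons_val_one]
  rw [← ENNReal.ofReal_mul (by linarith)]
  simp only [inv_one, abs_one, ENNReal.ofReal_one, one_mul]
  ring_nf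

/-- Sheared boxes are convex. -/
lemma convex_shearedBox (m a b : ℝ) :
    Convex ℝ {w : Fin 2 → ℝ | |w 0| ≤ a ∧ |w 1 - m * w 0| ≤ b} := by
  intro v hv w hw p q hp hq hpq
  simp only [Set.mem_ofPred_eq, Pi.add_apply, Pi.smul_apply, smul_eq_mul, abs_le] at hv hw ⊢
  obtain rfl : q = 1 - p := by linarith
  refine ⟨⟨?_, ?_⟩, ?_, ?_⟩ <;> nlinarith

/-- A closed discrete symmetric set which meets every sheared box of half-width `η` and
half-height `b`, but contains no vertical vector of length at most `b`, contains vectors of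
arbitrarily large slope with first coordinate in `(0, η]`. -/
lemma exists_slope_gt {A : Set (Fin 2 → ℝ)} (hA : IsClosed A) (hd : DiscreteTopology A)
    (hsymm : -A = A) {η b : ℝ} (hb : 0 ≤ b)
    (hbox : ∀ m : ℝ, ({w : Fin 2 → ℝ | |w 0| ≤ η ∧ |w 1 - m * w 0| ≤ b} ∩ A).Nonempty)
    (hvert : ∀ w ∈ A, w 0 = 0 → b < |w 1|) (M : ℝ) :
    ∃ s > M, ∃ w ∈ A, 0 < w 0 ∧ w 0 ≤ η ∧ w 1 = s * w 0 := by
  have hpos : ∀ m : ℝ, ∃ w ∈ A, 0 < w 0 ∧ w 0 ≤ η ∧ |w 1 - m * w 0| ≤ b := by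
    intro m
    obtain ⟨w, ⟨h0, h1⟩, hw⟩ := hbox m
    rcases lt_trichotomy (w 0) 0 with h | h | h
    · refine ⟨-w, by rwa [← Set.mem_neg, hsymm], by simpa using h, ?_, ?_⟩
      · simpa using (neg_le_abs _).trans h0
      · rw [← abs_neg]; convert h1 using 2; simp; ring
    · have := hvert w hw h
      simp only [h, mul_zero, sub_zero] at h1
      linarith
    · exact ⟨w, hw, h, (le_abs_self _).trans h0, h1⟩
  have hfin : ((Set.Icc ![0, -b] ![η, |M| * η] ∩ A) ∩ {w | 0 < w 0}).Finite :=
    (finite_inter_of_isCompact hA hd isCompact_Icc).inter_of_left _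
  obtain ⟨δ, hδ, hmin⟩ : ∃ δ > 0, ∀ w ∈ (Set.Icc ![0, -b] ![η, |M| * η] ∩ A) ∩ {w | 0 < w 0},
      δ ≤ w 0 := by
    rcases Set.eq_empty_or_nonempty
      ((Set.Icc ![0, -b] ![η, |M| * η] ∩ A) ∩ {w | 0 < w 0}) with he | hne
    · exact ⟨1, one_pos, by simp [he]⟩
    · obtain ⟨w, hw, h⟩ := Set.exists_min_image _ (fun w => w 0) hfin hne
      exact ⟨w 0, hw.2, h⟩
  obtain ⟨w, hw, h0, h0η, h1⟩ := hpos (|M| + (b + 1) / δ)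
  refine ⟨w 1 / w 0, ?_, w, hw, h0, h0η, by field_simp⟩
  by_contra! hle
  rw [div_le_iff₀ h0] at hle
  rw [abs_le] at h1
  have hM := mul_le_mul_of_nonneg_right (le_abs_self M) h0.le
  have hMη := mul_le_mul_of_nonneg_left h0η (abs_nonneg M)
  have hM0 := mul_nonneg (abs_nonneg M) h0.le
  have hq : 0 ≤ (b + 1) / δ * w 0 := by positivity
  have hδw : δ ≤ w 0 := by
    refine hmin w ⟨⟨?_, hw⟩, h0⟩
    simp only [Set.mem_Icc, Pi.le_def, Fin.forall_fin_two, Matrix.cons_val_zero,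
      Matrix.cons_val_one]
    exact ⟨⟨h0.le, by linarith⟩, h0η, by linarith⟩
  have hbδ : b + 1 ≤ (b + 1) / δ * w 0 := by
    rw [div_mul_eq_mul_div, le_div_iff₀ hδ]
    gcongr
  linarith

/-- For a non-exceptional point `x ∈ X_η`, the horocycle orbit of `x` meets the
transversal `Ω_η` in a nonempty discrete set of times which is unbounded above; moreover
from any point of `Ω_η ∩ X_η` there is a positive-time return to `Ω_η`, so the
first-return map of `h_s` to `Ω_η` is defined along the orbit of `x`. -/
theorem transversal_wellDefined
    {X : Type} [MetricSpace X] [LocallyCompactSpace X] [SecondCountableTopology X]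
    [MulAction SL2 X] [ContinuousSMul SL2 X]
    (Λ : X → Set (Fin 2 → ℝ))
    (hclosed : ∀ x, IsClosed (Λ x))
    (hdisc : ∀ x, DiscreteTopology (Λ x))
    (hzero : ∀ x, (0 : Fin 2 → ℝ) ∉ Λ x)
    (hequiv : ∀ (g : SL2) (x : X),
      Λ (g • x) = (fun w => (g : Matrix (Fin 2) (Fin 2) ℝ) *ᵥ w) '' Λ x)
    (hsymm : ∀ x, -(Λ x) = Λ x)
    (c : X → ℝ) (hcpos : ∀ x, 0 < c x)
    (hmink : ∀ x, ∀ K : Set (Fin 2 → ℝ), Convex ℝ K → K = -K →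
      ENNReal.ofReal (c x) ≤ volume K → (K ∩ Λ x).Nonempty)
    (hstrip : ∀ x, (∃ w ∈ Λ x, w ≠ 0 ∧ w 1 = 0) → ∀ η > 0, (Λ x ∩ Vstrip η).Nonempty)
    (η : ℝ) (hη : 0 < η) (x : X) (hx : x ∈ Xgood Λ c η) :
    {s : ℝ | hSL s • x ∈ OmegaSet Λ η}.Nonempty ∧
      (∀ t : ℝ, ¬ AccPt t (Filter.principal {s : ℝ | hSL s • x ∈ OmegaSet Λ η})) ∧
      (∀ M : ℝ, ∃ s ∈ {s : ℝ | hSL s • x ∈ OmegaSet Λ η}, M < s) ∧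
      (∀ ω ∈ OmegaSet Λ η ∩ Xgood Λ c η, ∃ s' > 0, hSL s' • ω ∈ OmegaSet Λ η) := by
  have key : ∀ y ∈ Xgood Λ c η, ∀ M : ℝ, ∃ s > M, hSL s • y ∈ OmegaSet Λ η := by
    intro y hy M
    have hcy := hcpos y
    simp only [hSL_smul_mem_OmegaSet_iff hequiv]
    refine exists_slope_gt (hclosed y) (hdisc y) (hsymm y)
      (b := c y / (4 * η)) (by positivity) (fun m => hmink y _ (convex_shearedBox _ _ _) ?_ ?_)
      (fun w hw h0 => ?_) M
    · ext w
      simp only [Set.mem_neg, Set.mem_ofPred_eq, Pi.neg_apply, abs_neg, mul_neg, ← neg_sub',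
        abs_neg]
    · rw [volume_shearedBox m hη.le]
      exact (congrArg _ (by field_simp)).le
    · have hw' : w = ![0, w 1] := by ext i; fin_cases i <;> simp [h0]
      by_contra! hle
      refine hy ⟨w 1, fun h1 => hzero y ?_, hle, hw' ▸ hw⟩
      convert hw
      ext i; fin_cases i <;> simp [h0, h1]
  refine ⟨?_, fun t => ?_, fun M => ?_, fun ω hω => key ω hω.2 0⟩
  · obtain ⟨s, -, hs⟩ := key x hx 0
    exact ⟨s, hs⟩
  · simp only [hSL_smul_mem_OmegaSet_iff hequiv]
    exact not_accPt_slopes (hclosed x) (hdisc x) η t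
  · obtain ⟨s, hM, hs⟩ := key x hx M
    exact ⟨s, hs, hM⟩
end
end

section
/- Fix η > 0 and let x ∈ X_η. Let s₁ < s₂ < ⋯ enumerate the set {s > 0 : h_s·x ∈ Ω_η} (which is nonempty, discrete, and unbounded above), and let ω₀ = h_{s₁}·x ∈ Ω_η. Then for every i ≥ 0, T_η^i(ω₀) = h_{s_{i+1}}·x, and consequently R_η(T_η^i(ω₀)) = s_{i+2} − s_{i+1}. That is, the sequence of slope gaps of x is exactly the sequence of return times of the map T_η along the orbit of ω₀. -/
open Matrix MeasureTheory Filter Topology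

noncomputable section

theorem hSL_mul_hSL (a b : ℝ) : hSL a * hSL b = hSL (a + b) := by
  apply Subtype.ext
  change !![1, 0; -a, 1] * !![1, 0; -b, 1] = !![1, 0; -(a + b), 1]
  simp [add_comm]

/-- If the positive hitting times of `Ω_η` along the orbit of `x` are enumerated increasingly
by `s`, then the return time from the `i`-th hitting point is the `i`-th gap. -/
theorem Rtime_hSL_smul {X : Type} [MulAction SL2 X] (Λ : X → Set (Fin 2 → ℝ)) (η : ℝ) (x : X)
    (s : ℕ → ℝ) (hmono : StrictMono s) (hpos : ∀ i, 0 < s i)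
    (hmem : ∀ i, hSL (s i) • x ∈ OmegaSet Λ η)
    (hall : ∀ t : ℝ, 0 < t → hSL t • x ∈ OmegaSet Λ η → ∃ i, s i = t) (i : ℕ) :
    Rtime Λ η (hSL (s i) • x) = s (i + 1) - s i := by
  refine IsLeast.csInf_eq ⟨⟨sub_pos.2 (hmono i.lt_succ_self), ?_⟩, ?_⟩
  · rw [smul_smul, hSL_mul_hSL, sub_add_cancel]
    exact hmem (i + 1)
  · rintro t ⟨ht, hit⟩
    rw [smul_smul, hSL_mul_hSL] at hit
    obtain ⟨j, hj⟩ := hall _ (add_pos ht (hpos i)) hit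
    have hij : i < j := hmono.lt_iff_lt.1 (by linarith)
    have hle : s (i + 1) ≤ s j := hmono.monotone hij
    linarith

/-- The sequence of slope gaps of `x` is the sequence of return times of the
return map `T_η` along the orbit of the first hitting point `ω₀ = h_{s 0} • x`. -/
theorem gaps_are_return_times
    {X : Type} [MetricSpace X] [LocallyCompactSpace X] [SecondCountableTopology X]
    [MulAction SL2 X] [ContinuousSMul SL2 X]
    (Λ : X → Set (Fin 2 → ℝ))
    (hclosed : ∀ x, IsClosed (Λ x))
    (hdisc : ∀ x, DiscreteTopology (Λ x))
    (hzero : ∀ x, (0 : Fin 2 → ℝ) ∉ Λ x)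
    (hequiv : ∀ (g : SL2) (x : X),
      Λ (g • x) = (fun w => (g : Matrix (Fin 2) (Fin 2) ℝ) *ᵥ w) '' Λ x)
    (hsymm : ∀ x, -(Λ x) = Λ x)
    (c : X → ℝ) (hcpos : ∀ x, 0 < c x)
    (hmink : ∀ x, ∀ K : Set (Fin 2 → ℝ), Convex ℝ K → K = -K →
      ENNReal.ofReal (c x) ≤ volume K → (K ∩ Λ x).Nonempty)
    (hstrip : ∀ x, (∃ w ∈ Λ x, w ≠ 0 ∧ w 1 = 0) → ∀ η > 0, (Λ x ∩ Vstrip η).Nonempty)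
    (η : ℝ) (hη : 0 < η) (x : X) (hx : x ∈ Xgood Λ c η)
    (s : ℕ → ℝ) (hmono : StrictMono s) (hpos : ∀ i, 0 < s i)
    (hmem : ∀ i, hSL (s i) • x ∈ OmegaSet Λ η)
    (hall : ∀ t : ℝ, 0 < t → hSL t • x ∈ OmegaSet Λ η → ∃ i, s i = t) :
    ∀ i : ℕ, (Tmap Λ η)^[i] (hSL (s 0) • x) = hSL (s i) • x ∧
      Rtime Λ η ((Tmap Λ η)^[i] (hSL (s 0) • x)) = s (i + 1) - s i := by
  have hR := Rtime_hSL_smul Λ η x s hmono hpos hmem hall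
  have hT : ∀ i : ℕ, (Tmap Λ η)^[i] (hSL (s 0) • x) = hSL (s i) • x := by
    intro i
    induction i with
    | zero => rfl
    | succ i ih =>
      rw [Function.iterate_succ_apply', ih, Tmap, hR, smul_smul, hSL_mul_hSL, sub_add_cancel]
  exact fun i => ⟨hT i, by rw [hT i, hR i]⟩
end
end

section
/- Fix η > 0 and suppose x ∈ X satisfies h_{s₀}·x = x for some s₀ > 0, and that the slope set 𝕊_η(x) is nonempty and has no accumulation points in ℝ. Then 𝕊_η(x) is infinite; enumerating it increasingly as s₁ < s₂ < ⋯ and setting M = min{n ≥ 1 : s_n > s₀}, one has M ≥ 2 and s_{M+i} = s_{i+1} + s₀ for all i ≥ 0. Consequently, the gaps are periodic with period M−1: s_{i+1} − s_i = s_{M+i} − s_{M+i−1} for all i ≥ 1, and for every N ≥ M−1 the gap set {s_{j+1} − s_j : 1 ≤ j ≤ N} equals {s_{j+1} − s_j : 1 ≤ j ≤ M−1}. -/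
open Matrix MeasureTheory Filter Topology

noncomputable section

/-- The shear `h_s` fixes the first coordinate and lowers slopes by `s`. -/
lemma hSL_mulVec (s : ℝ) (w : Fin 2 → ℝ) :
    (hSL s : Matrix (Fin 2) (Fin 2) ℝ) *ᵥ w = ![w 0, w 1 - s * w 0] := by
  ext i
  fin_cases i
  · simp [hSL, Matrix.mulVec, dotProduct, Fin.sum_univ_two]
  · simp [hSL, Matrix.mulVec, dotProduct, Fin.sum_univ_two]
    ring

/-- For a point fixed by `h_{s₀}`, the slopes exceeding `s₀` are exactly the translates
by `s₀` of all slopes. -/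
lemma add_mem_slopes_iff_pos {X : Type} [MulAction SL2 X] {Λ : X → Set (Fin 2 → ℝ)}
    (hequiv : ∀ (g : SL2) (x : X),
      Λ (g • x) = (fun w => (g : Matrix (Fin 2) (Fin 2) ℝ) *ᵥ w) '' Λ x)
    {η s₀ : ℝ} (hs₀ : 0 < s₀) {x : X} (hper : hSL s₀ • x = x) (t : ℝ) :
    t ∈ Slopes Λ η x ↔ 0 < t ∧ t + s₀ ∈ Slopes Λ η x := by
  have hΛ := hequiv (hSL s₀) x
  rw [hper] at hΛ
  constructor
  · rintro ⟨w, ⟨hw, h0, h1, h2⟩, rfl⟩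
    refine ⟨div_pos h2 h0, ?_⟩
    rw [hΛ] at hw
    obtain ⟨v, hv, rfl⟩ := hw
    simp only [hSL_mulVec, Matrix.cons_val_zero, Matrix.cons_val_one] at h0 h1 h2 ⊢
    refine ⟨v, ⟨hv, h0, h1, by nlinarith [mul_pos hs₀ h0]⟩, ?_⟩
    field_simp
    ring
  · rintro ⟨ht, w, ⟨hw, h0, h1, h2⟩, hwt⟩
    have hv : w 1 - s₀ * w 0 = t * w 0 := by
      rw [div_eq_iff h0.ne'] at hwt
      rw [hwt]
      ring
    refine ⟨![w 0, w 1 - s₀ * w 0], ⟨?_, h0, h1, ?_⟩, ?_⟩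
    · rw [hΛ]
      exact ⟨w, hw, hSL_mulVec s₀ w⟩
    · simpa [hv] using mul_pos ht h0
    · simp [hv, h0.ne']

lemma pos_of_mem_slopes {X : Type} {Λ : X → Set (Fin 2 → ℝ)} {η : ℝ} {x : X} {t : ℝ}
    (ht : t ∈ Slopes Λ η x) : 0 < t := by
  obtain ⟨w, ⟨-, h0, -, h2⟩, rfl⟩ := ht
  exact div_pos h2 h0

/-- For an `h_s`-periodic point `x` (with period `s₀`) whose slope set `𝕊_η(x)` is
nonempty and has no accumulation points, the slope set is infinite, and (enumerating it
increasingly, zero-indexed, as `s 0 < s 1 < ⋯`, with `M` the least index with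
`s₀ < s M`) the slopes satisfy `M ≥ 1`, `s (M + i) = s i + s₀`, the gaps are periodic
with period `M`, and the set of the first `N` gaps stabilizes for `N ≥ M`. -/
theorem periodic_gap_stabilization
    {X : Type} [MetricSpace X] [LocallyCompactSpace X] [SecondCountableTopology X]
    [MulAction SL2 X] [ContinuousSMul SL2 X]
    (Λ : X → Set (Fin 2 → ℝ))
    (hclosed : ∀ x, IsClosed (Λ x))
    (hdisc : ∀ x, DiscreteTopology (Λ x))
    (hzero : ∀ x, (0 : Fin 2 → ℝ) ∉ Λ x)
    (hequiv : ∀ (g : SL2) (x : X),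
      Λ (g • x) = (fun w => (g : Matrix (Fin 2) (Fin 2) ℝ) *ᵥ w) '' Λ x)
    (η : ℝ) (hη : 0 < η) (x : X)
    (s₀ : ℝ) (hs₀ : 0 < s₀) (hper : hSL s₀ • x = x)
    (hne : (Slopes Λ η x).Nonempty)
    (hacc : ∀ t : ℝ, ¬ AccPt t (Filter.principal (Slopes Λ η x))) :
    (Slopes Λ η x).Infinite ∧
      ∀ s : ℕ → ℝ, StrictMono s → (∀ n, s n ∈ Slopes Λ η x) →
        (∀ t ∈ Slopes Λ η x, ∃ n, s n = t) →
        ∀ M : ℕ, IsLeast {n : ℕ | s₀ < s n} M →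
          1 ≤ M ∧ (∀ i : ℕ, s (M + i) = s i + s₀) ∧
            (∀ k : ℕ, s (M + k + 1) - s (M + k) = s (k + 1) - s k) ∧
            (∀ N : ℕ, M ≤ N →
              {d : ℝ | ∃ k < N, d = s (k + 1) - s k} =
                {d : ℝ | ∃ k < M, d = s (k + 1) - s k}) := by
  have hA := add_mem_slopes_iff_pos (η := η) hequiv hs₀ hper
  refine ⟨fun hfin => ?_, fun s hs hmem hsurj M hM => ?_⟩
  · obtain ⟨a, ha, hmax⟩ := Set.exists_max_image _ id hfin hne
    have := hmax _ ((hA a).1 ha).2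
    simp only [id] at this
    linarith
  have hM1 : s₀ < s M := hM.1
  have hshift : ∀ i, s (M + i) = s i + s₀ := by
    refine congrFun ((StrictMono.range_inj (f := fun i => s (M + i)) (g := fun i => s i + s₀)
      (fun a b hab => hs (by omega)) (fun a b hab => by simpa using hs hab)).1 ?_)
    ext t
    constructor
    · rintro ⟨i, rfl⟩
      have hlt : s₀ < s (M + i) := hM1.trans_le (hs.monotone (by omega))
      obtain ⟨n, hn⟩ := hsurj (s (M + i) - s₀)
        ((hA _).2 ⟨by linarith, by simpa using hmem (M + i)⟩)
      exact ⟨n, by simp [hn]⟩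
    · rintro ⟨i, rfl⟩
      obtain ⟨n, hn⟩ := hsurj _ ((hA _).1 (hmem i)).2
      have hi := pos_of_mem_slopes (hmem i)
      have hMn : M ≤ n := hM.2 (show s₀ < s n by linarith)
      exact ⟨n - M, by simp [Nat.add_sub_cancel' hMn, hn]⟩
  have hMpos : 1 ≤ M := by
    by_contra! h
    obtain rfl : M = 0 := by omega
    have := hshift 0
    simp only [add_zero] at this
    linarith
  have hgap : ∀ k, s (M + k + 1) - s (M + k) = s (k + 1) - s k := fun k => by
    rw [add_assoc, hshift, hshift]
    ring
  have hperiodic : Function.Periodic (fun k => s (k + 1) - s k) M := fun k => by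
    simpa only [add_comm k M] using hgap k
  refine ⟨hMpos, hshift, hgap, fun N hN => Set.ext fun d => ⟨?_, ?_⟩⟩
  · rintro ⟨k, -, rfl⟩
    exact ⟨k % M, Nat.mod_lt _ hMpos, (hperiodic.map_mod_nat k).symm⟩
  · rintro ⟨k, hk, rfl⟩
    exact ⟨k, hk.trans_le hN, rfl⟩
end
end

section
/- (Hall's theorem) Fix 0 ≤ a < b < ∞. Let F(Q): γ₀ = 0 < γ₁ < ⋯ < γ_{N(Q)} = 1 be the Farey sequence of level Q and N(Q) = Σ_{i=1}^{Q} φ(i). Then lim_{Q→∞} (1/N(Q))·#{0 ≤ i < N(Q) : N(Q)·(γ_{i+1} − γ_i) ∈ (a,b)} = 2·Leb₂(Ã_{a,b}), where Leb₂ is two-dimensional Lebesgue measure and Ã_{a,b} = A_{(π²/3)a, (π²/3)b}. -/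
open MeasureTheory Filter Topology

noncomputable section

/-- The Farey set of level `Q`: all rationals `p/q ∈ [0,1]` with `1 ≤ q ≤ Q`. -/
def fareySet (Q : ℕ) : Set ℝ :=
  {x | ∃ p q : ℕ, 0 < q ∧ q ≤ Q ∧ p ≤ q ∧ x = (p : ℝ) / q}

/-- `N(Q) = ∑_{i=1}^{Q} φ(i)`, the number of gaps of the Farey sequence of level `Q`. -/
def NQ (Q : ℕ) : ℕ := ∑ i ∈ Finset.Icc 1 Q, Nat.totient i

/-- The region `Ω = {(u,v) ∈ [0,1]² : u + v > 1}`. -/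
def regOmega : Set (ℝ × ℝ) :=
  {p | p.1 ∈ Set.Icc (0 : ℝ) 1 ∧ p.2 ∈ Set.Icc (0 : ℝ) 1 ∧ 1 < p.1 + p.2}

/-- The region `A_{α,β} = {(u,v) ∈ Ω : 1/β < uv < 1/α}` (for `α = 0` the upper
condition is vacuous; the inequalities are written multiplicatively to implement the
conventions `1/0 = ∞`, `1/∞ = 0`). -/
def Aset (α β : ℝ) : Set (ℝ × ℝ) :=
  {p | p ∈ regOmega ∧ 1 < β * (p.1 * p.2) ∧ α * (p.1 * p.2) < 1}

/-- `Ã_{a,b} = A_{(π²/3)a, (π²/3)b}`. -/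
def Atilde (a b : ℝ) : Set (ℝ × ℝ) :=
  Aset (Real.pi ^ 2 / 3 * a) (Real.pi ^ 2 / 3 * b)

/-! ### Neighbours in the Farey set -/

/-- Two fractions with no fraction of denominator at most `Q` between them are unimodular
neighbours, and their mediant has denominator larger than `Q`. -/
lemma farey_neighbours_of_adjacent {p q p' q' Q : ℕ} (hc : p.Coprime q) (hq : 0 < q)
    (hqQ : q ≤ Q) (hq'0 : 0 < q') (hq'Q : q' ≤ Q) (hpq' : p' ≤ q')
    (hc' : p'.Coprime q') (hlt : p * q' < p' * q)
    (hadj : ∀ r s : ℕ, 0 < s → s ≤ Q → r ≤ s → ¬ (p * s < r * q ∧ r * q' < p' * s)) :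
    p' * q = p * q' + 1 ∧ Q < q + q' := by
  have hpq : p < q := by
    by_contra! h
    nlinarith [Nat.mul_le_mul h hpq']
  constructor
  · obtain ⟨s, r, hs, hsQ, hQs, hdet⟩ : ∃ s r : ℤ, 0 < s ∧ s ≤ Q ∧ Q < q + s ∧
        r * q = p * s + 1 := by
      have hb := Nat.gcd_eq_gcd_ab p q
      rw [hc.gcd_eq_one] at hb
      set t : ℤ := -Nat.gcdA p q
      have hq0 : (0 : ℤ) < q := by exact_mod_cast hq
      have h1 := Int.emod_nonneg ((Q : ℤ) - t) hq0.ne'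
      have h2 := Int.emod_lt_of_pos ((Q : ℤ) - t) hq0
      have h3 := Int.emod_add_mul_ediv ((Q : ℤ) - t) q
      refine ⟨Q - ((Q : ℤ) - t) % q, p * (((Q : ℤ) - t) / q) + Nat.gcdB p q, ?_, ?_, ?_, ?_⟩
      · have : (q : ℤ) ≤ Q := by exact_mod_cast hqQ
        linarith
      · linarith
      · linarith
      · have h4 : (Q : ℤ) - ((Q : ℤ) - t) % q = t + q * (((Q : ℤ) - t) / q) := by linarith
        rw [h4]
        push_cast at hb
        simp only [t] at hb ⊢
        linear_combination -hb
    have hr : 0 < r := by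
      by_contra! h
      nlinarith [mul_nonneg (Int.natCast_nonneg p) hs.le, mul_nonneg (neg_nonneg.2 h)
        (Int.natCast_nonneg q)]
    lift s to ℕ using hs.le
    lift r to ℕ using hr.le
    norm_cast at hs hsQ hQs hdet
    have hrs : r ≤ s := by
      by_contra! h
      nlinarith
    have key : p' * s ≤ r * q' := by
      by_contra! h
      exact hadj r s hs hsQ hrs ⟨by omega, h⟩
    rcases key.lt_or_eq with h | h
    · exfalso
      have e1 : p' * s + 1 ≤ r * q' := h
      have e2 : p * q' + 1 ≤ p' * q := hlt
      nlinarith [Nat.mul_le_mul_left q e1, Nat.mul_le_mul_left s e2,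
        congrArg (fun x => x * q') hdet]
    · have hcr : r.Coprime s := by
        have h1 := Nat.gcd_dvd_left r s
        have h2 := Nat.gcd_dvd_right r s
        have h3 : r.gcd s ∣ p * s + 1 := hdet ▸ h1.mul_right q
        exact Nat.dvd_one.1 ((Nat.dvd_add_right (h2.mul_left p)).1 h3)
      have hsq : s = q' := by
        apply Nat.dvd_antisymm
        · exact hcr.symm.dvd_of_dvd_mul_left ⟨p', by rw [← h]; ring⟩
        · exact hc'.symm.dvd_of_dvd_mul_left ⟨r, by rw [h]; ring⟩
      subst hsq
      rw [Nat.eq_of_mul_eq_mul_right hs h, hdet]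
  · by_contra! h
    exact hadj (p + p') (q + q') (by omega) h (by omega) ⟨by nlinarith, by nlinarith⟩

/-- No fraction of denominator at most `Q` lies strictly between unimodular neighbours whose
denominators have sum larger than `Q`. -/
lemma not_between_of_det_eq_one {p q p' q' r s Q : ℕ} (hdet : p' * q = p * q' + 1)
    (hQ : Q < q + q') (hs : s ≤ Q) : ¬ (p * s < r * q ∧ r * q' < p' * s) := by
  rintro ⟨h1, h2⟩
  have e1 : p * s + 1 ≤ r * q := h1
  have e2 : r * q' + 1 ≤ p' * s := h2
  nlinarith [Nat.mul_le_mul_left q' e1, Nat.mul_le_mul_left q e2,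
    congrArg (fun x => x * s) hdet]

/-- Every coprime pair of denominators occurs as a pair of unimodular neighbours in `[0, 1]`. -/
lemma exists_numerators_of_coprime {q q' : ℕ} (hq : 0 < q) (hq' : 0 < q')
    (hc : q.Coprime q') : ∃ p p' : ℕ, p < q ∧ p' ≤ q' ∧ p' * q = p * q' + 1 := by
  have hb := Nat.gcd_eq_gcd_ab q q'
  rw [hc.gcd_eq_one] at hb
  have hq0 : (0 : ℤ) < q := by exact_mod_cast hq
  set t : ℤ := -Nat.gcdB q q' with ht
  have h1 := Int.emod_nonneg t hq0.ne'
  have h2 := Int.emod_lt_of_pos t hq0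
  have h3 := Int.emod_add_mul_ediv t q
  obtain ⟨p, hp⟩ := Int.eq_ofNat_of_zero_le h1
  have hdet : (Nat.gcdA q q' - q' * (t / q)) * q = p * q' + 1 := by
    rw [← hp]
    push_cast at hb
    linear_combination (-1) * hb + (q' : ℤ) * (ht - h3)
  have hpos : 0 ≤ Nat.gcdA q q' - q' * (t / q) := by
    by_contra! h
    nlinarith [Int.natCast_nonneg (p * q')]
  obtain ⟨p', hp'⟩ := Int.eq_ofNat_of_zero_le hpos
  rw [hp'] at hdet
  rw [hp] at h2
  norm_cast at hdet h2
  refine ⟨p, p', h2, ?_, hdet⟩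
  by_contra! h
  nlinarith

/-- The numerator of the left neighbour is determined by the two denominators. -/
lemma numerator_unique_of_det_eq_one {q q' p p' r r' : ℕ} (hp : p < q) (hr : r < q)
    (h1 : p' * q = p * q' + 1) (h2 : r' * q = r * q' + 1) : p = r := by
  have hc : Int.gcd (q : ℤ) q' = 1 := by
    have h : q.gcd q' ∣ p * q' + 1 := h1 ▸ (Nat.gcd_dvd_left q q').mul_left p'
    exact Nat.dvd_one.1 ((Nat.dvd_add_right ((Nat.gcd_dvd_right q q').mul_left p)).1 h)
  have h : (q : ℤ) ∣ q' * ((p : ℤ) - r) := ⟨(p' : ℤ) - r', by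
    zify at h1 h2
    linear_combination h2 - h1⟩
  have h3 := Int.dvd_of_dvd_mul_right_of_gcd_one h hc
  have h4 := Int.eq_zero_of_abs_lt_dvd h3 (by rw [abs_lt]; omega)
  omega

/-! ### The Möbius series at `2` -/

open ArithmeticFunction in
lemma tsum_moebius_div_sq :
    ∑' d : ℕ, (moebius d : ℝ) / (d : ℝ) ^ 2 = 6 / Real.pi ^ 2 := by
  have h := LSeries_one_mul_Lseries_moebius (s := 2) (by norm_num)
  rw [LSeries_one_eq_riemannZeta (by norm_num), riemannZeta_two] at h
  have h2 : LSeries (fun n => ((moebius n : ℤ) : ℂ)) 2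
      = ((∑' d : ℕ, (moebius d : ℝ) / (d : ℝ) ^ 2 : ℝ) : ℂ) := by
    rw [LSeries, Complex.ofReal_tsum]
    refine tsum_congr fun n => ?_
    rcases eq_or_ne n 0 with rfl | hn
    · simp
    · rw [LSeries.term_of_ne_zero hn]
      push_cast
      norm_cast
  rw [h2] at h
  have h3 : Real.pi ^ 2 / 6 * ∑' d : ℕ, (moebius d : ℝ) / (d : ℝ) ^ 2 = 1 := by
    exact_mod_cast h
  have := Real.pi_ne_zero
  field_simp at h3 ⊢
  linarith

open ArithmeticFunction in
/-- Möbius inversion detects coprimality. -/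
lemma sum_moebius_common_divisors {m n Q : ℕ} (hm : 0 < m) (hmQ : m ≤ Q) :
    ∑ d ∈ Finset.Icc 1 Q, (if d ∣ m ∧ d ∣ n then moebius d else 0)
      = if m.Coprime n then 1 else 0 := by
  have h : (moebius * zeta : ArithmeticFunction ℤ) (m.gcd n) = _ :=
    congrArg (fun f : ArithmeticFunction ℤ => f (m.gcd n)) moebius_mul_coe_zeta
  rw [coe_mul_zeta_apply, one_apply] at h
  change _ = if m.gcd n = 1 then (1 : ℤ) else 0
  rw [← h, ← Finset.sum_filter]
  refine Finset.sum_congr ?_ fun _ _ => rfl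
  ext d
  simp only [Finset.mem_filter, Finset.mem_Icc, Nat.mem_divisors, Nat.dvd_gcd_iff]
  constructor
  · rintro ⟨_, hd⟩
    exact ⟨hd, (Nat.gcd_pos_of_pos_left n hm).ne'⟩
  · rintro ⟨hd, _⟩
    exact ⟨⟨Nat.pos_of_dvd_of_pos hd.1 hm, (Nat.le_of_dvd hm hd.1).trans hmQ⟩, hd⟩

/-! ### Counting dilated lattice points -/

open Classical in
/-- The number of pairs `(m, n)` of integers in `[1, Q]` with `(d m / Q, d n / Q) ∈ S`. -/
def latticeCount (S : Set (ℝ × ℝ)) (Q d : ℕ) : ℕ :=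
  {x ∈ Finset.Icc 1 Q ×ˢ Finset.Icc 1 Q |
    (((d * x.1 : ℕ) : ℝ) / Q, ((d * x.2 : ℕ) : ℝ) / Q) ∈ S}.card

open Classical in
/-- The number of coprime pairs `(m, n)` of integers in `[1, Q]` with `(m / Q, n / Q) ∈ S`. -/
def primitiveCount (S : Set (ℝ × ℝ)) (Q : ℕ) : ℕ :=
  {x ∈ Finset.Icc 1 Q ×ˢ Finset.Icc 1 Q |
    x.1.Coprime x.2 ∧ ((x.1 : ℝ) / Q, (x.2 : ℝ) / Q) ∈ S}.card

open ArithmeticFunction in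
lemma primitiveCount_eq_sum_moebius (S : Set (ℝ × ℝ)) (hS : S ⊆ Set.Ioc 0 1 ×ˢ Set.Ioc 0 1)
    (Q : ℕ) :
    (primitiveCount S Q : ℤ) = ∑ d ∈ Finset.Icc 1 Q, moebius d * latticeCount S Q d := by
  classical
  have h1 : (primitiveCount S Q : ℤ) = ∑ x ∈ Finset.Icc 1 Q ×ˢ Finset.Icc 1 Q with
      ((x.1 : ℝ) / Q, (x.2 : ℝ) / Q) ∈ S,
      ∑ d ∈ Finset.Icc 1 Q, (if d ∣ x.1 ∧ d ∣ x.2 then moebius d else 0) := by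
    rw [primitiveCount, Finset.card_filter, Finset.sum_filter, Nat.cast_sum]
    refine Finset.sum_congr rfl fun x hx => ?_
    simp only [Finset.mem_product, Finset.mem_Icc] at hx
    rw [sum_moebius_common_divisors hx.1.1 hx.1.2]
    by_cases hc : x.1.Coprime x.2 <;> by_cases hm : ((x.1 : ℝ) / Q, (x.2 : ℝ) / Q) ∈ S <;>
      simp [hc, hm]
  rw [h1, Finset.sum_comm]
  refine Finset.sum_congr rfl fun d hd => ?_
  have hd1 : 1 ≤ d := (Finset.mem_Icc.1 hd).1
  rw [← Finset.sum_filter, Finset.sum_const, nsmul_eq_mul, mul_comm]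
  congr 2
  symm
  refine Finset.card_bij (fun x _ => (d * x.1, d * x.2)) ?_ ?_ ?_
  · intro x hx
    simp only [Finset.mem_filter, Finset.mem_product, Finset.mem_Icc] at hx ⊢
    obtain ⟨⟨⟨hm, hmQ⟩, hn, hnQ⟩, hx⟩ := hx
    have hQ : (0 : ℝ) < Q := by exact_mod_cast hm.trans hmQ
    have hb := hS hx
    simp only [Set.mem_prod, Set.mem_Ioc, div_le_one hQ, Nat.cast_le] at hb
    exact ⟨⟨⟨⟨Nat.mul_pos hd1 hm, hb.1.2⟩, Nat.mul_pos hd1 hn, hb.2.2⟩, hx⟩,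
      dvd_mul_right _ _, dvd_mul_right _ _⟩
  · intro x _ y _ hxy
    simp only [Prod.mk.injEq] at hxy
    exact Prod.ext (Nat.eq_of_mul_eq_mul_left hd1 hxy.1) (Nat.eq_of_mul_eq_mul_left hd1 hxy.2)
  · rintro ⟨u, v⟩ hy
    simp only [Finset.mem_filter, Finset.mem_product, Finset.mem_Icc] at hy
    obtain ⟨⟨⟨⟨hu, huQ⟩, hv, hvQ⟩, hy⟩, ⟨m, rfl⟩, ⟨n, rfl⟩⟩ := hy
    refine ⟨(m, n), ?_, rfl⟩
    simp only [Finset.mem_filter, Finset.mem_product, Finset.mem_Icc]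
    exact ⟨⟨⟨Nat.pos_of_mul_pos_left hu, (Nat.le_mul_of_pos_left m hd1).trans huQ⟩,
      Nat.pos_of_mul_pos_left hv, (Nat.le_mul_of_pos_left n hd1).trans hvQ⟩, hy⟩

lemma latticeCount_le_sq (S : Set (ℝ × ℝ)) (hS : S ⊆ Set.Ioc 0 1 ×ˢ Set.Ioc 0 1) {Q d : ℕ}
    (hd : 0 < d) : latticeCount S Q d ≤ (Q / d) ^ 2 := by
  classical
  have h : latticeCount S Q d ≤
      (Finset.Icc 1 (Q / d) ×ˢ Finset.Icc 1 (Q / d)).card := by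
    refine Finset.card_le_card fun x hx => ?_
    simp only [Finset.mem_filter, Finset.mem_product, Finset.mem_Icc] at hx ⊢
    obtain ⟨⟨⟨hm, hmQ⟩, hn, hnQ⟩, hx⟩ := hx
    have hQ : (0 : ℝ) < Q := by exact_mod_cast hm.trans hmQ
    have hb := hS hx
    simp only [Set.mem_prod, Set.mem_Ioc, div_le_one hQ, Nat.cast_le] at hb
    exact ⟨⟨hm, (Nat.le_div_iff_mul_le hd).2 (by linarith [hb.1.2])⟩, hn,
      (Nat.le_div_iff_mul_le hd).2 (by linarith [hb.2.2])⟩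
  simpa [sq] using h

lemma latticeCount_div_sq_le (S : Set (ℝ × ℝ)) (hS : S ⊆ Set.Ioc 0 1 ×ˢ Set.Ioc 0 1)
    (Q : ℕ) {d : ℕ} (hd : 0 < d) :
    (latticeCount S Q d : ℝ) / (Q : ℝ) ^ 2 ≤ 1 / (d : ℝ) ^ 2 := by
  rcases Nat.eq_zero_or_pos Q with rfl | hQ
  · simp
  have h1 : (latticeCount S Q d : ℝ) ≤ ((Q : ℝ) / d) ^ 2 := by
    calc (latticeCount S Q d : ℝ) ≤ (((Q / d : ℕ) : ℝ)) ^ 2 := by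
          exact_mod_cast latticeCount_le_sq S hS hd
      _ ≤ _ := by gcongr; exact Nat.cast_div_le
  have hQ' : (0 : ℝ) < Q := by exact_mod_cast hQ
  calc (latticeCount S Q d : ℝ) / (Q : ℝ) ^ 2 ≤ ((Q : ℝ) / d) ^ 2 / (Q : ℝ) ^ 2 := by gcongr
    _ = _ := by field_simp

/-- The lattice point of the grid of mesh `h` at the upper right corner of the cell of `p`. -/
def gridCorner (h : ℝ) (p : ℝ × ℝ) : ℝ × ℝ :=
  (h * (⌈p.1 / h⌉₊ : ℝ), h * (⌈p.2 / h⌉₊ : ℝ))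

lemma measurable_gridCorner (h : ℝ) : Measurable (gridCorner h) := by
  unfold gridCorner
  have : Measurable (fun n : ℕ => (n : ℝ)) := measurable_from_top
  exact ((this.comp (Nat.measurable_ceil.comp (measurable_fst.div_const h))).const_mul h).prodMk
    ((this.comp (Nat.measurable_ceil.comp (measurable_snd.div_const h))).const_mul h)

/-- The number of lattice points in `S` is the normalized area of the corresponding cells. -/
lemma volume_gridCorner_preimage (S : Set (ℝ × ℝ)) (hS : S ⊆ Set.Ioc 0 1 ×ˢ Set.Ioc 0 1)
    {Q d : ℕ} (hQ : 0 < Q) (hd : 0 < d) :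
    (volume (gridCorner ((d : ℝ) / Q) ⁻¹' S)).toReal
      = latticeCount S Q d * ((d : ℝ) / Q) ^ 2 := by
  classical
  set h : ℝ := (d : ℝ) / Q with hh
  have hQ' : (0 : ℝ) < Q := by exact_mod_cast hQ
  have hd' : (0 : ℝ) < d := by exact_mod_cast hd
  have hpos : 0 < h := by positivity
  let cell : ℕ × ℕ → Set (ℝ × ℝ) := fun x =>
    Set.Ioc (h * ((x.1 - 1 : ℕ) : ℝ)) (h * x.1) ×ˢ Set.Ioc (h * ((x.2 - 1 : ℕ) : ℝ)) (h * x.2)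
  have hceil : ∀ (t : ℝ) (n : ℕ), 1 ≤ n →
      (t ∈ Set.Ioc (h * ((n - 1 : ℕ) : ℝ)) (h * n) ↔ ⌈t / h⌉₊ = n) := by
    intro t n hn
    rw [Nat.ceil_eq_iff (by omega), lt_div_iff₀ hpos, div_le_iff₀ hpos, Set.mem_Ioc,
      mul_comm h, mul_comm h]
  set F : Finset (ℕ × ℕ) := {x ∈ Finset.Icc 1 Q ×ˢ Finset.Icc 1 Q |
    (((d * x.1 : ℕ) : ℝ) / Q, ((d * x.2 : ℕ) : ℝ) / Q) ∈ S} with hF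
  have hF1 : ∀ x ∈ F, 1 ≤ x.1 ∧ 1 ≤ x.2 := by
    intro x hx
    simp only [hF, Finset.mem_filter, Finset.mem_product, Finset.mem_Icc] at hx
    exact ⟨hx.1.1.1, hx.1.2.1⟩
  have hmul : ∀ n : ℕ, ((d * n : ℕ) : ℝ) / Q = h * n := by
    intro n
    rw [hh]
    push_cast
    ring
  have hunion : gridCorner h ⁻¹' S = ⋃ x ∈ F, cell x := by
    ext p
    simp only [Set.mem_preimage, Set.mem_iUnion, exists_prop]
    constructor
    · intro hp
      have hb := hS hp
      have hbound : ∀ n : ℕ, 0 < h * (n : ℝ) ∧ h * (n : ℝ) ≤ 1 → 1 ≤ n ∧ n ≤ Q := by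
        rintro n ⟨h0, h1⟩
        rw [← hmul] at h0 h1
        rw [div_le_one hQ', Nat.cast_le] at h1
        refine ⟨Nat.pos_of_ne_zero ?_, (Nat.le_mul_of_pos_left n hd).trans h1⟩
        rintro rfl
        simp at h0
      have b1 := hbound _ hb.1
      have b2 := hbound _ hb.2
      refine ⟨(⌈p.1 / h⌉₊, ⌈p.2 / h⌉₊), ?_, ?_⟩
      · simp only [hF, Finset.mem_filter, Finset.mem_product, Finset.mem_Icc]
        refine ⟨⟨b1, b2⟩, ?_⟩
        rw [hmul, hmul]
        exact hp
      · exact ⟨(hceil _ _ b1.1).2 rfl, (hceil _ _ b2.1).2 rfl⟩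
    · rintro ⟨x, hx, hpx⟩
      have hx1 := hF1 x hx
      have e1 := (hceil _ _ hx1.1).1 hpx.1
      have e2 := (hceil _ _ hx1.2).1 hpx.2
      simp only [hF, Finset.mem_filter, hmul] at hx
      simp only [gridCorner, e1, e2]
      exact hx.2
  have hdisj : Set.PairwiseDisjoint (↑F : Set (ℕ × ℕ)) cell := by
    intro x hx y hy hxy
    refine Set.disjoint_left.2 fun p hpx hpy => hxy ?_
    have hx1 := hF1 x hx
    have hy1 := hF1 y hy
    exact Prod.ext
      (((hceil _ _ hx1.1).1 hpx.1).symm.trans ((hceil _ _ hy1.1).1 hpy.1))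
      (((hceil _ _ hx1.2).1 hpx.2).symm.trans ((hceil _ _ hy1.2).1 hpy.2))
  have hvol : ∀ x ∈ F, volume (cell x) = ENNReal.ofReal (h ^ 2) := by
    intro x hx
    have hx1 := hF1 x hx
    simp only [cell]
    rw [Measure.volume_eq_prod, Measure.prod_prod, Real.volume_Ioc, Real.volume_Ioc,
      Nat.cast_sub hx1.1, Nat.cast_sub hx1.2, sq, ENNReal.ofReal_mul hpos.le]
    congr 2 <;> push_cast <;> ring
  rw [hunion, measure_biUnion_finset hdisj
    (fun x _ => measurableSet_Ioc.prod measurableSet_Ioc), Finset.sum_congr rfl hvol,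
    Finset.sum_const, nsmul_eq_mul, ENNReal.toReal_mul, ENNReal.toReal_natCast,
    ENNReal.toReal_ofReal (by positivity)]
  rfl

/-- Equidistribution of lattice points, for sets `S Q` that converge to `A` almost everywhere. -/
lemma tendsto_latticeCount_div_sq (S : ℕ → Set (ℝ × ℝ)) (A : Set (ℝ × ℝ))
    (hSm : ∀ Q, MeasurableSet (S Q)) (hAm : MeasurableSet A)
    (hS : ∀ Q, S Q ⊆ Set.Ioc 0 1 ×ˢ Set.Ioc 0 1) (hA : A ⊆ Set.Ioc 0 1 ×ˢ Set.Ioc 0 1)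
    (hlim : ∀ᵐ p : ℝ × ℝ, ∀ f : ℕ → ℝ × ℝ, Tendsto f atTop (𝓝 p) →
      ∀ᶠ Q in atTop, (f Q ∈ S Q ↔ p ∈ A)) {d : ℕ} (hd : 0 < d) :
    Tendsto (fun Q : ℕ => (latticeCount (S Q) Q d : ℝ) / (Q : ℝ) ^ 2) atTop
      (𝓝 ((volume A).toReal / (d : ℝ) ^ 2)) := by
  have hd' : (0 : ℝ) < d := by exact_mod_cast hd
  have hcorner : ∀ t : ℝ, 0 ≤ t →
      Tendsto (fun Q : ℕ => (d : ℝ) / Q * (⌈t / ((d : ℝ) / Q)⌉₊ : ℝ)) atTop (𝓝 t) := by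
    intro t ht
    have h1 : Tendsto (fun Q : ℕ => (Q : ℝ) / d) atTop atTop :=
      tendsto_natCast_atTop_atTop.atTop_div_const hd'
    refine ((tendsto_nat_ceil_mul_div_atTop ht).comp h1).congr fun Q => ?_
    simp only [Function.comp]
    rw [div_div_eq_mul_div, ← mul_div_assoc, div_div_eq_mul_div]
    ring
  have key : Tendsto (fun Q : ℕ => volume (gridCorner ((d : ℝ) / Q) ⁻¹' S Q)) atTop
      (𝓝 (volume A)) := by
    refine tendsto_measure_of_ae_tendsto_indicator (B := Set.Icc 0 1 ×ˢ Set.Icc 0 1) atTop hAm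
      (fun Q => measurable_gridCorner _ (hSm Q))
      (measurableSet_Icc.prod measurableSet_Icc) ?_ ?_ ?_
    · exact (isCompact_Icc.prod isCompact_Icc).measure_lt_top.ne
    · filter_upwards [eventually_gt_atTop 0] with Q hQ p hp
      have hQ' : (0 : ℝ) < Q := by exact_mod_cast hQ
      have hpos : 0 < (d : ℝ) / Q := by positivity
      have hb := hS Q hp
      have hbound : ∀ t : ℝ, (d : ℝ) / Q * (⌈t / ((d : ℝ) / Q)⌉₊ : ℝ) ∈ Set.Ioc 0 1 →
          t ∈ Set.Icc (0 : ℝ) 1 := by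
        rintro t ⟨h0, h1⟩
        constructor
        · by_contra! ht
          rw [Nat.ceil_eq_zero.2 (div_nonpos_of_nonpos_of_nonneg ht.le hpos.le)] at h0
          simp at h0
        · have h2 := Nat.le_ceil (t / ((d : ℝ) / Q))
          rw [div_le_iff₀' hpos] at h2
          exact h2.trans h1
      exact ⟨hbound _ hb.1, hbound _ hb.2⟩
    · filter_upwards [hlim] with p hp
      by_cases h : 0 ≤ p.1 ∧ 0 ≤ p.2
      · exact hp _ ((hcorner p.1 h.1).prodMk_nhds (hcorner p.2 h.2))
      · refine Eventually.of_forall fun Q => iff_of_false (fun hpS => h ?_) fun hpA => ?_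
        · have hb := hS Q hpS
          have hneg : ∀ t : ℝ, 0 < (d : ℝ) / Q * (⌈t / ((d : ℝ) / Q)⌉₊ : ℝ) → 0 ≤ t := by
            intro t h0
            by_contra! ht
            rw [Nat.ceil_eq_zero.2 (div_nonpos_of_nonpos_of_nonneg ht.le (by positivity))] at h0
            simp at h0
          exact ⟨hneg _ hb.1.1, hneg _ hb.2.1⟩
        · have hb := hA hpA
          exact h ⟨hb.1.1.le, hb.2.1.le⟩
  have hfin : volume A ≠ ⊤ := ((measure_mono hA).trans_lt
    ((measure_mono (Set.prod_mono Set.Ioc_subset_Icc_self Set.Ioc_subset_Icc_self)).trans_lt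
      (isCompact_Icc.prod isCompact_Icc).measure_lt_top)).ne
  have h2 := (((ENNReal.tendsto_toReal hfin).comp key).div_const ((d : ℝ) ^ 2))
  refine h2.congr' ?_
  filter_upwards [eventually_gt_atTop 0] with Q hQ
  have hQ' : (0 : ℝ) < Q := by exact_mod_cast hQ
  simp only [Function.comp]
  rw [volume_gridCorner_preimage _ (hS Q) hQ hd]
  field_simp

/-- Equidistribution of primitive lattice points, for sets `S Q` that converge to `A` almost
everywhere. -/
lemma tendsto_primitiveCount_div_sq (S : ℕ → Set (ℝ × ℝ)) (A : Set (ℝ × ℝ))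
    (hSm : ∀ Q, MeasurableSet (S Q)) (hAm : MeasurableSet A)
    (hS : ∀ Q, S Q ⊆ Set.Ioc 0 1 ×ˢ Set.Ioc 0 1) (hA : A ⊆ Set.Ioc 0 1 ×ˢ Set.Ioc 0 1)
    (hlim : ∀ᵐ p : ℝ × ℝ, ∀ f : ℕ → ℝ × ℝ, Tendsto f atTop (𝓝 p) →
      ∀ᶠ Q in atTop, (f Q ∈ S Q ↔ p ∈ A)) :
    Tendsto (fun Q : ℕ => (primitiveCount (S Q) Q : ℝ) / (Q : ℝ) ^ 2) atTop
      (𝓝 (6 / Real.pi ^ 2 * (volume A).toReal)) := by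
  have hsum : ∀ Q : ℕ, ∑' d : ℕ, (ArithmeticFunction.moebius d : ℝ) *
      ((latticeCount (S Q) Q d : ℝ) / (Q : ℝ) ^ 2)
        = (primitiveCount (S Q) Q : ℝ) / (Q : ℝ) ^ 2 := by
    intro Q
    rw [tsum_eq_sum (s := Finset.Icc 1 Q)]
    · have h := congrArg (fun z : ℤ => (z : ℝ)) (primitiveCount_eq_sum_moebius (S Q) (hS Q) Q)
      push_cast at h
      rw [h, Finset.sum_div]
      exact Finset.sum_congr rfl fun d _ => (mul_div_assoc _ _ _).symm
    · intro d hd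
      rcases Nat.eq_zero_or_pos d with rfl | hd0
      · simp
      · have hlt : Q < d := by
          by_contra! h
          exact hd (Finset.mem_Icc.2 ⟨hd0, h⟩)
        have h := latticeCount_le_sq (S Q) (hS Q) (Q := Q) hd0
        rw [Nat.div_eq_of_lt hlt] at h
        simp [Nat.le_zero.1 h]
  have hval : ∑' d : ℕ, (ArithmeticFunction.moebius d : ℝ) *
      ((volume A).toReal / (d : ℝ) ^ 2) = 6 / Real.pi ^ 2 * (volume A).toReal := by
    rw [← tsum_moebius_div_sq, ← tsum_mul_right]
    exact tsum_congr fun d => by ring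
  rw [← hval]
  simp_rw [← hsum]
  refine tendsto_tsum_of_dominated_convergence (bound := fun d : ℕ => 1 / (d : ℝ) ^ 2)
    (Real.summable_one_div_nat_pow.2 one_lt_two) ?_ ?_
  · intro d
    rcases Nat.eq_zero_or_pos d with rfl | hd0
    · simp
    · exact (tendsto_latticeCount_div_sq S A hSm hAm hS hA hlim hd0).const_mul _
  · refine Eventually.of_forall fun Q d => ?_
    rcases Nat.eq_zero_or_pos d with rfl | hd0
    · simp
    · rw [norm_mul, Real.norm_eq_abs, Real.norm_of_nonneg (by positivity)]
      have h1 : |(ArithmeticFunction.moebius d : ℝ)| ≤ 1 := by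
        exact_mod_cast ArithmeticFunction.abs_moebius_le_one (n := d)
      calc _ ≤ 1 * ((latticeCount (S Q) Q d : ℝ) / (Q : ℝ) ^ 2) := by gcongr
        _ ≤ _ := by rw [one_mul]; exact latticeCount_div_sq_le (S Q) (hS Q) Q hd0

/-! ### The limiting regions -/

lemma ae_ne_of_slices (g : ℝ × ℝ → ℝ) (hg : Measurable g) (c : ℝ)
    (h : ∀ u, {v | g (u, v) = c}.Subsingleton) : ∀ᵐ p : ℝ × ℝ, g p ≠ c := by
  rw [ae_iff]
  have hm : MeasurableSet {p : ℝ × ℝ | ¬ g p ≠ c} := by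
    have : {p : ℝ × ℝ | ¬ g p ≠ c} = g ⁻¹' {c} := by
      ext p
      simp
    exact this ▸ hg (measurableSet_singleton c)
  rw [Measure.volume_eq_prod, Measure.measure_prod_null hm]
  refine Eventually.of_forall fun u => ?_
  have hs : (Prod.mk u ⁻¹' {p : ℝ × ℝ | ¬ g p ≠ c}).Subsingleton := by
    simpa using! h u
  exact hs.measure_zero _

lemma ae_ne_fst (c : ℝ) : ∀ᵐ p : ℝ × ℝ, p.1 ≠ c := by
  have h := (Measure.quasiMeasurePreserving_fst (μ := (volume : Measure ℝ))
    (ν := (volume : Measure ℝ))).ae (p := fun x => x ≠ c) (by simp [ae_iff])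
  exact h

lemma eventually_lt_iff_of_tendsto {ι : Type*} {l : Filter ι} {f g : ι → ℝ} {x y : ℝ}
    (hf : Tendsto f l (𝓝 x)) (hg : Tendsto g l (𝓝 y)) (h : x ≠ y) :
    ∀ᶠ i in l, (f i < g i ↔ x < y) := by
  rcases h.lt_or_gt with h | h
  · filter_upwards [hf.eventually_lt hg h] with i hi
    exact iff_of_true hi h
  · filter_upwards [hg.eventually_lt hf h] with i hi
    exact iff_of_false hi.le.not_gt h.le.not_gt

lemma eventually_mem_Ioc_iff_of_tendsto {f : ℕ → ℝ} {x c d : ℝ}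
    (hf : Tendsto f atTop (𝓝 x)) (hc : x ≠ c) (hd : x ≠ d) :
    ∀ᶠ i in atTop, (f i ∈ Set.Ioc c d ↔ x ∈ Set.Ioc c d) := by
  filter_upwards [eventually_lt_iff_of_tendsto tendsto_const_nhds hf hc.symm,
    eventually_lt_iff_of_tendsto tendsto_const_nhds hf hd.symm] with i h1 h2
  rw [Set.mem_Ioc, Set.mem_Ioc, ← not_lt, ← not_lt, h1, h2]

lemma NQ_eq_primitiveCount (Q : ℕ) :
    NQ Q = primitiveCount
      {p | p.1 ∈ Set.Ioc 0 1 ∧ p.2 ∈ Set.Ioc 0 1 ∧ p.2 ≤ p.1} Q := by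
  classical
  have h : ∀ m ∈ Finset.Icc 1 Q, Nat.totient m
      = ({n ∈ Finset.Icc 1 Q | m.Coprime n ∧ n ≤ m}).card := by
    intro m hm
    rw [← Nat.filter_coprime_Ico_eq_totient m 1]
    congr 1
    ext n
    simp only [Finset.mem_Icc] at hm
    simp only [Finset.mem_filter, Finset.mem_Ico, Finset.mem_Icc]
    constructor
    · rintro ⟨h1, h2⟩
      exact ⟨⟨h1.1, by omega⟩, h2, by omega⟩
    · rintro ⟨h1, h2, h3⟩
      exact ⟨⟨h1.1, by omega⟩, h2⟩
  rw [NQ, Finset.sum_congr rfl h, primitiveCount, Finset.card_filter, Finset.sum_product]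
  refine Finset.sum_congr rfl fun m hm => ?_
  rw [Finset.card_filter]
  refine Finset.sum_congr rfl fun n hn => ?_
  rw [Finset.mem_Icc] at hm hn
  have hQ : (0 : ℝ) < Q := by exact_mod_cast hm.1.trans hm.2
  have hm0 : (0 : ℝ) < m := by exact_mod_cast hm.1
  have hn0 : (0 : ℝ) < n := by exact_mod_cast hn.1
  simp only [Set.mem_ofPred_eq, Set.mem_Ioc, div_le_one hQ, Nat.cast_le,
    div_le_div_iff_of_pos_right hQ, hm.2, hn.2, div_pos hm0 hQ, div_pos hn0 hQ, true_and]

lemma volume_triangle :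
    (volume {p : ℝ × ℝ | p.1 ∈ Set.Ioc 0 1 ∧ p.2 ∈ Set.Ioo 0 p.1}).toReal = 1 / 2 := by
  have h := volume_regionBetween_eq_integral (μ := (volume : Measure ℝ)) (f := fun _ => (0 : ℝ))
    (g := fun x => x) (s := Set.Ioc 0 1) (integrableOn_const (by simp))
    ((continuous_id.integrableOn_Icc (a := 0) (b := 1)).mono_set Set.Ioc_subset_Icc_self)
    measurableSet_Ioc (fun x hx => hx.1.le)
  have h2 : ∫ y in Set.Ioc (0 : ℝ) 1, ((fun x => x) - fun _ => 0 : ℝ → ℝ) y = 1 / 2 := by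
    rw [← intervalIntegral.integral_of_le zero_le_one]
    simp
  rw [h2] at h
  change (volume (regionBetween (fun _ => (0 : ℝ)) (fun x => x) (Set.Ioc 0 1))).toReal = 1 / 2
  rw [Measure.volume_eq_prod, h, ENNReal.toReal_ofReal (by norm_num)]

/-- The number of Farey fractions of level `Q` is asymptotic to `3 Q² / π²`. -/
lemma tendsto_NQ_div_sq :
    Tendsto (fun Q : ℕ => (NQ Q : ℝ) / (Q : ℝ) ^ 2) atTop (𝓝 (3 / Real.pi ^ 2)) := by
  have h := tendsto_primitiveCount_div_sq
    (fun _ => {p | p.1 ∈ Set.Ioc 0 1 ∧ p.2 ∈ Set.Ioc 0 1 ∧ p.2 ≤ p.1})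
    {p : ℝ × ℝ | p.1 ∈ Set.Ioc 0 1 ∧ p.2 ∈ Set.Ioo 0 p.1}
    (fun _ => (measurable_fst measurableSet_Ioc).inter
      ((measurable_snd measurableSet_Ioc).inter (measurableSet_le measurable_snd measurable_fst)))
    ((measurable_fst measurableSet_Ioc).inter
      ((measurableSet_lt measurable_const measurable_snd).inter
        (measurableSet_lt measurable_snd measurable_fst)))
    (fun _ p hp => ⟨hp.1, hp.2.1⟩)
    (fun p hp => ⟨hp.1, hp.2.1, hp.2.2.le.trans hp.1.2⟩) ?_
  · rw [volume_triangle] at h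
    simp_rw [← NQ_eq_primitiveCount] at h
    convert! h using 2
    ring
  · filter_upwards [ae_ne_fst 0, ae_ne_fst 1,
      ae_ne_of_slices Prod.snd measurable_snd 0 (fun _ _ h _ h' => h.trans h'.symm),
      ae_ne_of_slices Prod.snd measurable_snd 1 (fun _ _ h _ h' => h.trans h'.symm),
      ae_ne_of_slices (fun p => p.2 - p.1) (by fun_prop) 0 (fun u v h v' h' => by
        simp only [Set.mem_ofPred_eq] at h h'; linarith)] with p h1 h2 h3 h4 h5 f hf
    have hf1 := (continuous_fst.tendsto p).comp hf
    have hf2 := (continuous_snd.tendsto p).comp hf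
    filter_upwards [eventually_mem_Ioc_iff_of_tendsto hf1 h1 h2,
      eventually_mem_Ioc_iff_of_tendsto hf2 h3 h4,
      eventually_lt_iff_of_tendsto hf1 hf2 (fun h => h5 (by rw [h, sub_self]))] with Q e1 e2 e3
    simp only [Function.comp] at e1 e2 e3
    simp only [e1, e2, ← not_lt, e3]
    simp only [not_lt]
    constructor
    · rintro ⟨a1, a2, a3⟩
      exact ⟨a1, a2.1, lt_of_le_of_ne a3 fun h => h5 (by rw [h, sub_self])⟩
    · rintro ⟨a1, a2⟩
      exact ⟨a1, ⟨a2.1, a2.2.le.trans a1.2⟩, a2.2.le⟩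

/-- The region of rescaled denominators `(u, v)` of neighbours with `a < r / (u v) < b`. -/
def gapRegion (a b r : ℝ) : Set (ℝ × ℝ) :=
  {p | p.1 ∈ Set.Ioc 0 1 ∧ p.2 ∈ Set.Ioc 0 1 ∧ 1 < p.1 + p.2 ∧
    a * (p.1 * p.2) < r ∧ r < b * (p.1 * p.2)}

lemma measurableSet_gapRegion (a b r : ℝ) : MeasurableSet (gapRegion a b r) :=
  have hprod : Measurable fun p : ℝ × ℝ => p.1 * p.2 := by fun_prop
  (measurable_fst measurableSet_Ioc).inter <| (measurable_snd measurableSet_Ioc).inter <|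
    (measurableSet_lt measurable_const (measurable_fst.add measurable_snd)).inter <|
      (measurableSet_lt (hprod.const_mul a) measurable_const).inter <|
        measurableSet_lt measurable_const (hprod.const_mul b)

lemma Atilde_eq_gapRegion (a b : ℝ) : Atilde a b = gapRegion a b (3 / Real.pi ^ 2) := by
  have hpi : 0 < Real.pi ^ 2 := by positivity
  ext ⟨u, v⟩
  simp only [Atilde, Aset, regOmega, gapRegion, Set.mem_ofPred_eq, Set.mem_Icc, Set.mem_Ioc]
  rw [lt_div_iff₀ hpi, div_lt_iff₀ hpi]
  constructor
  · rintro ⟨⟨⟨h1, h2⟩, ⟨h3, h4⟩, h5⟩, h6, h7⟩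
    exact ⟨⟨by linarith, h2⟩, ⟨by linarith, h4⟩, h5, by linarith, by linarith⟩
  · rintro ⟨⟨h1, h2⟩, ⟨h3, h4⟩, h5, h6, h7⟩
    exact ⟨⟨⟨h1.le, h2⟩, ⟨h3.le, h4⟩, h5⟩, by linarith, by linarith⟩

lemma tendsto_primitiveCount_gapRegion (a b : ℝ) {r : ℕ → ℝ} {ρ : ℝ} (hρ : ρ ≠ 0)
    (hr : Tendsto r atTop (𝓝 ρ)) :
    Tendsto (fun Q : ℕ => (primitiveCount (gapRegion a b (r Q)) Q : ℝ) / (Q : ℝ) ^ 2) atTop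
      (𝓝 (6 / Real.pi ^ 2 * (volume (gapRegion a b ρ)).toReal)) := by
  have hmul : ∀ c : ℝ, ∀ᵐ p : ℝ × ℝ, c * (p.1 * p.2) ≠ ρ := by
    intro c
    refine ae_ne_of_slices (fun p => c * (p.1 * p.2)) (by fun_prop) ρ ?_
    intro u v h v' h'
    simp only [Set.mem_ofPred_eq] at h h'
    have h0 : c * u ≠ 0 := by
      intro h0
      apply hρ
      rw [← h, ← mul_assoc, h0, zero_mul]
    apply mul_left_cancel₀ h0
    linarith
  refine tendsto_primitiveCount_div_sq _ _ (fun Q => measurableSet_gapRegion _ _ _)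
    (measurableSet_gapRegion _ _ _) (fun _ p hp => ⟨hp.1, hp.2.1⟩)
    (fun p hp => ⟨hp.1, hp.2.1⟩) ?_
  filter_upwards [ae_ne_fst 0, ae_ne_fst 1,
    ae_ne_of_slices Prod.snd measurable_snd 0 (fun _ _ h _ h' => h.trans h'.symm),
    ae_ne_of_slices Prod.snd measurable_snd 1 (fun _ _ h _ h' => h.trans h'.symm),
    ae_ne_of_slices (fun p => p.1 + p.2) (by fun_prop) 1 (fun u v h v' h' => by
      simp only [Set.mem_ofPred_eq] at h h'; linarith), hmul a, hmul b]
    with p h1 h2 h3 h4 h5 h6 h7 f hf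
  have hf1 := (continuous_fst.tendsto p).comp hf
  have hf2 := (continuous_snd.tendsto p).comp hf
  filter_upwards [eventually_mem_Ioc_iff_of_tendsto hf1 h1 h2,
    eventually_mem_Ioc_iff_of_tendsto hf2 h3 h4,
    eventually_lt_iff_of_tendsto tendsto_const_nhds (hf1.add hf2) h5.symm,
    eventually_lt_iff_of_tendsto ((hf1.mul hf2).const_mul a) hr h6,
    eventually_lt_iff_of_tendsto hr ((hf1.mul hf2).const_mul b) h7.symm] with Q e1 e2 e3 e4 e5
  simp only [Function.comp] at e1 e2 e3 e4 e5
  simp only [gapRegion, Set.mem_ofPred_eq, e1, e2, e3, e4, e5]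

/-! ### Gaps of the Farey sequence -/

lemma exists_coprime_of_mem_fareySet {Q : ℕ} {x : ℝ} (hx : x ∈ fareySet Q) :
    ∃ p q : ℕ, p.Coprime q ∧ 0 < q ∧ q ≤ Q ∧ p ≤ q ∧ x = (p : ℝ) / q := by
  obtain ⟨p, q, hq, hqQ, hpq, rfl⟩ := hx
  obtain ⟨p', q', hc, hp, hq'⟩ := Nat.exists_coprime p q
  have hg : 0 < p.gcd q := Nat.gcd_pos_of_pos_right p hq
  generalize p.gcd q = g at hp hq' hg
  subst hp hq'
  have hq0 : 0 < q' := Nat.pos_of_mul_pos_right hq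
  refine ⟨p', q', hc, hq0, (Nat.le_mul_of_pos_right q' hg).trans hqQ,
    Nat.le_of_mul_le_mul_right hpq hg, ?_⟩
  have : (g : ℝ) ≠ 0 := by exact_mod_cast hg.ne'
  push_cast
  exact mul_div_mul_right _ _ this

lemma natCast_div_lt_div_iff {p q r s : ℕ} (hq : 0 < q) (hs : 0 < s) :
    (p : ℝ) / q < (r : ℝ) / s ↔ p * s < r * q := by
  rw [div_lt_div_iff₀ (by exact_mod_cast hq) (by exact_mod_cast hs)]
  exact_mod_cast Iff.rfl

/-- The gaps of the Farey sequence are parametrized by the coprime pairs `(q, q')` with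
`q, q' ≤ Q < q + q'`, the gap being `1 / (q q')`. -/
lemma ncard_farey_gaps (a b : ℝ) {Q : ℕ} (hQ : 1 ≤ Q) {g : ℕ → ℝ}
    (hmono : StrictMonoOn g (Set.Iic (NQ Q))) (hg1 : g (NQ Q) = 1)
    (himg : g '' Set.Iic (NQ Q) = fareySet Q) :
    {i : ℕ | i < NQ Q ∧ (NQ Q : ℝ) * (g (i + 1) - g i) ∈ Set.Ioo a b}.ncard
      = primitiveCount (gapRegion a b ((NQ Q : ℝ) / (Q : ℝ) ^ 2)) Q := by
  classical
  set N := NQ Q with hN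
  have hQ0 : (0 : ℝ) < Q := by exact_mod_cast hQ
  have hex : ∀ i, ∃ p q : ℕ, i ≤ N →
      p.Coprime q ∧ 0 < q ∧ q ≤ Q ∧ p ≤ q ∧ g i = (p : ℝ) / q := by
    intro i
    by_cases hi : i ≤ N
    · obtain ⟨p, q, h⟩ := exists_coprime_of_mem_fareySet (himg.subset (Set.mem_image_of_mem g hi))
      exact ⟨p, q, fun _ => h⟩
    · exact ⟨0, 0, fun h => absurd h hi⟩
  choose num den hnd using hex
  have hfarey : ∀ r s : ℕ, 0 < s → s ≤ Q → r ≤ s → ∃ j, j ≤ N ∧ g j = (r : ℝ) / s := by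
    intro r s hs hsQ hrs
    have : (r : ℝ) / s ∈ g '' Set.Iic N := himg ▸ ⟨r, s, hs, hsQ, hrs, rfl⟩
    obtain ⟨j, hj, h⟩ := this
    exact ⟨j, hj, h⟩
  have hlt_iff : ∀ {i j}, i ≤ N → j ≤ N → (g i < g j ↔ i < j) := fun hi hj =>
    hmono.lt_iff_lt hi hj
  have hinj : ∀ {i j}, i ≤ N → j ≤ N → g i = g j → i = j := fun hi hj h =>
    hmono.injOn hi hj h
  have hneigh : ∀ i, i < N → num (i + 1) * den i = num i * den (i + 1) + 1 ∧
      Q < den i + den (i + 1) := by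
    intro i hi
    obtain ⟨hc, hq, hqQ, hpq, he⟩ := hnd i hi.le
    obtain ⟨hc', hq', hqQ', hpq', he'⟩ := hnd (i + 1) hi
    refine farey_neighbours_of_adjacent hc hq hqQ hq' hqQ' hpq' hc' ?_ ?_
    · rw [← natCast_div_lt_div_iff hq hq', ← he, ← he', hlt_iff hi.le hi]
      omega
    · intro r s hs hsQ hrs
      obtain ⟨j, hj, hje⟩ := hfarey r s hs hsQ hrs
      rw [← natCast_div_lt_div_iff hq hs, ← natCast_div_lt_div_iff hs hq', ← he, ← he', ← hje,
        hlt_iff hi.le hj, hlt_iff hj hi]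
      omega
  have hgap : ∀ {p q p' q' : ℕ}, 0 < q → 0 < q' → p' * q = p * q' + 1 →
      ((N : ℝ) * ((p' : ℝ) / q' - (p : ℝ) / q) ∈ Set.Ioo a b ↔
        a * ((q : ℝ) / Q * ((q' : ℝ) / Q)) < (N : ℝ) / (Q : ℝ) ^ 2 ∧
        (N : ℝ) / (Q : ℝ) ^ 2 < b * ((q : ℝ) / Q * ((q' : ℝ) / Q))) := by
    intro p q p' q' hq hq' hdet
    have hq0 : (0 : ℝ) < q := by exact_mod_cast hq
    have hq0' : (0 : ℝ) < q' := by exact_mod_cast hq'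
    have hdet' : (p' : ℝ) * q = p * q' + 1 := by exact_mod_cast hdet
    have e : (N : ℝ) * ((p' : ℝ) / q' - (p : ℝ) / q) = N / (q * q') := by
      field_simp
      linear_combination (N : ℝ) * hdet'
    have e2 : ∀ c : ℝ, c * ((q : ℝ) / Q * ((q' : ℝ) / Q)) = c * (q * q') / (Q : ℝ) ^ 2 := by
      intro c
      field_simp
    rw [e, e2, e2, div_lt_div_iff_of_pos_right (by positivity),
      div_lt_div_iff_of_pos_right (by positivity), Set.mem_Ioo, lt_div_iff₀ (by positivity),
      div_lt_iff₀ (by positivity)]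
  rw [primitiveCount, ← Set.ncard_coe_finset]
  refine Set.ncard_congr (fun i _ => (den i, den (i + 1))) ?_ ?_ ?_
  · rintro i ⟨hi, hmem⟩
    obtain ⟨hc, hq, hqQ, hpq, he⟩ := hnd i hi.le
    obtain ⟨hc', hq', hqQ', hpq', he'⟩ := hnd (i + 1) hi
    obtain ⟨hdet, hsum⟩ := hneigh i hi
    rw [he, he', hgap hq hq' hdet] at hmem
    simp only [Finset.coe_filter, Finset.mem_product, Finset.mem_Icc, Set.mem_ofPred_eq, gapRegion,
      Set.mem_Ioc, div_le_one hQ0, Nat.cast_le]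
    have hq0 : (0 : ℝ) < den i := by exact_mod_cast hq
    have hq0' : (0 : ℝ) < den (i + 1) := by exact_mod_cast hq'
    refine ⟨⟨⟨hq, hqQ⟩, hq', hqQ'⟩, ?_, ⟨by positivity, hqQ⟩, ⟨by positivity, hqQ'⟩, ?_, hmem⟩
    · have h : (den i).gcd (den (i + 1)) ∣ num i * den (i + 1) + 1 :=
        hdet ▸ (Nat.gcd_dvd_left _ _).mul_left _
      exact Nat.dvd_one.1 ((Nat.dvd_add_right ((Nat.gcd_dvd_right _ _).mul_left _)).1 h)
    · rw [← add_div, one_lt_div hQ0]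
      exact_mod_cast hsum
  · rintro i j ⟨hi, _⟩ ⟨hj, _⟩ hij
    simp only [Prod.mk.injEq] at hij
    have hlt : ∀ k, k < N → num k < den k := by
      intro k hk
      obtain ⟨_, hq, _, _, he⟩ := hnd k hk.le
      have h : g k < g N := (hlt_iff hk.le le_rfl).2 hk
      rw [hg1, he, div_lt_one (by exact_mod_cast hq)] at h
      exact_mod_cast h
    have hi2 := (hneigh i hi).1
    have hj2 := (hneigh j hj).1
    rw [← hij.1, ← hij.2] at hj2
    have hnum := numerator_unique_of_det_eq_one (hlt i hi) (hij.1 ▸ hlt j hj) hi2 hj2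
    apply hinj hi.le hj.le
    rw [(hnd i hi.le).2.2.2.2, (hnd j hj.le).2.2.2.2, hnum, hij.1]
  · rintro ⟨q, q'⟩ hx
    simp only [Finset.mem_coe, Finset.mem_filter, Finset.mem_product, Finset.mem_Icc] at hx
    obtain ⟨⟨⟨hq, hqQ⟩, hq', hqQ'⟩, hc, -, -, hsum, hmem⟩ := hx
    rw [← add_div, one_lt_div hQ0] at hsum
    have hsum' : Q < q + q' := by exact_mod_cast hsum
    obtain ⟨p, p', hp, hp', hdet⟩ := exists_numerators_of_coprime hq hq' hc
    obtain ⟨i, hi, hie⟩ := hfarey p q hq hqQ hp.le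
    obtain ⟨j, hj, hje⟩ := hfarey p' q' hq' hqQ' hp'
    have hij : i < j := by
      rw [← hlt_iff hi hj, hie, hje, natCast_div_lt_div_iff hq hq']
      omega
    have hiN : i < N := hij.trans_le hj
    obtain rfl : j = i + 1 := by
      by_contra hne
      obtain ⟨-, hs, hsQ, -, he⟩ := hnd (i + 1) hiN
      refine not_between_of_det_eq_one (r := num (i + 1)) hdet hsum' hsQ ⟨?_, ?_⟩
      · rw [← natCast_div_lt_div_iff hq hs, ← hie, ← he, hlt_iff hi hiN]
        omega
      · rw [← natCast_div_lt_div_iff hs hq', ← hje, ← he, hlt_iff hiN hj]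
        omega
    have hcop : ∀ {p q p' q' : ℕ}, p.Coprime q → p'.Coprime q' → 0 < q → 0 < q' →
        (p : ℝ) / q = (p' : ℝ) / q' → q = q' := by
      intro p q p' q' h1 h2 hq hq' h
      rw [div_eq_div_iff (by exact_mod_cast hq.ne') (by exact_mod_cast hq'.ne')] at h
      have h : p * q' = p' * q := by exact_mod_cast h
      exact Nat.dvd_antisymm (h1.symm.dvd_of_dvd_mul_left ⟨p', by rw [h]; ring⟩)
        (h2.symm.dvd_of_dvd_mul_left ⟨p, by rw [← h]; ring⟩)
    have hcpq : p.Coprime q := by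
      have h : p.gcd q ∣ p * q' + 1 := hdet ▸ (Nat.gcd_dvd_right p q).mul_left p'
      exact Nat.dvd_one.1 ((Nat.dvd_add_right ((Nat.gcd_dvd_left p q).mul_right q')).1 h)
    have hcpq' : p'.Coprime q' := by
      have h : p'.gcd q' ∣ p * q' + 1 := hdet ▸ (Nat.gcd_dvd_left p' q').mul_right q
      exact Nat.dvd_one.1 ((Nat.dvd_add_right ((Nat.gcd_dvd_right p' q').mul_left p)).1 h)
    refine ⟨i, ⟨hiN, ?_⟩, ?_⟩
    · rw [hie, hje, hgap hq hq' hdet]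
      exact hmem
    · obtain ⟨h1, h2, -, -, h3⟩ := hnd i hi
      obtain ⟨h1', h2', -, -, h3'⟩ := hnd (i + 1) hj
      exact Prod.ext (hcop h1 hcpq h2 hq (h3.symm.trans hie))
        (hcop h1' hcpq' h2' hq' (h3'.symm.trans hje))

/-- Hall's theorem: the normalized gaps of the Farey sequence of level `Q`,
`γ_0 = 0 < γ_1 < ⋯ < γ_{N(Q)} = 1`, have limiting distribution `2·Leb₂(Ã_{a,b})`. -/
theorem hall_farey_gap_distribution (a b : ℝ) (ha : 0 ≤ a) (hab : a < b)
    (γ : ℕ → ℕ → ℝ)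
    (hγ : ∀ Q : ℕ, 1 ≤ Q →
      StrictMonoOn (γ Q) (Set.Iic (NQ Q)) ∧ γ Q 0 = 0 ∧ γ Q (NQ Q) = 1 ∧
        γ Q '' Set.Iic (NQ Q) = fareySet Q) :
    Tendsto (fun Q : ℕ =>
        ({i : ℕ | i < NQ Q ∧ (NQ Q : ℝ) * (γ Q (i + 1) - γ Q i) ∈ Set.Ioo a b}.ncard : ℝ)
          / (NQ Q))
      atTop (𝓝 (2 * (volume (Atilde a b)).toReal)) := by
  have hlim := (tendsto_primitiveCount_gapRegion a b (by positivity) tendsto_NQ_div_sq).div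
    tendsto_NQ_div_sq (by positivity)
  have hval : 6 / Real.pi ^ 2 * (volume (gapRegion a b (3 / Real.pi ^ 2))).toReal
      / (3 / Real.pi ^ 2) = 2 * (volume (Atilde a b)).toReal := by
    rw [Atilde_eq_gapRegion]
    field_simp
    ring
  rw [hval] at hlim
  refine hlim.congr' ?_
  filter_upwards [eventually_ge_atTop 1] with Q hQ
  obtain ⟨hmono, -, h1, himg⟩ := hγ Q hQ
  have hQ0 : (Q : ℝ) ^ 2 ≠ 0 := by positivity
  rw [ncard_farey_gaps a b hQ hmono h1 himg, Pi.div_apply, div_div_div_cancel_right₀ hQ0]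
end
end

section
/- Fix η > 0. For every unimodular lattice Λ ⊆ ℝ² that is η-horizontally short, there exists a unique pair (a,b) ∈ Δ_η such that Λ = Λ_{a,b}. Conversely, for every (a,b) ∈ Δ_η, the lattice Λ_{a,b} is η-horizontally short. -/
open Matrix

noncomputable section

/-- The lattice `M·ℤ² ⊆ ℝ²`. -/
def lattOf (M : Matrix (Fin 2) (Fin 2) ℝ) : Set (Fin 2 → ℝ) :=
  {w | ∃ m n : ℤ, w = M *ᵥ ![(m : ℝ), (n : ℝ)]}

/-- A unimodular lattice in `ℝ²`: a set of the form `M·ℤ²` with `det M = 1`. -/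
def IsUnimodularLattice (L : Set (Fin 2 → ℝ)) : Prop :=
  ∃ M : Matrix (Fin 2) (Fin 2) ℝ, M.det = 1 ∧ L = lattOf M

/-- `L` is `η`-horizontally short: it contains a vector `(u,0)ᵀ` with `0 < u ≤ η`. -/
def HShort (η : ℝ) (L : Set (Fin 2 → ℝ)) : Prop :=
  ∃ u : ℝ, 0 < u ∧ u ≤ η ∧ ![u, 0] ∈ L

/-- The lattice `Λ_{a,b} = [[a,b],[0,a⁻¹]]·ℤ²`. -/
def lattAB (a b : ℝ) : Set (Fin 2 → ℝ) := lattOf !![a, b; 0, a⁻¹]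

/-- The triangle `Δ_η = {(a,b) : 0 < a ≤ η, 0 < b ≤ η, a + b > η}`. -/
def deltaSet (η : ℝ) : Set (ℝ × ℝ) :=
  {p | 0 < p.1 ∧ p.1 ≤ η ∧ 0 < p.2 ∧ p.2 ≤ η ∧ η < p.1 + p.2}

theorem mem_lattAB {a b x y : ℝ} :
    ![x, y] ∈ lattAB a b ↔ ∃ m n : ℤ, x = a * m + b * n ∧ y = a⁻¹ * n := by
  simp [lattAB, lattOf, funext_iff, Fin.forall_fin_two, mul_comm]

theorem lattOf_mul_map_subset (M : Matrix (Fin 2) (Fin 2) ℝ) (N : Matrix (Fin 2) (Fin 2) ℤ) :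
    lattOf (M * N.map (fun k : ℤ => (k : ℝ))) ⊆ lattOf M := by
  rintro _ ⟨m, n, rfl⟩
  refine ⟨N 0 0 * m + N 0 1 * n, N 1 0 * m + N 1 1 * n, ?_⟩
  rw [← Matrix.mulVec_mulVec]
  congr 1
  ext i
  fin_cases i <;> simp [Matrix.mulVec, dotProduct, Fin.sum_univ_two]

theorem lattOf_mul_map_of_det_eq_one (M : Matrix (Fin 2) (Fin 2) ℝ)
    {N : Matrix (Fin 2) (Fin 2) ℤ} (hN : N.det = 1) :
    lattOf (M * N.map (fun k : ℤ => (k : ℝ))) = lattOf M := by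
  refine (lattOf_mul_map_subset M N).antisymm ?_
  have h := lattOf_mul_map_subset (M * N.map (fun k : ℤ => (k : ℝ))) N.adjugate
  have hinv : N.map (fun k : ℤ => (k : ℝ)) * N.adjugate.map (fun k : ℤ => (k : ℝ)) = 1 := by
    have h1 := congrArg (fun A => A.map (Int.castRingHom ℝ)) (Matrix.mul_adjugate N)
    rw [hN, one_smul, Matrix.map_mul, Matrix.map_one _ (map_zero _) (map_one _)] at h1
    exact h1
  rwa [Matrix.mul_assoc, hinv, Matrix.mul_one] at h

theorem lattAB_add_zsmul (a c : ℝ) (k : ℤ) : lattAB a (c + k • a) = lattAB a c := by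
  have h := lattOf_mul_map_of_det_eq_one !![a, c; 0, a⁻¹] (N := !![1, k; 0, 1])
    (by simp [Matrix.det_fin_two])
  rw [lattAB, lattAB, ← h]
  congr 1
  ext i j
  fin_cases i <;> fin_cases j <;> simp [Matrix.mul_apply, Fin.sum_univ_two, mul_comm, add_comm]

theorem IsUnimodularLattice.exists_eq_lattAB {L : Set (Fin 2 → ℝ)} (hL : IsUnimodularLattice L)
    {u : ℝ} (hu : 0 < u) (huL : ![u, 0] ∈ L) :
    ∃ a c : ℝ, 0 < a ∧ a ≤ u ∧ L = lattAB a c := by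
  obtain ⟨M, hM, rfl⟩ := hL
  obtain ⟨m, n, hmn⟩ := huL
  have h0 : u = M 0 0 * m + M 0 1 * n := by
    simpa [Matrix.mulVec, dotProduct, Fin.sum_univ_two] using congrFun hmn 0
  have h1 : 0 = M 1 0 * m + M 1 1 * n := by
    simpa [Matrix.mulVec, dotProduct, Fin.sum_univ_two] using congrFun hmn 1
  have hg : 0 < Int.gcd m n := by
    refine Int.gcd_pos_iff.2 ?_
    by_contra! h
    simp [h.1, h.2] at h0
    exact hu.ne' h0
  obtain ⟨m', n', hcop, hm, hn⟩ := Int.exists_gcd_one hg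
  obtain ⟨x, y, hxy⟩ := Int.isCoprime_iff_gcd_eq_one.2 hcop
  set g := Int.gcd m n
  have hg1 : (1 : ℝ) ≤ g := by exact_mod_cast hg
  have hm' : (m : ℝ) = m' * g := by exact_mod_cast hm
  have hn' : (n : ℝ) = n' * g := by exact_mod_cast hn
  have hxy' : (x : ℝ) * m' + y * n' = 1 := by exact_mod_cast hxy
  rw [hm', hn'] at h0 h1
  rw [Matrix.det_fin_two] at hM
  set a := M 0 0 * m' + M 0 1 * n' with ha
  have hua : u = a * g := by rw [h0, ha]; ring
  have ha0 : 0 < a := by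
    by_contra! h
    nlinarith
  have hb0 : M 1 0 * m' + M 1 1 * n' = 0 := by
    have : (M 1 0 * m' + M 1 1 * n') * g = 0 := by linarith
    exact (mul_eq_zero.1 this).resolve_right (by positivity)
  refine ⟨a, -(M 0 0 * y) + M 0 1 * x, ha0, by nlinarith, ?_⟩
  have hd : -(M 1 0 * y) + M 1 1 * x = a⁻¹ := by
    refine eq_inv_of_mul_eq_one_right ?_
    linear_combination ((x : ℝ) * m' + y * n') * hM + hxy' + (-(M 0 0 * y) + M 0 1 * x) * hb0
  rw [lattAB, ← lattOf_mul_map_of_det_eq_one M (N := !![m', -y; n', x])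
    (by rw [Matrix.det_fin_two_of]; linarith), ← hd]
  congr 1
  ext i j
  fin_cases i <;> fin_cases j <;> simp [Matrix.mul_apply, Fin.sum_univ_two, hb0, ha]

theorem exists_int_mul_of_lattAB_eq {a b a' b' : ℝ} (ha' : 0 < a')
    (h : lattAB a b = lattAB a' b') : ∃ m : ℤ, a = a' * m := by
  have hmem : ![a, 0] ∈ lattAB a b := mem_lattAB.2 ⟨1, 0, by simp, by simp⟩
  rw [h, mem_lattAB] at hmem
  obtain ⟨m, n, h1, h2⟩ := hmem
  have hn : (n : ℝ) = 0 := (mul_eq_zero.1 h2.symm).resolve_left (inv_pos.2 ha').ne'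
  exact ⟨m, by simpa [hn] using h1⟩

theorem eq_of_lattAB_eq {a b a' b' : ℝ} (ha : 0 < a) (ha' : 0 < a')
    (h : lattAB a b = lattAB a' b') : a = a' ∧ ∃ k : ℤ, b = b' + k • a := by
  have le_of {s t : ℝ} (hs : 0 < s) (ht : 0 < t) (hst : ∃ m : ℤ, s = t * m) : t ≤ s := by
    obtain ⟨m, rfl⟩ := hst
    have hm : (0 : ℝ) < m := pos_of_mul_pos_right hs ht.le
    have : (1 : ℝ) ≤ m := by exact_mod_cast hm
    nlinarith
  obtain rfl : a = a' := le_antisymm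
    (le_of ha' ha (exists_int_mul_of_lattAB_eq ha h.symm))
    (le_of ha ha' (exists_int_mul_of_lattAB_eq ha' h))
  have hmem : ![b, a⁻¹] ∈ lattAB a b := mem_lattAB.2 ⟨0, 1, by simp, by simp⟩
  rw [h, mem_lattAB] at hmem
  obtain ⟨m, n, h1, h2⟩ := hmem
  have hn : (n : ℝ) = 1 := by
    field_simp at h2
    exact h2.symm
  refine ⟨rfl, m, ?_⟩
  rw [h1, hn, zsmul_eq_mul]
  ring


/-- The `η`-horizontally short unimodular lattices are parametrized bijectively by
`Δ_η` via `(a,b) ↦ Λ_{a,b}`. -/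
theorem transversal_parametrization (η : ℝ) (hη : 0 < η) :
    (∀ L : Set (Fin 2 → ℝ), IsUnimodularLattice L → HShort η L →
      ∃! p : ℝ × ℝ, p ∈ deltaSet η ∧ L = lattAB p.1 p.2) ∧
      (∀ p ∈ deltaSet η, HShort η (lattAB p.1 p.2)) := by
  refine ⟨fun L hL hs => ?_, fun p hp => ⟨p.1, hp.1, hp.2.1, mem_lattAB.2 ⟨1, 0, by simp, by simp⟩⟩⟩
  obtain ⟨u, hu, huη, huL⟩ := hs
  obtain ⟨a, c, ha, hau, rfl⟩ := hL.exists_eq_lattAB hu huL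
  obtain ⟨k, ⟨hk1, hk2⟩, -⟩ := existsUnique_add_zsmul_mem_Ioc ha c (η - a)
  refine ⟨(a, c + k • a), ⟨⟨ha, hau.trans huη, ?_, ?_, ?_⟩, (lattAB_add_zsmul a c k).symm⟩, ?_⟩
  · dsimp only; linarith
  · dsimp only; linarith
  · dsimp only; linarith
  rintro ⟨a', b'⟩ ⟨⟨ha', -, -, hb', hab'⟩, h⟩
  dsimp only at ha' hb' hab' h
  rw [← lattAB_add_zsmul a c k] at h
  obtain ⟨rfl, j, hj⟩ := eq_of_lattAB_eq ha ha' h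
  have huniq := existsUnique_add_zsmul_mem_Ioc ha b' (η - a)
  have hj0 : j = 0 := huniq.unique
    ⟨by rw [← hj]; exact hk1, by rw [← hj]; exact hk2⟩
    ⟨by rw [zero_smul]; linarith, by rw [zero_smul]; linarith⟩
  rw [hj, hj0, zero_smul, add_zero]
end
end

section
/- Fix η > 0 and (a,b) ∈ Δ_η. Then the set {s > 0 : h_s·Λ_{a,b} is η-horizontally short} is nonempty and its minimum equals 1/(ab). That is, the return time of the flow h_s to the set of η-horizontally short unimodular lattices, starting from Λ_{a,b}, is R_η(a,b) = 1/(ab). -/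
open Matrix

noncomputable section

/-- The shear matrix `h_s = [[1,0],[-s,1]]`. -/
def hMat (s : ℝ) : Matrix (Fin 2) (Fin 2) ℝ := !![1, 0; -s, 1]

/-- Membership of a horizontal vector in the sheared lattice `h_s·Λ_{a,b}`. -/
lemma horizontal_mem_image_lattAB_iff (a b s u : ℝ) :
    ![u, 0] ∈ (fun w => hMat s *ᵥ w) '' lattAB a b ↔
      ∃ m n : ℤ, a * m + b * n = u ∧ a⁻¹ * n = s * u := by
  have key (m n : ℤ) : hMat s *ᵥ (!![a, b; 0, a⁻¹] *ᵥ ![(m : ℝ), (n : ℝ)]) = ![u, 0] ↔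
      a * m + b * n = u ∧ a⁻¹ * n = s * u := by
    rw [funext_iff, Fin.forall_fin_two]
    simp only [hMat, mulVec, dotProduct, Fin.sum_univ_two, of_apply, cons_val_zero,
      cons_val_one]
    constructor
    · rintro ⟨h₁, h₂⟩
      have h : a * m + b * n = u := by linarith
      exact ⟨h, by rw [← h]; linarith⟩
    · rintro ⟨rfl, h⟩
      exact ⟨by ring, by linarith⟩
  constructor
  · rintro ⟨_, ⟨m, n, rfl⟩, h⟩
    exact ⟨m, n, (key m n).1 h⟩
  · rintro ⟨m, n, h⟩
    exact ⟨_, ⟨m, n, rfl⟩, (key m n).2 h⟩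

/-- The return time of the horocycle flow `h_s` to the `η`-horizontally short
lattices, starting from `Λ_{a,b}` with `(a,b) ∈ Δ_η`, is `1/(ab)`. -/
theorem bcz_return_time (η : ℝ) (hη : 0 < η) (a b : ℝ) (hab : (a, b) ∈ deltaSet η) :
    IsLeast {s : ℝ | 0 < s ∧ HShort η ((fun w => hMat s *ᵥ w) '' lattAB a b)}
      (1 / (a * b)) := by
  obtain ⟨ha, haη, hb, hbη, hsum⟩ := hab
  dsimp only at ha haη hb hbη hsum
  constructor
  · refine ⟨by positivity, b, hb, hbη, ?_⟩
    rw [horizontal_mem_image_lattAB_iff]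
    refine ⟨0, 1, by simp, ?_⟩
    field_simp
    simp
  · rintro s ⟨hs, u, hu, huη, hmem⟩
    obtain ⟨m, n, hmn, hn⟩ := (horizontal_mem_image_lattAB_iff a b s u).1 hmem
    have hn' : (n : ℝ) = a * (s * u) := by
      rw [← hn, mul_inv_cancel_left₀ ha.ne']
    have hnpos : 0 < n := by
      have : (0 : ℝ) < n := hn' ▸ by positivity
      exact_mod_cast this
    have hn1 : (1 : ℝ) ≤ n := by exact_mod_cast hnpos
    have hm : m ≤ 0 := by
      by_contra! hm
      have hm1 : (1 : ℝ) ≤ m := by exact_mod_cast hm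
      nlinarith
    have hm0 : (m : ℝ) ≤ 0 := by exact_mod_cast hm
    have hub : u ≤ b * n := by nlinarith
    rw [div_le_iff₀ (by positivity)]
    refine le_of_mul_le_mul_right ?_ hu
    rw [hn'] at hub
    linarith
end
end

section
/- Fix η > 0. The BCZ map T_η : Δ_η → Δ_η, T_η(a,b) = (b, ⌊(η+a)/b⌋·b − a), maps Δ_η into Δ_η and preserves two-dimensional Lebesgue measure: the pushforward of the Lebesgue measure restricted to Δ_η under T_η equals the Lebesgue measure restricted to Δ_η. -/
open MeasureTheory

noncomputable section

/-- The BCZ map `T_η(a,b) = (b, ⌊(η+a)/b⌋·b − a)`. -/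
def bczMap (η : ℝ) (p : ℝ × ℝ) : ℝ × ℝ :=
  (p.2, (⌊(η + p.1) / p.2⌋ : ℝ) * p.2 - p.1)

theorem measurableSet_deltaSet (η : ℝ) : MeasurableSet (deltaSet η) := by
  unfold deltaSet
  refine (measurableSet_lt measurable_const measurable_fst).inter <|
    (measurableSet_le measurable_fst measurable_const).inter <|
    (measurableSet_lt measurable_const measurable_snd).inter <|
    (measurableSet_le measurable_snd measurable_const).inter <|
    measurableSet_lt measurable_const (measurable_fst.add measurable_snd)

theorem measurable_bczMap (η : ℝ) : Measurable (bczMap η) := by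
  have h : Measurable fun p : ℝ × ℝ => ⌊(η + p.1) / p.2⌋ := by fun_prop
  have h' : Measurable fun p : ℝ × ℝ => (⌊(η + p.1) / p.2⌋ : ℝ) :=
    (measurable_of_countable (fun n : ℤ => (n : ℝ))).comp h
  unfold bczMap
  fun_prop

theorem floor_div_eq_iff {x b : ℝ} (hb : 0 < b) (j : ℤ) :
    ⌊x / b⌋ = j ↔ (j : ℝ) * b ≤ x ∧ x < (j + 1) * b := by
  rw [Int.floor_eq_iff, le_div_iff₀ hb, div_lt_iff₀ hb]

theorem mapsTo_bczMap (η : ℝ) : Set.MapsTo (bczMap η) (deltaSet η) (deltaSet η) := by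
  rintro ⟨a, b⟩ ⟨ha, haη, hb, hbη, hab⟩
  obtain ⟨h₁, h₂⟩ := (floor_div_eq_iff hb _).1 (rfl : ⌊(η + a) / b⌋ = _)
  refine ⟨hb, hbη, ?_, ?_, ?_⟩ <;> dsimp only [bczMap] at * <;> linarith

/-- The linear map `(a, b) ↦ (b, j b - a)`, which agrees with the BCZ map where the floor
equals `j`, preserves Lebesgue measure. -/
theorem measurePreserving_bczBranch (j : ℤ) :
    MeasurePreserving (fun p : ℝ × ℝ => (p.2, (j : ℝ) * p.2 - p.1)) volume volume := by
  have h : MeasurePreserving (fun p : ℝ × ℝ => (p.1, (j : ℝ) * p.1 - p.2))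
      ((volume : Measure ℝ).prod volume) (volume.prod volume) :=
    (MeasurePreserving.id volume).skew_product (g := fun x y => (j : ℝ) * x - y)
      (by fun_prop)
      (Filter.Eventually.of_forall fun x =>
        (Measure.measurePreserving_sub_left volume ((j : ℝ) * x)).map_eq)
  exact h.comp Measure.measurePreserving_swap

/-- The part of `A ∩ Δ_η` pulled back along the branch `j` of the BCZ map is the part of `A ∩ Δ_η`
on which the floor of the inverse map equals `j`. -/
theorem preimage_bczMap_inter_fiber (η : ℝ) (A : Set (ℝ × ℝ)) (j : ℤ) :
    (bczMap η ⁻¹' A ∩ deltaSet η) ∩ (fun p : ℝ × ℝ => ⌊(η + p.1) / p.2⌋) ⁻¹' {j} =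
      (fun p : ℝ × ℝ => (p.2, (j : ℝ) * p.2 - p.1)) ⁻¹'
        ((A ∩ deltaSet η) ∩ (fun p : ℝ × ℝ => ⌊(η + p.2) / p.1⌋) ⁻¹' {j}) := by
  ext ⟨a, b⟩
  simp only [Set.mem_inter_iff, Set.mem_preimage, Set.mem_singleton_iff]
  constructor
  · rintro ⟨⟨hA, hΔ⟩, hj⟩
    have hΔ' := mapsTo_bczMap η hΔ
    simp only [bczMap, hj] at hA hΔ'
    refine ⟨⟨hA, hΔ'⟩, ?_⟩
    obtain ⟨-, haη, hb, -, hab⟩ := hΔ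
    dsimp only at *
    rw [floor_div_eq_iff hb]
    constructor <;> linarith
  · rintro ⟨⟨hA, hb, hbη, hc, hcη, hbc⟩, hj⟩
    dsimp only at *
    rw [floor_div_eq_iff hb] at hj
    have hj' : ⌊(η + a) / b⌋ = j := by
      rw [floor_div_eq_iff hb]
      constructor <;> linarith
    refine ⟨⟨by simpa only [bczMap, hj'] using hA, ?_, ?_, hb, hbη, ?_⟩, hj'⟩ <;>
      dsimp only <;> linarith

theorem measure_eq_tsum_inter_fiber {α : Type*} [MeasurableSpace α] (μ : Measure α) {f : α → ℤ}
    (hf : Measurable f) {s : Set α} (hs : MeasurableSet s) :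
    μ s = ∑' j, μ (s ∩ f ⁻¹' {j}) := by
  rw [← measure_iUnion]
  · rw [← Set.inter_iUnion, ← Set.preimage_iUnion, Set.iUnion_of_singleton, Set.preimage_univ,
      Set.inter_univ]
  · intro i j hij
    exact ((Set.disjoint_singleton.2 hij).preimage f).mono Set.inter_subset_right
      Set.inter_subset_right
  · exact fun j => hs.inter (hf (measurableSet_singleton j))

/-- The BCZ map maps `Δ_η` into itself and preserves two-dimensional Lebesgue
measure restricted to `Δ_η`. -/
theorem bcz_measure_preserving (η : ℝ) (hη : 0 < η) :
    Set.MapsTo (bczMap η) (deltaSet η) (deltaSet η) ∧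
      Measure.map (bczMap η) (volume.restrict (deltaSet η)) =
        volume.restrict (deltaSet η) := by
  refine ⟨mapsTo_bczMap η, Measure.ext fun A hA => ?_⟩
  have hT := measurable_bczMap η
  have hΔ := measurableSet_deltaSet η
  have hf : Measurable fun p : ℝ × ℝ => ⌊(η + p.1) / p.2⌋ := by fun_prop
  have hg : Measurable fun p : ℝ × ℝ => ⌊(η + p.2) / p.1⌋ := by fun_prop
  rw [Measure.map_apply hT hA, Measure.restrict_apply (hT hA), Measure.restrict_apply hA,
    measure_eq_tsum_inter_fiber volume hf ((hT hA).inter hΔ),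
    measure_eq_tsum_inter_fiber volume hg (hA.inter hΔ)]
  refine tsum_congr fun j => ?_
  rw [preimage_bczMap_inter_fiber]
  exact (measurePreserving_bczBranch j).measure_preimage
    ((hA.inter hΔ).inter (hg (measurableSet_singleton j))).nullMeasurableSet
end
end

section
/- Let Λ = M·ℤ² with M ∈ SL(2,ℝ) be a unimodular lattice in ℝ². Then there exists s > 0 with h_s·Λ = Λ if and only if Λ contains a nonzero vector of the form (0,v)ᵀ. In particular, if Λ = [[0,−a⁻¹],[a,b]]·ℤ² for some a ≠ 0 and b ∈ ℝ, then h_{a²}·Λ = Λ. -/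
open Matrix

noncomputable section

theorem mem_lattOf_iff {M : Matrix (Fin 2) (Fin 2) ℝ} {w : Fin 2 → ℝ} :
    w ∈ lattOf M ↔ ∃ m n : ℤ, w 0 = M 0 0 * m + M 0 1 * n ∧ w 1 = M 1 0 * m + M 1 1 * n := by
  simp [lattOf, funext_iff, Fin.forall_fin_two]

theorem hMat_mulVec (s : ℝ) (w : Fin 2 → ℝ) : hMat s *ᵥ w = ![w 0, w 1 - s * w 0] := by
  ext i
  fin_cases i
  · simp [hMat, Matrix.mulVec, dotProduct, Fin.sum_univ_two]
  · simp [hMat, Matrix.mulVec, dotProduct, Fin.sum_univ_two]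
    ring

theorem hMat_mulVec_mem_lattOf {M : Matrix (Fin 2) (Fin 2) ℝ} (hM : M.det = 1) {v : ℝ}
    (hv : ![0, v] ∈ lattOf M) (j : ℤ) {w : Fin 2 → ℝ} (hw : w ∈ lattOf M) :
    hMat (j * v ^ 2) *ᵥ w ∈ lattOf M := by
  rw [mem_lattOf_iff] at hv hw
  obtain ⟨m, n, h0, h1⟩ := hv
  obtain ⟨k, l, hk, hl⟩ := hw
  simp only [cons_val_zero, cons_val_one] at h0 h1
  rw [det_fin_two] at hM
  have hm : (m : ℝ) = -M 0 1 * v := by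
    linear_combination (-(m : ℝ)) * hM - M 1 1 * h0 + M 0 1 * h1
  have hn : (n : ℝ) = M 0 0 * v := by
    linear_combination (-(n : ℝ)) * hM + M 1 0 * h0 - M 0 0 * h1
  rw [mem_lattOf_iff]
  refine ⟨k - j * (m * n * k - m ^ 2 * l), l - j * (n ^ 2 * k - m * n * l), ?_, ?_⟩
  · rw [hMat_mulVec]
    push_cast
    simp only [hk, hm, hn]
    ring
  · rw [hMat_mulVec]
    push_cast
    simp only [hk, hl, hm, hn]
    linear_combination j * v ^ 2 * (M 0 0 * k + M 0 1 * l) * hM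

theorem image_hMat_sq_lattOf {M : Matrix (Fin 2) (Fin 2) ℝ} (hM : M.det = 1) {v : ℝ}
    (hv : ![0, v] ∈ lattOf M) : (fun w => hMat (v ^ 2) *ᵥ w) '' lattOf M = lattOf M := by
  apply Set.Subset.antisymm
  · rintro _ ⟨w, hw, rfl⟩
    simpa using hMat_mulVec_mem_lattOf hM hv 1 hw
  · intro w hw
    refine ⟨_, hMat_mulVec_mem_lattOf hM hv (-1) hw, ?_⟩
    simp only [hMat_mulVec]
    ext i
    fin_cases i <;> simp

theorem sub_mem_lattOf {M : Matrix (Fin 2) (Fin 2) ℝ} {w w' : Fin 2 → ℝ}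
    (hw : w ∈ lattOf M) (hw' : w' ∈ lattOf M) : w - w' ∈ lattOf M := by
  rw [mem_lattOf_iff] at *
  obtain ⟨m, n, h0, h1⟩ := hw
  obtain ⟨k, l, h0', h1'⟩ := hw'
  refine ⟨m - k, n - l, ?_, ?_⟩
  · simp only [Pi.sub_apply, h0, h0']
    push_cast
    ring
  · simp only [Pi.sub_apply, h1, h1']
    push_cast
    ring

theorem exists_mem_lattOf_apply_zero_ne_zero {M : Matrix (Fin 2) (Fin 2) ℝ} (hM : M.det ≠ 0) :
    ∃ w ∈ lattOf M, w 0 ≠ 0 := by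
  by_contra! h
  have h0 := h _ (mem_lattOf_iff.2 ⟨1, 0, rfl, rfl⟩ : ![_, _] ∈ lattOf M)
  have h1 := h _ (mem_lattOf_iff.2 ⟨0, 1, rfl, rfl⟩ : ![_, _] ∈ lattOf M)
  simp at h0 h1
  simp [det_fin_two, h0, h1] at hM

/-- A unimodular lattice is periodic under the horocycle flow `h_s` (for some `s > 0`)
iff it contains a nonzero vertical vector; explicitly, lattices of the form
`[[0,-a⁻¹],[a,b]]·ℤ²` satisfy `h_{a²}·Λ = Λ`. -/
theorem horocycle_periodic_iff_vertical (L : Set (Fin 2 → ℝ))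
    (hL : IsUnimodularLattice L) :
    ((∃ s : ℝ, 0 < s ∧ (fun w => hMat s *ᵥ w) '' L = L) ↔
      ∃ v : ℝ, v ≠ 0 ∧ ![0, v] ∈ L) ∧
      (∀ a b : ℝ, a ≠ 0 → L = lattOf !![0, -a⁻¹; a, b] →
        (fun w => hMat (a ^ 2) *ᵥ w) '' L = L) := by
  obtain ⟨M, hM, rfl⟩ := hL
  refine ⟨⟨?_, ?_⟩, ?_⟩
  · rintro ⟨s, hs, h⟩
    obtain ⟨w, hw, hw0⟩ := exists_mem_lattOf_apply_zero_ne_zero (hM ▸ one_ne_zero)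
    refine ⟨-(s * w 0), neg_ne_zero.2 (mul_ne_zero hs.ne' hw0), ?_⟩
    have hmem : hMat s *ᵥ w ∈ lattOf M := by
      rw [← h]
      exact Set.mem_image_of_mem _ hw
    convert sub_mem_lattOf hmem hw using 1
    rw [hMat_mulVec]
    ext i
    fin_cases i <;> simp
  · rintro ⟨v, hv, hmem⟩
    exact ⟨v ^ 2, by positivity, image_hMat_sq_lattOf hM hmem⟩
  · intro a b ha h
    refine image_hMat_sq_lattOf hM ?_
    rw [h, mem_lattOf_iff]
    exact ⟨1, 0, by simp, by simp⟩
end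
end

section
/- Let G = SL(2,ℝ), Γ = SL(2,ℤ), and let μ be a Borel probability measure on the quotient G/Γ that is invariant under the left translation action of G (the normalized Haar measure). Let g ∈ G be such that the unimodular lattice g·ℤ² contains no nonzero vector of the form (0,v)ᵀ. Then for every bounded continuous function f : G/Γ → ℝ, lim_{S→∞} (1/S)·∫₀^S f(h_s·gΓ) ds = ∫_{G/Γ} f dμ, where h_s = [[1,0],[−s,1]]. That is, the horocycle orbit measures of gΓ equidistribute toward Haar measure. -/
open Matrix MeasureTheory Filter Topology

noncomputable section

/-- `SL(2,ℤ)` viewed as a subgroup of `SL(2,ℝ)`. -/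
def SL2Z : Subgroup SL2 :=
  (Matrix.SpecialLinearGroup.map (n := Fin 2) (Int.castRingHom ℝ)).range

instance : IsTopologicalGroup SL2 :=
  Matrix.SpecialLinearGroup.topologicalGroup

instance : T2Space SL2 :=
  inferInstanceAs (T2Space {A : Matrix (Fin 2) (Fin 2) ℝ // A.det = 1})

instance : SecondCountableTopology SL2 :=
  haveI : SecondCountableTopology (Matrix (Fin 2) (Fin 2) ℝ) :=
    inferInstanceAs (SecondCountableTopology (Fin 2 → Fin 2 → ℝ))
  TopologicalSpace.Subtype.secondCountableTopology {A : Matrix (Fin 2) (Fin 2) ℝ | A.det = 1}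

theorem isClosedEmbedding_SL2_val :
    IsClosedEmbedding ((fun A => A.1) : SL2 → Matrix (Fin 2) (Fin 2) ℝ) :=
  (isClosed_eq (continuous_id.matrix_det) continuous_const).isClosedEmbedding_subtypeVal

instance : LocallyCompactSpace SL2 :=
  haveI : LocallyCompactSpace (Matrix (Fin 2) (Fin 2) ℝ) :=
    inferInstanceAs (LocallyCompactSpace (Fin 2 → Fin 2 → ℝ))
  isClosedEmbedding_SL2_val.locallyCompactSpace

theorem isClosed_SL2Z : IsClosed (SL2Z : Set SL2) := by
  have : (SL2Z : Set SL2) = ⋂ i, ⋂ j, (fun A : SL2 => A.1 i j) ⁻¹' Set.range ((↑) : ℤ → ℝ) := by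
    ext A
    simp only [SL2Z, MonoidHom.coe_range, Set.mem_range, Set.mem_iInter, Set.mem_preimage]
    constructor
    · rintro ⟨B, rfl⟩ i j
      exact ⟨B i j, by simp⟩
    · intro h
      choose B hB using h
      have hdet : (Matrix.of B).det = 1 := by
        have := A.2
        rw [Matrix.det_fin_two] at this ⊢
        simp only [← hB] at this
        exact_mod_cast this
      refine ⟨⟨Matrix.of B, hdet⟩, ?_⟩
      exact Matrix.SpecialLinearGroup.ext _ _ fun i j => hB i j
  rw [this]
  refine isClosed_iInter fun i => isClosed_iInter fun j => ?_
  refine Int.isClosedEmbedding_coe_real.isClosed_range.preimage ?_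
  exact (continuous_apply_apply i j).comp isClosedEmbedding_SL2_val.continuous

instance : T2Space (SL2 ⧸ SL2Z) := by
  rw [t2Space_iff_of_isOpenQuotientMap (QuotientGroup.isOpenQuotientMap_mk (N := SL2Z))]
  have : {q : SL2 × SL2 | (q.1 : SL2 ⧸ SL2Z) = q.2} =
      (fun q : SL2 × SL2 => q.1⁻¹ * q.2) ⁻¹' (SL2Z : Set SL2) := by
    ext q
    simp [QuotientGroup.eq]
  rw [this]
  exact isClosed_SL2Z.preimage (by fun_prop)

/-- A measurable function on a homogeneous space that is almost everywhere invariant under each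
group element is almost everywhere constant. -/
theorem ae_eq_const_of_forall_smul_ae_eq {G X : Type*} [Group G] [TopologicalSpace G]
    [IsTopologicalGroup G] [LocallyCompactSpace G] [SecondCountableTopology G]
    [TopologicalSpace X] [SecondCountableTopology X] [MeasurableSpace X] [BorelSpace X]
    [MulAction G X] [ContinuousSMul G X] [MulAction.IsPretransitive G X]
    (μ : Measure X) [IsProbabilityMeasure μ] {f : X → ℝ} (hf : Measurable f)
    (hinv : ∀ g : G, ∀ᵐ x ∂μ, f (g • x) = f x) : ∃ c, ∀ᵐ x ∂μ, f x = c := by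
  borelize G
  let ν : Measure G := Measure.haar
  have hm : Measurable fun p : G × X => p.1 • p.2 := continuous_smul.measurable
  have h1 : ∀ᵐ x ∂μ, ∀ᵐ g ∂ν, f (g • x) = f x := by
    refine (Measure.ae_ae_comm ?_).1 (Eventually.of_forall hinv)
    exact measurableSet_eq_fun (hf.comp hm) (hf.comp measurable_snd)
  obtain ⟨x₀, hx₀⟩ := h1.exists
  refine ⟨f x₀, ?_⟩
  have h2 : ∀ x, ∀ᵐ g ∂ν, f (g • x) = f x₀ := by
    intro x
    obtain ⟨k, rfl⟩ := MulAction.exists_smul_eq G x₀ x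
    have := (quasiMeasurePreserving_mul_right ν k).ae hx₀
    filter_upwards [this] with g hg
    rw [← mul_smul, hg]
  have h3 : ∀ᵐ g ∂ν, ∀ᵐ x ∂μ, f (g • x) = f x₀ := by
    refine (Measure.ae_ae_comm ?_).2 (Eventually.of_forall h2)
    exact measurableSet_eq_fun (hf.comp hm) measurable_const
  obtain ⟨g, hg⟩ := h3.exists
  filter_upwards [hg, hinv g] with x h h'
  rw [← h', h]

/-- The Mautner phenomenon for isometric actions. -/
theorem smul_eq_of_tendsto_mul_mul {M E ι : Type*} [Group M] [TopologicalSpace M]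
    [MetricSpace E] [MulAction M E] [IsIsometricSMul M E] [ContinuousSMul M E]
    {l : Filter ι} [l.NeBot] {ψ : E} {a : M} {p g q : ι → M}
    (hp : ∀ i, p i • ψ = ψ) (hq : ∀ i, q i • ψ = ψ) (hg : Tendsto g l (𝓝 1))
    (ha : Tendsto (fun i => p i * g i * q i) l (𝓝 a)) : a • ψ = ψ := by
  have h1 : Tendsto (fun i => (p i * g i * q i) • ψ) l (𝓝 (a • ψ)) := ha.smul_const ψ
  have h2 : Tendsto (fun i => (p i * g i * q i) • ψ) l (𝓝 ψ) := by
    rw [tendsto_iff_dist_tendsto_zero]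
    have h3 : Tendsto (fun i => dist (g i • ψ) ψ) l (𝓝 0) := by
      rw [← tendsto_iff_dist_tendsto_zero]
      simpa using hg.smul_const ψ
    refine h3.congr fun i => ?_
    rw [mul_smul, mul_smul, hq]
    nth_rewrite 4 [← hp i]
    rw [dist_smul]
  exact tendsto_nhds_unique h1 h2

/-- The element `[[a,b],[c,d]]` of `SL(2,ℝ)`. -/
def mkSL (a b c d : ℝ) (h : a * d - b * c = 1) : SL2 :=
  ⟨!![a, b; c, d], by rw [Matrix.det_fin_two_of, h]⟩

/-- The upper unipotent `[[1,t],[0,1]]`. -/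
def uSL (t : ℝ) : SL2 := mkSL 1 t 0 1 (by ring)

/-- The diagonal matrix with entries `e^t` and `e^{-t}`. -/
def aSL (t : ℝ) : SL2 := mkSL (Real.exp t) 0 0 (Real.exp (-t)) (by simp [← Real.exp_add])

theorem SL2_ext {A B : SL2} (h00 : A 0 0 = B 0 0) (h01 : A 0 1 = B 0 1) (h10 : A 1 0 = B 1 0)
    (h11 : A 1 1 = B 1 1) : A = B := by
  refine Matrix.SpecialLinearGroup.ext _ _ fun i j => ?_
  fin_cases i <;> fin_cases j <;> assumption

section entries
variable (a b c d : ℝ) (h : a * d - b * c = 1) (A B : SL2)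
@[simp] theorem mkSL_00 : mkSL a b c d h 0 0 = a := rfl
@[simp] theorem mkSL_01 : mkSL a b c d h 0 1 = b := rfl
@[simp] theorem mkSL_10 : mkSL a b c d h 1 0 = c := rfl
@[simp] theorem mkSL_11 : mkSL a b c d h 1 1 = d := rfl
@[simp] theorem hSL_00 : hSL a 0 0 = 1 := rfl
@[simp] theorem hSL_01 : hSL a 0 1 = 0 := rfl
@[simp] theorem hSL_10 : hSL a 1 0 = -a := rfl
@[simp] theorem hSL_11 : hSL a 1 1 = 1 := rfl
theorem SL2_mul_apply (i j : Fin 2) : (A * B) i j = A i 0 * B 0 j + A i 1 * B 1 j := by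
  simp [Matrix.SpecialLinearGroup.coe_mul, Matrix.mul_apply, Fin.sum_univ_two]
theorem SL2_det : A 0 0 * A 1 1 - A 0 1 * A 1 0 = 1 := by
  have := A.2
  rwa [Matrix.det_fin_two] at this
end entries

theorem tendsto_SL2 {ι : Type*} {l : Filter ι} {F : ι → SL2} {A : SL2}
    (h : ∀ i j, Tendsto (fun x => F x i j) l (𝓝 (A i j))) : Tendsto F l (𝓝 A) := by
  rw [isClosedEmbedding_SL2_val.isInducing.tendsto_nhds_iff]
  exact tendsto_pi_nhds.2 fun i => tendsto_pi_nhds.2 fun j => h i j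

theorem continuous_SL2_apply (i j : Fin 2) : Continuous fun A : SL2 => A i j :=
  (continuous_apply_apply i j).comp isClosedEmbedding_SL2_val.continuous

theorem continuous_SL2 {Y : Type*} [TopologicalSpace Y] {F : Y → SL2}
    (h : ∀ i j, Continuous fun y => F y i j) : Continuous F := by
  rw [isClosedEmbedding_SL2_val.isInducing.continuous_iff]
  exact continuous_pi fun i => continuous_pi fun j => h i j

theorem continuous_hSL : Continuous hSL :=
  continuous_SL2 fun i j => by
    fin_cases i <;> fin_cases j <;> simp <;> fun_prop

theorem hSL_add (s t : ℝ) : hSL (s + t) = hSL s * hSL t :=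
  SL2_ext (by simp [SL2_mul_apply]) (by simp [SL2_mul_apply])
    (by simp [SL2_mul_apply]; ring) (by simp [SL2_mul_apply])

theorem hSL_zero : hSL 0 = 1 :=
  SL2_ext (by simp) (by simp) (by simp) (by simp)

theorem hSL_natCast (n : ℕ) : hSL n = hSL 1 ^ n := by
  induction n with
  | zero => simp [hSL_zero]
  | succ n ih => rw [Nat.cast_succ, hSL_add, ih, pow_succ]

theorem hSL_neg (s : ℝ) : hSL (-s) = (hSL s)⁻¹ := by
  rw [eq_inv_iff_mul_eq_one, ← hSL_add, neg_add_cancel, hSL_zero]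

theorem aSL_add (s t : ℝ) : aSL (s + t) = aSL s * aSL t :=
  SL2_ext (by simp [SL2_mul_apply, aSL, Real.exp_add]) (by simp [SL2_mul_apply, aSL])
    (by simp [SL2_mul_apply, aSL]) (by simp [SL2_mul_apply, aSL, Real.exp_add, mul_comm])

theorem aSL_zero : aSL 0 = 1 :=
  SL2_ext (by simp [aSL]) (by simp [aSL]) (by simp [aSL]) (by simp [aSL])

theorem aSL_neg (s : ℝ) : aSL (-s) = (aSL s)⁻¹ := by
  rw [eq_inv_iff_mul_eq_one, ← aSL_add, neg_add_cancel, aSL_zero]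

theorem aSL_mul_hSL_mul (t s : ℝ) : aSL t * hSL s * aSL (-t) = hSL (s * Real.exp (-(2 * t))) := by
  have h2 : Real.exp (-(2 * t)) = Real.exp (-t) * Real.exp (-t) := by
    rw [← Real.exp_add]; ring_nf
  refine SL2_ext ?_ ?_ ?_ ?_ <;> simp [SL2_mul_apply, aSL, ← Real.exp_add]
  rw [h2]
  ring

theorem aSL_mul_uSL_mul (t s : ℝ) : aSL t * uSL s * aSL (-t) = uSL (s * Real.exp (2 * t)) := by
  have h2 : Real.exp (2 * t) = Real.exp t * Real.exp t := by
    rw [← Real.exp_add]; ring_nf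
  refine SL2_ext ?_ ?_ ?_ ?_ <;> simp [SL2_mul_apply, aSL, uSL, ← Real.exp_add]
  rw [h2]
  ring

/-- The group `SL(2,ℝ)` is generated by upper and lower unipotents. -/
theorem subgroup_eq_top_of_unipotents {H : Subgroup SL2} (hu : ∀ t, uSL t ∈ H)
    (hh : ∀ t, hSL t ∈ H) : H = ⊤ := by
  have key : ∀ A : SL2, A 1 0 ≠ 0 → A ∈ H := by
    intro A hA
    have : A = uSL ((A 0 0 - 1) / A 1 0) * hSL (-(A 1 0)) * uSL ((A 1 1 - 1) / A 1 0) := by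
      have hd := SL2_det A
      refine SL2_ext ?_ ?_ ?_ ?_ <;> simp [SL2_mul_apply, uSL] <;> field_simp <;> linarith
    rw [this]
    exact H.mul_mem (H.mul_mem (hu _) (hh _)) (hu _)
  rw [eq_top_iff]
  intro A _
  by_cases h : A 1 0 = 0
  · have hd := SL2_det A
    have h1 : A 1 1 ≠ 0 := by
      intro h0
      simp [h, h0] at hd
    have := key (A * hSL 1) (by simpa [SL2_mul_apply, h] using h1)
    simpa using H.mul_mem this (H.inv_mem (hh 1))
  · exact key A h

/-- A vector fixed by `h_1` in an isometric action of `SL(2,ℝ)` is fixed by all of `SL(2,ℝ)`. -/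
theorem smul_eq_of_hSL_one_smul_eq {E : Type*} [MetricSpace E] [MulAction SL2ᵈᵐᵃ E]
    [IsIsometricSMul SL2ᵈᵐᵃ E] [ContinuousSMul SL2ᵈᵐᵃ E] {ψ : E}
    (h : DomMulAct.mk (hSL 1) • ψ = ψ) (g : SL2) : DomMulAct.mk g • ψ = ψ := by
  let H : Subgroup SL2 :=
    { carrier := {g | DomMulAct.mk g • ψ = ψ}
      mul_mem' := by
        intro a b (ha : _ = _) (hb : _ = _)
        show DomMulAct.mk (a * b) • ψ = ψ
        rw [DomMulAct.mk_mul, mul_smul, ha, hb]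
      one_mem' := by simp
      inv_mem' := by
        intro a (ha : _ = _)
        show DomMulAct.mk a⁻¹ • ψ = ψ
        rw [DomMulAct.mk_inv, inv_smul_eq_iff, ha] }
  have mautner : ∀ {a : SL2} (p q r : ℕ → SL2), (∀ i, p i ∈ H) → (∀ i, r i ∈ H) →
      Tendsto q atTop (𝓝 1) → Tendsto (fun i => p i * q i * r i) atTop (𝓝 a) → a ∈ H := by
    intro a p q r hp hr hq ha
    refine smul_eq_of_tendsto_mul_mul (l := (atTop : Filter ℕ)) (M := SL2ᵈᵐᵃ)
      (p := fun i => DomMulAct.mk (r i)) (g := fun i => DomMulAct.mk (q i))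
      (q := fun i => DomMulAct.mk (p i)) hr hp ?_ ?_
    · exact (DomMulAct.continuous_mk.tendsto 1).comp hq
    · refine ((DomMulAct.continuous_mk.tendsto a).comp ha).congr fun i => ?_
      simp [mul_assoc]
  have hn : ∀ n : ℕ, hSL n ∈ H := fun n => by
    rw [hSL_natCast]
    exact H.pow_mem h n
  have hu : Continuous uSL := continuous_SL2 fun i j => by
    fin_cases i <;> fin_cases j <;> simp [uSL] <;> fun_prop
  have hb : Tendsto (fun k : ℕ => 1 / (2 * ((k : ℝ) + 1))) atTop (𝓝 0) := by
    simpa using (tendsto_one_div_add_atTop_nhds_zero_nat (𝕜 := ℝ)).mul_const 2⁻¹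
  have ha : aSL (Real.log 2) ∈ H := by
    refine mautner (fun k => hSL ((k + 1 : ℕ) : ℝ)) (fun k => uSL (1 / (2 * ((k : ℝ) + 1))))
      (fun k => hSL (-((2 * (k + 1) : ℕ) : ℝ))) (fun k => hn _) (fun k => ?_) ?_ ?_
    · rw [hSL_neg]
      exact H.inv_mem (hn _)
    · have h1 : uSL 0 = 1 := SL2_ext rfl rfl rfl rfl
      exact h1 ▸ (hu.tendsto 0).comp hb
    · have h2 : ∀ k : ℕ, hSL ((k + 1 : ℕ) : ℝ) * uSL (1 / (2 * ((k : ℝ) + 1))) *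
          hSL (-((2 * (k + 1) : ℕ) : ℝ)) = mkSL 2 (1 / (2 * ((k : ℝ) + 1))) 0 2⁻¹ (by simp) := by
        intro k
        have : (k : ℝ) + 1 ≠ 0 := by positivity
        refine SL2_ext ?_ ?_ ?_ ?_ <;> simp [SL2_mul_apply, uSL] <;> field_simp <;> ring
      simp only [h2]
      refine tendsto_SL2 fun i j => ?_
      have h3 : Real.exp (Real.log 2) = 2 := Real.exp_log two_pos
      fin_cases i <;> fin_cases j <;> simp only [Fin.mk_zero, Fin.mk_one,
        mkSL_00, mkSL_01, mkSL_10, mkSL_11, aSL, Real.exp_neg, h3]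
      · exact tendsto_const_nhds
      · exact hb
      · exact tendsto_const_nhds
      · exact tendsto_const_nhds
  have han : ∀ n : ℕ, aSL (n * Real.log 2) ∈ H := by
    intro n
    induction n with
    | zero => simp [aSL_zero, H.one_mem]
    | succ n ih =>
      rw [Nat.cast_succ, add_mul, one_mul, aSL_add]
      exact H.mul_mem ih ha
  have han' : ∀ n : ℕ, aSL (-(n * Real.log 2)) ∈ H := fun n => by
    rw [aSL_neg]
    exact H.inv_mem (han n)
  have hlim : ∀ t : ℝ, Tendsto (fun n : ℕ => t * Real.exp (-(2 * (n * Real.log 2)))) atTop (𝓝 0) := by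
    intro t
    have : Tendsto (fun n : ℕ => 2 * ((n : ℝ) * Real.log 2)) atTop atTop :=
      (tendsto_natCast_atTop_atTop.atTop_mul_const (Real.log_pos one_lt_two)).const_mul_atTop
        two_pos
    simpa using (Real.tendsto_exp_neg_atTop_nhds_zero.comp this).const_mul t
  have key : H = ⊤ := by
    refine subgroup_eq_top_of_unipotents (fun t => ?_) (fun t => ?_)
    · refine mautner (fun n => aSL (n * Real.log 2))
        (fun n => uSL (t * Real.exp (-(2 * (n * Real.log 2)))))
        (fun n => aSL (-(n * Real.log 2))) han han' ?_ ?_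
      · have h1 : uSL 0 = 1 := SL2_ext rfl rfl rfl rfl
        exact h1 ▸ (hu.tendsto 0).comp (hlim t)
      · refine tendsto_const_nhds.congr fun n => ?_
        rw [aSL_mul_uSL_mul, mul_assoc, ← Real.exp_add]
        simp
    · refine mautner (fun n => aSL (-(n * Real.log 2)))
        (fun n => hSL (t * Real.exp (-(2 * (n * Real.log 2)))))
        (fun n => aSL (- -(n * Real.log 2))) han' (by simpa using han) ?_ ?_
      · exact hSL_zero ▸ (continuous_hSL.tendsto 0).comp (hlim t)
      · refine tendsto_const_nhds.congr fun n => ?_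
        rw [aSL_mul_hSL_mul, mul_assoc, ← Real.exp_add]
        simp
  exact key.ge (Subgroup.mem_top g)

theorem lp_ae_const_of_smul_eq [MeasurableSpace (SL2 ⧸ SL2Z)] [BorelSpace (SL2 ⧸ SL2Z)]
    (μ : Measure (SL2 ⧸ SL2Z)) [IsProbabilityMeasure μ] [SMulInvariantMeasure SL2 (SL2 ⧸ SL2Z) μ]
    {ψ : Lp ℝ 2 μ} (h : DomMulAct.mk (hSL 1) • ψ = ψ) :
    ∃ c : ℝ, ψ =ᵐ[μ] fun _ => c := by
  borelize SL2
  have : Fact ((2 : ENNReal) ≠ ⊤) := ⟨by simp⟩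
  refine ae_eq_const_of_forall_smul_ae_eq (G := SL2) μ (Lp.stronglyMeasurable ψ).measurable
    fun g => ?_
  have h1 := smul_eq_of_hSL_one_smul_eq h g
  have h2 := DomMulAct.smul_Lp_ae_eq (DomMulAct.mk g) ψ
  rw [h1] at h2
  filter_upwards [h2] with x hx
  simpa using hx.symm

/-- Convergence in measure of the Birkhoff sums of `h_1`. -/
theorem tendsto_measure_birkhoff_hSL [MeasurableSpace (SL2 ⧸ SL2Z)] [BorelSpace (SL2 ⧸ SL2Z)]
    (μ : Measure (SL2 ⧸ SL2Z)) [IsProbabilityMeasure μ] [SMulInvariantMeasure SL2 (SL2 ⧸ SL2Z) μ]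
    {F : SL2 ⧸ SL2Z → ℝ} (hFc : Continuous F) {M : ℝ} (hM : ∀ x, |F x| ≤ M) {ε : ℝ} (hε : 0 < ε) :
    Tendsto (fun N : ℕ => μ {x | ε ≤ |(N : ℝ)⁻¹ * (∑ n ∈ Finset.range N, F (hSL n • x)) -
      ∫ y, F y ∂μ|}) atTop (𝓝 0) := by
  have hF : MemLp F 2 μ :=
    MemLp.of_bound hFc.aestronglyMeasurable M (ae_of_all _ hM)
  let T : Lp ℝ 2 μ →L[ℝ] Lp ℝ 2 μ := (Lp.compMeasurePreservingₗᵢ ℝ (hSL 1 • ·)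
    (measurePreserving_smul (hSL 1) μ)).toContinuousLinearMap
  have hT : ∀ φ, T φ = DomMulAct.mk (hSL 1) • φ := fun _ => rfl
  have hTn : ∀ n φ, T^[n] φ = DomMulAct.mk (hSL n) • φ := by
    intro n φ
    induction n with
    | zero => simp [hSL_zero]
    | succ n ih =>
      rw [Function.iterate_succ_apply', ih, hT, Nat.cast_succ, hSL_add, DomMulAct.mk_mul, mul_smul]
  let φ : Lp ℝ 2 μ := hF.toLp F
  let K := T.eqLocus (1 : Lp ℝ 2 μ →L[ℝ] Lp ℝ 2 μ)
  have hT1 : ‖T‖ ≤ 1 := LinearIsometry.norm_toContinuousLinearMap_le _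
  have hlim := T.tendsto_birkhoffAverage_orthogonalProjection hT1 φ
  set ψ : K := K.orthogonalProjectionOnto φ with hψ
  obtain ⟨c, hc⟩ := lp_ae_const_of_smul_eq μ (ψ := ψ.1) ψ.2
  have hone : Lp.const 2 μ (1 : ℝ) ∈ K := rfl
  have hcF : c = ∫ y, F y ∂μ := by
    have h0 : inner ℝ (Lp.const 2 μ (1 : ℝ)) φ = inner ℝ (Lp.const 2 μ (1 : ℝ)) ψ.1 :=
      (K.inner_orthogonalProjectionOnto_eq_of_mem_left ⟨_, hone⟩ φ).symm
    rw [L2.inner_def, L2.inner_def] at h0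
    have h1 : ∫ a, inner ℝ (Lp.const 2 μ (1 : ℝ) a) (φ a) ∂μ = ∫ y, F y ∂μ := by
      refine integral_congr_ae ?_
      filter_upwards [hF.coeFn_toLp] with x hx'
      simp [φ, hx']
    have h2 : ∫ a, inner ℝ (Lp.const 2 μ (1 : ℝ) a) (ψ.1 a) ∂μ = c := by
      rw [show c = ∫ y, c ∂μ by simp]
      refine integral_congr_ae ?_
      filter_upwards [hc] with x hx'
      simp [hx']
    rw [← h1, h0, h2]
  have hmeas := tendstoInMeasure_of_tendsto_Lp hlim (ENNReal.ofReal ε) (by simpa using hε)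
  refine hmeas.congr fun N => measure_congr ?_
  have h3 : ∀ n : ℕ, ∀ᵐ x ∂μ, (T^[n] φ) x = F (hSL n • x) := by
    intro n
    rw [hTn]
    have h4 := DomMulAct.smul_Lp_ae_eq (DomMulAct.mk (hSL n)) φ
    have h5 := (measurePreserving_smul (hSL n) μ).quasiMeasurePreserving.ae hF.coeFn_toLp
    filter_upwards [h4, h5] with x h h'
    rw [h]
    exact h'
  have h6 : ∀ᵐ x ∂μ, (birkhoffAverage ℝ T _root_.id N φ : Lp ℝ 2 μ) x =
      (N : ℝ)⁻¹ * ∑ n ∈ Finset.range N, F (hSL n • x) := by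
    have h7 := Lp.coeFn_smul (N : ℝ)⁻¹ (∑ n ∈ Finset.range N, T^[n] φ)
    have h8 := Lp.coeFn_finsetSum (Finset.range N) (fun n => T^[n] φ)
    filter_upwards [h7, h8, ae_all_iff.2 h3] with x hx hx' hx''
    simp only [birkhoffAverage, birkhoffSum, id]
    rw [hx, Pi.smul_apply, hx']
    simp [hx'']
  filter_upwards [h6, hc] with x hx hx'
  have : (ENNReal.ofReal ε ≤ edist ((birkhoffAverage ℝ T _root_.id N φ : Lp ℝ 2 μ) x) (ψ.1 x)) =
    (ε ≤ |(N : ℝ)⁻¹ * (∑ n ∈ Finset.range N, F (hSL n • x)) - ∫ y, F y ∂μ|) := by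
    rw [hx, hx', hcF, edist_dist, ENNReal.ofReal_le_ofReal_iff dist_nonneg, Real.dist_eq]
  exact this

theorem continuous_hSL_smul {f : SL2 ⧸ SL2Z → ℝ} (hf : Continuous f) :
    Continuous fun p : ℝ × (SL2 ⧸ SL2Z) => f (hSL p.1 • p.2) :=
  hf.comp ((continuous_hSL.comp continuous_fst).smul continuous_snd)

theorem continuous_hSL_orbit {f : SL2 ⧸ SL2Z → ℝ} (hf : Continuous f) (x : SL2 ⧸ SL2Z) :
    Continuous fun s : ℝ => f (hSL s • x) :=
  hf.comp (continuous_hSL.smul continuous_const)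

theorem abs_integral_le_of_abs_le {α : Type*} [MeasurableSpace α] {μ : Measure α}
    [IsProbabilityMeasure μ] {f : α → ℝ} {M : ℝ} (hM : ∀ x, |f x| ≤ M) : |∫ y, f y ∂μ| ≤ M := by
  simpa using norm_integral_le_of_norm_le_const (μ := μ) (f := f) (C := M) (ae_of_all _ hM)

/-- Horocycle averages converge in measure, by the mean ergodic theorem and ergodicity. -/
theorem exists_measure_horocycle_average_lt [MeasurableSpace (SL2 ⧸ SL2Z)]
    [BorelSpace (SL2 ⧸ SL2Z)] (μ : Measure (SL2 ⧸ SL2Z)) [IsProbabilityMeasure μ]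
    [SMulInvariantMeasure SL2 (SL2 ⧸ SL2Z) μ] {f : SL2 ⧸ SL2Z → ℝ} (hf : Continuous f) {M : ℝ}
    (hM : ∀ x, |f x| ≤ M) {ε : ℝ} (hε : 0 < ε) {κ : ENNReal} (hκ : 0 < κ) :
    ∃ L₀ : ℝ, 0 < L₀ ∧ ∀ L, L₀ ≤ L →
      μ {x | ε * L ≤ |(∫ s in (0 : ℝ)..L, f (hSL s • x)) - L * ∫ y, f y ∂μ|} < κ := by
  set c := ∫ y, f y ∂μ with hc
  have hcM : |c| ≤ M := abs_integral_le_of_abs_le hM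
  have hM0 : 0 ≤ M := (abs_nonneg _).trans hcM
  let F : SL2 ⧸ SL2Z → ℝ := fun x => ∫ s in (0 : ℝ)..1, f (hSL s • x)
  have hFc : Continuous F := by
    have h : Continuous fun p : (SL2 ⧸ SL2Z) × ℝ => f (hSL p.2 • p.1) :=
      hf.comp ((continuous_hSL.comp continuous_snd).smul continuous_fst)
    exact intervalIntegral.continuous_parametric_intervalIntegral_of_continuous'
      (f := fun x s => f (hSL s • x)) h 0 1
  have hFM : ∀ x, |F x| ≤ M := fun x => by
    have h := intervalIntegral.norm_integral_le_of_norm_le_const (a := (0 : ℝ)) (b := 1) (C := M)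
      (f := fun s => f (hSL s • x)) (fun s _ => hM _)
    rwa [sub_zero, abs_one, mul_one] at h
  have hFint : ∫ y, F y ∂μ = c := by
    have h1 : ∀ s : ℝ, ∫ y, f (hSL s • y) ∂μ = c := fun s =>
      (measurePreserving_smul (hSL s) μ).integral_comp
        (Homeomorph.smul (hSL s)).measurableEmbedding f
    have h2 : ∫ y, F y ∂μ = ∫ s in (0 : ℝ)..1, ∫ y, f (hSL s • y) ∂μ := by
      refine (intervalIntegral_integral_swap (f := fun s x => f (hSL s • x)) ?_).symm
      have : IsFiniteMeasure (volume.restrict (Set.uIoc (0 : ℝ) 1)) := by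
        rw [Set.uIoc_of_le zero_le_one]
        infer_instance
      refine Integrable.of_bound (C := M) (continuous_hSL_smul hf).aestronglyMeasurable
        (ae_of_all _ fun p => hM _)
    simp [h2, h1]
  have hsum : ∀ (N : ℕ) (x : SL2 ⧸ SL2Z), ∑ n ∈ Finset.range N, F (hSL n • x) =
      ∫ s in (0 : ℝ)..N, f (hSL s • x) := by
    intro N x
    have := intervalIntegral.sum_integral_adjacent_intervals (a := fun n : ℕ => (n : ℝ)) (n := N)
      (μ := volume) (f := fun s => f (hSL s • x))
      (fun k _ => (continuous_hSL_orbit hf x).intervalIntegrable _ _)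
    rw [Nat.cast_zero] at this
    rw [← this]
    refine Finset.sum_congr rfl fun n _ => ?_
    have h3 := intervalIntegral.integral_comp_add_right (a := 0) (b := 1)
      (fun s => f (hSL s • x)) (n : ℝ)
    simp only [zero_add] at h3
    rw [Nat.cast_succ, add_comm (n : ℝ) 1, ← h3]
    simp only [F, hSL_add, mul_smul]
  have hlim := tendsto_measure_birkhoff_hSL μ hFc hFM (half_pos hε)
  obtain ⟨N₀, hN₀⟩ := eventually_atTop.1 (hlim.eventually_lt_const hκ)
  refine ⟨(N₀ + 1) + 4 * M / ε + 1, by positivity, fun L hL => ?_⟩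
  have h4 : 0 ≤ 4 * M / ε := by positivity
  have hL0 : 0 ≤ L := by linarith [N₀.cast_nonneg (α := ℝ)]
  have hfl := Nat.floor_le hL0
  have hfl' := Nat.lt_floor_add_one L
  set N := ⌊L⌋₊
  have hNN : N₀ ≤ N := Nat.le_floor (by linarith)
  have hN : 4 * M / ε ≤ N := by linarith [N₀.cast_nonneg (α := ℝ)]
  have hNpos : (0 : ℝ) < N := by linarith [N₀.cast_nonneg (α := ℝ)]
  refine (measure_mono fun x hx => ?_).trans_lt (hN₀ N hNN)
  simp only [Set.mem_ofPred_eq, hsum, hFint] at hx ⊢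
  have hi : ∀ a b, IntervalIntegrable (fun s => f (hSL s • x)) volume a b :=
    fun a b => (continuous_hSL_orbit hf x).intervalIntegrable _ _
  have h5 : |∫ s in (N : ℝ)..L, f (hSL s • x)| ≤ M := by
    refine (intervalIntegral.norm_integral_le_of_norm_le_const (C := M)
      (f := fun s => f (hSL s • x)) (fun s _ => hM _)).trans ?_
    rw [abs_of_nonneg (by linarith)]
    nlinarith
  rw [← intervalIntegral.integral_add_adjacent_intervals (hi 0 N) (hi N L)] at hx
  set I := ∫ s in (0 : ℝ)..N, f (hSL s • x)
  set J := ∫ s in (N : ℝ)..L, f (hSL s • x)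
  have h6 : |I + J - L * c| ≤ |I - N * c| + 2 * M := by
    have : I + J - L * c = (I - N * c) + (J - (L - N) * c) := by ring
    rw [this]
    refine (abs_add_le _ _).trans ?_
    have : |J - (L - N) * c| ≤ 2 * M := by
      refine (abs_sub _ _).trans ?_
      rw [abs_mul, abs_of_nonneg (by linarith : 0 ≤ L - N)]
      nlinarith [abs_nonneg c]
    linarith
  have h7 : (N : ℝ)⁻¹ * I - c = (N : ℝ)⁻¹ * (I - N * c) := by field_simp
  rw [h7, abs_mul, abs_of_pos (inv_pos.2 hNpos), inv_mul_eq_div, le_div_iff₀ hNpos]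
  rw [div_le_iff₀ hε] at hN
  nlinarith

theorem exists_nhds_one_forall_abs_smul_sub_lt {G X : Type*} [Group G] [TopologicalSpace G]
    [IsTopologicalGroup G] [LocallyCompactSpace G] [TopologicalSpace X]
    [MulAction G X] [ContinuousSMul G X] {f : X → ℝ} (hf : Continuous f)
    (hcs : HasCompactSupport f) {ε : ℝ} (hε : 0 < ε) :
    ∃ V ∈ 𝓝 (1 : G), ∀ v ∈ V, ∀ x, |f (v • x) - f x| < ε := by
  obtain ⟨V₀, hV₀, hV₀1⟩ := exists_compact_mem_nhds (1 : G)
  let C : Set X := (fun p : G × X => p.1⁻¹ • p.2) '' (V₀ ×ˢ tsupport f)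
  have hC : IsCompact C := (hV₀.prod hcs).image (by fun_prop)
  have hout : ∀ v ∈ V₀, ∀ x ∉ C, f (v • x) = 0 := by
    intro v hv x hx
    by_contra hne
    exact hx ⟨(v, v • x), ⟨hv, subset_tsupport f hne⟩, by simp⟩
  have hn : IsOpen {p : G × X | |f (p.1 • p.2) - f p.2| < ε} :=
    isOpen_lt (by fun_prop) continuous_const
  obtain ⟨u, v, hu, -, h1u, hCv, huv⟩ := generalized_tube_lemma (isCompact_singleton (x := (1 : G)))
    hC hn (by rintro ⟨a, b⟩ ⟨rfl, -⟩; simpa using hε)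
  refine ⟨V₀ ∩ u, inter_mem hV₀1 (hu.mem_nhds (h1u rfl)), fun a ha x => ?_⟩
  by_cases hx : x ∈ C
  · exact huv (Set.mk_mem_prod ha.2 (hCv hx))
  · have h1 := hout 1 (mem_of_mem_nhds hV₀1) x hx
    rw [one_smul] at h1
    simpa [hout a ha.1 x hx, h1] using hε

theorem abs_integral_comp_sub_integral_le {g φ φ' : ℝ → ℝ} {M η : ℝ} (hg : Continuous g)
    (hM : ∀ x, |g x| ≤ M) (hφ : ∀ r ∈ Set.Icc (0 : ℝ) 1, HasDerivAt φ (φ' r) r)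
    (hφ' : ContinuousOn φ' (Set.Icc 0 1)) (hη : ∀ r ∈ Set.Icc (0 : ℝ) 1, |φ' r - 1| ≤ η)
    (h0 : |φ 0| ≤ η) (h1 : |φ 1 - 1| ≤ η) :
    |(∫ r in (0 : ℝ)..1, g (φ r)) - ∫ r in (0 : ℝ)..1, g r| ≤ 3 * (M * η) := by
  have hI : Set.uIcc (0 : ℝ) 1 = Set.Icc 0 1 := Set.uIcc_of_le zero_le_one
  have hM0 : 0 ≤ M := (abs_nonneg _).trans (hM 0)
  have hcv := intervalIntegral.integral_comp_mul_deriv (a := 0) (b := 1) (f := φ) (f' := φ')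
    (g := g) (by rwa [hI]) (by rwa [hI]) hg
  have hi : ∀ a b, IntervalIntegrable g volume a b := fun a b => hg.intervalIntegrable a b
  have hφc : ContinuousOn φ (Set.Icc 0 1) := fun r hr => (hφ r hr).continuousAt.continuousWithinAt
  have hgφ : ContinuousOn (fun r => g (φ r)) (Set.Icc 0 1) := hg.comp_continuousOn hφc
  have hb : ∀ a b, |∫ r in a..b, g r| ≤ M * |b - a| := fun a b =>
    intervalIntegral.norm_integral_le_of_norm_le_const (C := M) (f := g) fun s _ => hM s
  have e1 : |(∫ r in (0 : ℝ)..1, g (φ r)) - ∫ r in (0 : ℝ)..1, (g ∘ φ) r * φ' r| ≤ M * η := by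
    rw [← intervalIntegral.integral_sub]
    · have := intervalIntegral.norm_integral_le_of_norm_le_const (a := 0) (b := 1) (C := M * η)
        (f := fun r => g (φ r) - (g ∘ φ) r * φ' r) ?_
      · simpa using this
      · intro r hr
        rw [Set.uIoc_of_le zero_le_one] at hr
        have : g (φ r) - (g ∘ φ) r * φ' r = - (g (φ r) * (φ' r - 1)) := by
          simp only [Function.comp]; ring
        rw [this, norm_neg, norm_mul]
        exact mul_le_mul (hM _) (hη r ⟨hr.1.le, hr.2⟩) (norm_nonneg _) hM0
    · exact ContinuousOn.intervalIntegrable (by rwa [hI])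
    · exact ContinuousOn.intervalIntegrable (by rw [hI]; exact hgφ.mul hφ')
  rw [hcv] at e1
  have e2 : (∫ x in φ 0..φ 1, g x) = (∫ x in φ 0..0, g x) + (∫ x in (0 : ℝ)..1, g x) +
      ∫ x in (1 : ℝ)..φ 1, g x := by
    rw [intervalIntegral.integral_add_adjacent_intervals (hi _ _) (hi _ _),
      intervalIntegral.integral_add_adjacent_intervals (hi _ _) (hi _ _)]
  have e3 := hb (φ 0) 0
  have e4 := hb 1 (φ 1)
  rw [zero_sub, abs_neg] at e3
  have e5 : M * |φ 0| ≤ M * η := mul_le_mul_of_nonneg_left h0 hM0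
  have e6 : M * |φ 1 - 1| ≤ M * η := mul_le_mul_of_nonneg_left h1 hM0
  rw [e2] at e1
  rw [abs_le] at *
  constructor <;> linarith [e1.1, e1.2, e3.1, e3.2, e4.1, e4.2]

theorem exists_pos_le_measure_smul_of_isCompact [MeasurableSpace (SL2 ⧸ SL2Z)]
    [BorelSpace (SL2 ⧸ SL2Z)] (μ : Measure (SL2 ⧸ SL2Z)) [IsProbabilityMeasure μ]
    [SMulInvariantMeasure SL2 (SL2 ⧸ SL2Z) μ] {K : Set SL2} (hK : IsCompact K) {U : Set SL2}
    (hU : U ∈ 𝓝 1) :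
    ∃ κ : ENNReal, 0 < κ ∧ ∀ A ∈ K, κ ≤ μ ((fun u : SL2 => u • (A : SL2 ⧸ SL2Z)) '' U) := by
  refine hK.induction_on (p := fun K => ∃ κ : ENNReal, 0 < κ ∧ ∀ A ∈ K,
    κ ≤ μ ((fun u : SL2 => u • (A : SL2 ⧸ SL2Z)) '' U)) ⟨1, one_pos, by simp⟩ ?_ ?_ ?_
  · rintro s t hst ⟨κ, h0, h⟩
    exact ⟨κ, h0, fun A hA => h A (hst hA)⟩
  · rintro s t ⟨κ, h0, h⟩ ⟨κ', h0', h'⟩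
    refine ⟨min κ κ', lt_min h0 h0', ?_⟩
    rintro A (hA | hA)
    · exact (min_le_left _ _).trans (h A hA)
    · exact (min_le_right _ _).trans (h' A hA)
  · intro A _
    have hmul : Tendsto (fun p : SL2 × SL2 => p.1 * p.2⁻¹) (𝓝 1 ×ˢ 𝓝 1) (𝓝 1) := by
      have : Continuous fun p : SL2 × SL2 => p.1 * p.2⁻¹ := by fun_prop
      simpa [nhds_prod_eq] using this.tendsto (1, 1)
    obtain ⟨W, hW, W', hW', hWW⟩ := mem_prod_iff.1 (hmul hU)
    obtain ⟨O, hOW, hO, hO1⟩ := mem_nhds_iff.1 hW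
    refine ⟨(fun B => B * A⁻¹) ⁻¹' W', mem_nhdsWithin_of_mem_nhds ?_, ?_⟩
    · have : Continuous fun B : SL2 => B * A⁻¹ := by fun_prop
      exact this.continuousAt.preimage_mem_nhds (by simpa using hW')
    have hopen : IsOpen ((fun u : SL2 => u • (A : SL2 ⧸ SL2Z)) '' O) := by
      have : (fun u : SL2 => u • (A : SL2 ⧸ SL2Z)) '' O =
          (QuotientGroup.mk : SL2 → SL2 ⧸ SL2Z) '' ((fun u => u * A) '' O) := by
        rw [Set.image_image]; rfl
      rw [this]
      exact QuotientGroup.isOpenMap_coe _ ((Homeomorph.mulRight A).isOpenMap _ hO)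
    refine ⟨_, measure_isOpen_pos_of_smulInvariant_of_ne_zero SL2 (IsProbabilityMeasure.ne_zero μ)
      hopen ⟨_, ⟨1, hO1, rfl⟩⟩, fun B hB => measure_mono ?_⟩
    rintro _ ⟨w, hw, rfl⟩
    refine ⟨w * (B * A⁻¹)⁻¹, hWW (Set.mk_mem_prod (hOW hw) hB), ?_⟩
    show ((w * (B * A⁻¹)⁻¹ * B : SL2) : SL2 ⧸ SL2Z) = ((w * A : SL2) : SL2 ⧸ SL2Z)
    congr 1
    group

/-- For `u` close to `1`, the product `h_r u` factors as an upper triangular matrix near `1` times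
`h_φ(r)`, with `φ` close to the identity in `C¹` on `[0, 1]`. -/
theorem exists_nhds_one_forall_unipotent_factor {V : Set SL2} (hV : V ∈ 𝓝 1) {η : ℝ}
    (hη : 0 < η) :
    ∃ U ∈ 𝓝 (1 : SL2), ∀ u ∈ U, ∀ r ∈ Set.Icc (0 : ℝ) 1, ∀ θ ∈ Set.Icc (0 : ℝ) 1,
      0 < u 1 1 - r * u 0 1 ∧ |((u 1 1 - r * u 0 1) ^ 2)⁻¹ - 1| ≤ η ∧
      |(r * u 0 0 - u 1 0) / (u 1 1 - r * u 0 1) - r| ≤ η ∧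
      ∀ v : SL2, v 0 0 = (u 1 1 - r * u 0 1)⁻¹ → v 0 1 = θ * u 0 1 → v 1 0 = 0 →
        v 1 1 = u 1 1 - r * u 0 1 → v ∈ V := by
  rw [isClosedEmbedding_SL2_val.isInducing.nhds_eq_comap, mem_comap] at hV
  obtain ⟨N, hN, hNV⟩ := hV
  have key : ∀ᶠ u : SL2 in 𝓝 1, ∀ p ∈ Set.Icc (0 : ℝ) 1 ×ˢ Set.Icc (0 : ℝ) 1,
      0 < u 1 1 - p.1 * u 0 1 ∧ |((u 1 1 - p.1 * u 0 1) ^ 2)⁻¹ - 1| < η ∧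
      |(p.1 * u 0 0 - u 1 0) / (u 1 1 - p.1 * u 0 1) - p.1| < η ∧
      !![(u 1 1 - p.1 * u 0 1)⁻¹, p.2 * u 0 1; 0, u 1 1 - p.1 * u 0 1] ∈ N := by
    refine (isCompact_Icc.prod isCompact_Icc).eventually_forall_of_forall_eventually ?_
    rintro ⟨r, θ⟩ -
    have hc : ∀ i j, Continuous fun z : SL2 × ℝ × ℝ => z.1 i j := fun i j =>
      (continuous_SL2_apply i j).comp continuous_fst
    have h1 : Continuous fun z : SL2 × ℝ × ℝ => z.2.1 := by fun_prop
    have h2 : Continuous fun z : SL2 × ℝ × ℝ => z.2.2 := by fun_prop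
    have hq : Continuous fun z : SL2 × ℝ × ℝ => z.1 1 1 - z.2.1 * z.1 0 1 :=
      (hc 1 1).sub (h1.mul (hc 0 1))
    have hq1 : (1 : SL2) 1 1 - r * (1 : SL2) 0 1 = 1 := by simp
    have hqa : ContinuousAt (fun z : SL2 × ℝ × ℝ => (z.1 1 1 - z.2.1 * z.1 0 1)⁻¹) (1, r, θ) :=
      hq.continuousAt.inv₀ (by simp)
    refine (hq.continuousAt.eventually (lt_mem_nhds (by simp))).and
      (Eventually.and ?_ (Eventually.and ?_ ?_))
    · have : ContinuousAt (fun z : SL2 × ℝ × ℝ => |((z.1 1 1 - z.2.1 * z.1 0 1) ^ 2)⁻¹ - 1|)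
          (1, r, θ) :=
        (((hq.pow 2).continuousAt.inv₀ (by simp)).sub continuousAt_const).abs
      exact this.eventually (gt_mem_nhds (by simpa using hη))
    · have : ContinuousAt (fun z : SL2 × ℝ × ℝ => |(z.2.1 * z.1 0 0 - z.1 1 0) /
          (z.1 1 1 - z.2.1 * z.1 0 1) - z.2.1|) (1, r, θ) :=
        (((((h1.mul (hc 0 0)).sub (hc 1 0)).continuousAt).div hq.continuousAt (by simp)).sub
          h1.continuousAt).abs
      exact this.eventually (gt_mem_nhds (by simpa using hη))
    · have : ContinuousAt (fun z : SL2 × ℝ × ℝ => !![(z.1 1 1 - z.2.1 * z.1 0 1)⁻¹,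
          z.2.2 * z.1 0 1; 0, z.1 1 1 - z.2.1 * z.1 0 1]) (1, r, θ) := by
        refine continuousAt_pi.2 fun i => continuousAt_pi.2 fun j => ?_
        fin_cases i <;> fin_cases j
        · exact hqa
        · exact (h2.mul (hc 0 1)).continuousAt
        · exact continuousAt_const
        · exact hq.continuousAt
      refine this.eventually ?_
      have h1N : !![((1 : SL2) 1 1 - r * (1 : SL2) 0 1)⁻¹, θ * (1 : SL2) 0 1; 0,
          (1 : SL2) 1 1 - r * (1 : SL2) 0 1] = ((1 : SL2) : Matrix (Fin 2) (Fin 2) ℝ) := by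
        ext i j
        fin_cases i <;> fin_cases j <;> simp
      have h2N : N ∈ 𝓝 !![((1 : SL2) 1 1 - r * (1 : SL2) 0 1)⁻¹, θ * (1 : SL2) 0 1; 0,
          (1 : SL2) 1 1 - r * (1 : SL2) 0 1] := by rwa [h1N]
      exact h2N
  refine ⟨_, key, fun u hu r hr θ hθ => ?_⟩
  obtain ⟨a, b, c, d⟩ := hu (r, θ) ⟨hr, hθ⟩
  refine ⟨a, b.le, c.le, fun v h00 h01 h10 h11 => hNV ?_⟩
  have hv : (v : Matrix (Fin 2) (Fin 2) ℝ) =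
      !![(u 1 1 - r * u 0 1)⁻¹, θ * u 0 1; 0, u 1 1 - r * u 0 1] := by
    ext i j
    fin_cases i <;> fin_cases j
    exacts [h00, h01, h10, h11]
  show (v : Matrix (Fin 2) (Fin 2) ℝ) ∈ N
  exact hv ▸ d

theorem integral_orbit_aSL_neg_smul {f : SL2 ⧸ SL2Z → ℝ} (t : ℝ) (x : SL2 ⧸ SL2Z) :
    ∫ s in (0 : ℝ)..Real.exp (2 * t), f (hSL s • aSL (-t) • x) =
      Real.exp (2 * t) * ∫ r in (0 : ℝ)..1, f (aSL (-t) • hSL r • x) := by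
  have h := intervalIntegral.mul_integral_comp_mul_left (a := 0) (b := 1)
    (f := fun s => f (hSL s • aSL (-t) • x)) (Real.exp (2 * t))
  rw [mul_zero, mul_one] at h
  rw [← h]
  congr 2
  ext r
  have h1 := aSL_mul_hSL_mul (-t) r
  rw [show -(2 * -t) = 2 * t by ring, neg_neg] at h1
  rw [mul_comm, ← h1, smul_smul, smul_smul]
  congr 2
  rw [mul_assoc, mul_assoc, ← aSL_add, add_neg_cancel, aSL_zero, mul_one]

theorem abs_sub_integral_aSL_smul_le {f : SL2 ⧸ SL2Z → ℝ} (hf : Continuous f) {M ε η : ℝ}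
    (hM : ∀ x, |f x| ≤ M) {V : Set SL2} (hVf : ∀ v ∈ V, ∀ x, |f (v • x) - f x| < ε) {u : SL2}
    (hu : ∀ r ∈ Set.Icc (0 : ℝ) 1, ∀ θ ∈ Set.Icc (0 : ℝ) 1,
      0 < u 1 1 - r * u 0 1 ∧ |((u 1 1 - r * u 0 1) ^ 2)⁻¹ - 1| ≤ η ∧
      |(r * u 0 0 - u 1 0) / (u 1 1 - r * u 0 1) - r| ≤ η ∧
      ∀ v : SL2, v 0 0 = (u 1 1 - r * u 0 1)⁻¹ → v 0 1 = θ * u 0 1 → v 1 0 = 0 →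
        v 1 1 = u 1 1 - r * u 0 1 → v ∈ V) {t : ℝ} (ht : 0 ≤ t) (x : SL2 ⧸ SL2Z) :
    |(∫ r in (0 : ℝ)..1, f (aSL (-t) • hSL r • u • x)) -
      ∫ r in (0 : ℝ)..1, f (aSL (-t) • hSL r • x)| ≤ ε + 3 * (M * η) := by
  set g : ℝ → ℝ := fun r => f (aSL (-t) • hSL r • x) with hgdef
  set φ : ℝ → ℝ := fun r => (r * u 0 0 - u 1 0) / (u 1 1 - r * u 0 1) with hφdef
  have hθ : Real.exp (-(2 * t)) ∈ Set.Icc (0 : ℝ) 1 :=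
    ⟨(Real.exp_pos _).le, Real.exp_le_one_iff.2 (by linarith)⟩
  have hcs : ∀ y : SL2 ⧸ SL2Z, Continuous fun r => aSL (-t) • hSL r • y := fun y => by
    simp_rw [smul_smul]
    exact (continuous_const.mul continuous_hSL).smul continuous_const
  have hg : Continuous g := hf.comp (hcs x)
  have hI : Set.uIcc (0 : ℝ) 1 = Set.Icc 0 1 := Set.uIcc_of_le zero_le_one
  have hφd : ∀ r ∈ Set.Icc (0 : ℝ) 1, HasDerivAt φ (((u 1 1 - r * u 0 1) ^ 2)⁻¹) r := by
    intro r hr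
    have hq := (hu r hr _ hθ).1
    have h1 : HasDerivAt (fun r => r * u 0 0 - u 1 0) (1 * u 0 0) r :=
      ((hasDerivAt_id r).mul_const _).sub_const _
    have h2 : HasDerivAt (fun r => u 1 1 - r * u 0 1) (-(1 * u 0 1)) r :=
      ((hasDerivAt_id r).mul_const _).const_sub _
    refine (h1.div h2 hq.ne').congr_deriv ?_
    rw [inv_eq_one_div]
    congr 1
    linear_combination SL2_det u
  have hφ'c : ContinuousOn (fun r => ((u 1 1 - r * u 0 1) ^ 2)⁻¹) (Set.Icc (0 : ℝ) 1) :=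
    ContinuousOn.inv₀ (by fun_prop) fun r hr => (pow_pos (hu r hr _ hθ).1 2).ne'
  have h3 := abs_integral_comp_sub_integral_le hg (fun _ => hM _) hφd hφ'c
    (fun r hr => (hu r hr _ hθ).2.1)
    (by simpa [φ] using (hu 0 (by simp) _ hθ).2.2.1)
    (by simpa [φ] using (hu 1 (by simp) _ hθ).2.2.1)
  have hpt : ∀ r ∈ Set.Icc (0 : ℝ) 1, |f (aSL (-t) • hSL r • u • x) - g (φ r)| ≤ ε := by
    intro r hr
    obtain ⟨hq, -, -, hv⟩ := hu r hr _ hθ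
    have := hv (mkSL (u 1 1 - r * u 0 1)⁻¹ (Real.exp (-(2 * t)) * u 0 1) 0 (u 1 1 - r * u 0 1)
      (by rw [mul_zero, sub_zero, inv_mul_cancel₀ hq.ne'])) rfl rfl rfl rfl
    refine le_of_eq_of_le ?_ (hVf _ this (aSL (-t) • hSL (φ r) • x)).le
    simp only [g, smul_smul]
    congr 4
    have he : Real.exp (-(2 * t)) * Real.exp t = Real.exp (-t) := by
      rw [← Real.exp_add]; ring_nf
    have a00 : aSL (-t) 0 0 = Real.exp (-t) := rfl
    have a01 : aSL (-t) 0 1 = 0 := rfl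
    have a10 : aSL (-t) 1 0 = 0 := rfl
    have a11 : aSL (-t) 1 1 = Real.exp t := by
      show Real.exp (- -t) = _
      rw [neg_neg]
    have hφq : φ r * (u 1 1 - r * u 0 1) = r * u 0 0 - u 1 0 := div_mul_cancel₀ _ hq.ne'
    have hqi := inv_mul_cancel₀ hq.ne'
    have hφi : u 0 0 = (u 1 1 - r * u 0 1)⁻¹ - u 0 1 * φ r := by
      have hd := SL2_det u
      refine mul_right_cancel₀ hq.ne' ?_
      linear_combination hd - hqi + u 0 1 * hφq
    apply SL2_ext <;> simp only [SL2_mul_apply, mkSL_00, mkSL_01, mkSL_10, mkSL_11, hSL_00, hSL_01,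
      hSL_10, hSL_11, a00, a01, a10, a11]
    · linear_combination Real.exp (-t) * hφi + u 0 1 * φ r * he
    · linear_combination - u 0 1 * he
    · linear_combination Real.exp t * hφq
    · ring
  have hgφ : ContinuousOn (fun r => g (φ r)) (Set.Icc 0 1) :=
    hg.comp_continuousOn fun r hr => (hφd r hr).continuousAt.continuousWithinAt
  have h4 : |(∫ r in (0 : ℝ)..1, f (aSL (-t) • hSL r • u • x)) -
      ∫ r in (0 : ℝ)..1, g (φ r)| ≤ ε := by
    rw [← intervalIntegral.integral_sub]
    · have := intervalIntegral.norm_integral_le_of_norm_le_const (a := 0) (b := 1) (C := ε)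
        (f := fun r => f (aSL (-t) • hSL r • u • x) - g (φ r)) ?_
      · simpa using this
      · intro r hr
        rw [Set.uIoc_of_le zero_le_one] at hr
        exact hpt r ⟨hr.1.le, hr.2⟩
    · exact (hf.comp (hcs (u • x))).intervalIntegrable _ _
    · exact ContinuousOn.intervalIntegrable (by rwa [hI])
  have := abs_sub_le (∫ r in (0 : ℝ)..1, f (aSL (-t) • hSL r • u • x))
    (∫ r in (0 : ℝ)..1, g (φ r)) (∫ r in (0 : ℝ)..1, g r)
  linarith

/-- Averages over expanding horocycle segments based at a compact set converge uniformly. -/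
theorem exists_uniform_horocycle_average [MeasurableSpace (SL2 ⧸ SL2Z)]
    [BorelSpace (SL2 ⧸ SL2Z)] (μ : Measure (SL2 ⧸ SL2Z)) [IsProbabilityMeasure μ]
    [SMulInvariantMeasure SL2 (SL2 ⧸ SL2Z) μ] {K : Set SL2} (hK : IsCompact K)
    {f : SL2 ⧸ SL2Z → ℝ} (hf : Continuous f) (hcs : HasCompactSupport f) {M ε : ℝ}
    (hM : ∀ x, |f x| ≤ M) (hε : 0 < ε) :
    ∃ T : ℝ, 0 < T ∧ ∀ t, T ≤ t → ∀ A ∈ K,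
      |(∫ s in (0 : ℝ)..Real.exp (2 * t), f (hSL s • aSL (-t) • (A : SL2 ⧸ SL2Z))) -
        Real.exp (2 * t) * ∫ y, f y ∂μ| ≤ ε * Real.exp (2 * t) := by
  have hM0 : 0 ≤ M := (abs_nonneg _).trans (hM (1 : SL2))
  obtain ⟨V, hV, hVf⟩ := exists_nhds_one_forall_abs_smul_sub_lt (G := SL2) hf hcs
    (ε := ε / 4) (by positivity)
  obtain ⟨U, hU, hUV⟩ := exists_nhds_one_forall_unipotent_factor hV
    (η := ε / (12 * (M + 1))) (by positivity)
  obtain ⟨κ, hκ, hκU⟩ := exists_pos_le_measure_smul_of_isCompact μ hK hU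
  obtain ⟨L₀, hL₀, hL⟩ := exists_measure_horocycle_average_lt μ hf hM
    (ε := ε / 4) (by positivity) hκ
  have hη : 3 * (M * (ε / (12 * (M + 1)))) ≤ ε / 4 := by
    rw [show 3 * (M * (ε / (12 * (M + 1)))) = (ε / 4) * (M / (M + 1)) by field_simp; ring]
    exact mul_le_of_le_one_right (by positivity) ((div_le_one (by positivity)).2 (by linarith))
  refine ⟨max 1 L₀, by positivity, fun t ht A hA => ?_⟩
  have ht0 : 0 ≤ t := by linarith [le_max_left 1 L₀]
  have hLt : L₀ ≤ Real.exp (2 * t) := by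
    linarith [le_max_right 1 L₀, Real.add_one_le_exp (2 * t)]
  have hbad := hL _ hLt
  obtain ⟨u, hu, hgood⟩ : ∃ u ∈ U, aSL (-t) • u • (A : SL2 ⧸ SL2Z) ∉
      {x | ε / 4 * Real.exp (2 * t) ≤ |(∫ s in (0 : ℝ)..Real.exp (2 * t), f (hSL s • x)) -
        Real.exp (2 * t) * ∫ y, f y ∂μ|} := by
    by_contra! hcon
    refine absurd hbad (not_lt.2 ((hκU A hA).trans ?_))
    rw [← measure_preimage_smul μ (aSL (-t)) {x : SL2 ⧸ SL2Z | _}]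
    refine measure_mono ?_
    rintro _ ⟨u, hu, rfl⟩
    exact hcon u hu
  rw [Set.mem_ofPred_eq, not_le, integral_orbit_aSL_neg_smul] at hgood
  have hcmp := abs_sub_integral_aSL_smul_le hf hM hVf (hUV u hu) ht0 (A : SL2 ⧸ SL2Z)
  rw [integral_orbit_aSL_neg_smul]
  set E := Real.exp (2 * t)
  have hE : 0 < E := Real.exp_pos _
  set I₁ := ∫ r in (0 : ℝ)..1, f (aSL (-t) • hSL r • u • (A : SL2 ⧸ SL2Z))
  set I₂ := ∫ r in (0 : ℝ)..1, f (aSL (-t) • hSL r • (A : SL2 ⧸ SL2Z))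
  set c := ∫ y, f y ∂μ
  rw [← mul_sub, abs_mul, abs_of_pos hE, mul_comm] at hgood ⊢
  have h1 : |I₁ - c| < ε / 4 := lt_of_mul_lt_mul_right hgood hE.le
  refine mul_le_mul_of_nonneg_right ?_ hE.le
  rw [abs_le] at hcmp ⊢
  rw [abs_lt] at h1
  constructor <;> linarith [hcmp.1, hcmp.2, h1.1, h1.2]

/-- If small averages can be found starting from every point, the whole average is small. -/
theorem abs_integral_le_of_forall_exists_abs_integral_le {F : ℝ → ℝ} (hF : Continuous F)
    {M ε L₀ Lmax : ℝ} (hM : ∀ s, |F s| ≤ M) (hε : 0 ≤ ε) (hL₀ : 0 < L₀) (hLmax : 0 ≤ Lmax)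
    {a b : ℝ} (hab : a ≤ b)
    (h : ∀ s ∈ Set.Ico a b, ∃ L, L₀ ≤ L ∧ L ≤ Lmax ∧ |∫ x in s..s + L, F x| ≤ ε * L) :
    |∫ x in a..b, F x| ≤ ε * (b - a) + M * Lmax := by
  have hM0 : 0 ≤ M := (abs_nonneg _).trans (hM 0)
  obtain ⟨n, hn⟩ := exists_nat_ge ((b - a) / L₀)
  rw [div_le_iff₀ hL₀] at hn
  induction n generalizing a with
  | zero =>
    have : a = b := by simp at hn; linarith
    subst this
    simpa using mul_nonneg hM0 hLmax
  | succ n ih =>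
    rcases hab.eq_or_lt with rfl | hlt
    · simpa using mul_nonneg hM0 hLmax
    obtain ⟨L, h1, h2, h3⟩ := h a ⟨le_rfl, hlt⟩
    rcases le_total b (a + L) with hb | hb
    · have := intervalIntegral.norm_integral_le_of_norm_le_const (a := a) (b := b) (C := M)
        (f := F) fun s _ => hM s
      rw [Real.norm_eq_abs, abs_of_nonneg (sub_nonneg.2 hab)] at this
      have : M * (b - a) ≤ M * Lmax := mul_le_mul_of_nonneg_left (by linarith) hM0
      have : 0 ≤ ε * (b - a) := mul_nonneg hε (by linarith)
      linarith
    · have h4 := ih hb (fun s hs => h s ⟨by linarith [hs.1], hs.2⟩) (by push_cast at hn; linarith)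
      rw [← intervalIntegral.integral_add_adjacent_intervals (hF.intervalIntegrable a (a + L))
        (hF.intervalIntegrable (a + L) b)]
      refine (abs_add_le _ _).trans ?_
      linarith

theorem abs_integral_le_of_exists_outside {F : ℝ → ℝ} (hF : Continuous F)
    {M ε L₀ Lmax S s₀ r : ℝ} (hM : ∀ s, |F s| ≤ M) (hε : 0 ≤ ε) (hL₀ : 0 < L₀)
    (hLmax : 0 ≤ Lmax) (hS : 0 ≤ S) (hr : 0 ≤ r)
    (h : ∀ s ∈ Set.Ico 0 S, r ≤ |s - s₀| →
      ∃ L, L₀ ≤ L ∧ L ≤ Lmax ∧ |∫ x in s..s + L, F x| ≤ ε * L) :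
    |∫ x in (0 : ℝ)..S, F x| ≤ ε * S + 2 * (M * Lmax) + 2 * (M * r) := by
  have hM0 : 0 ≤ M := (abs_nonneg _).trans (hM 0)
  set p := max 0 (min S (s₀ - r)) with hp
  set q := max 0 (min S (s₀ + r)) with hq
  have hp0 : 0 ≤ p := le_max_left _ _
  have hqS : q ≤ S := max_le hS (min_le_left _ _)
  have hpq : p ≤ q := max_le_max le_rfl (min_le_min le_rfl (by linarith))
  have hqp : q - p ≤ 2 * r := by
    have h1 : q ≤ p + 2 * r := by
      refine max_le (by linarith) ?_
      rcases le_total S (s₀ - r) with h | h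
      · have : p = max 0 S := by rw [hp, min_eq_left h]
        linarith [min_le_left S (s₀ + r), le_max_right 0 S]
      · have : p = max 0 (s₀ - r) := by rw [hp, min_eq_right h]
        linarith [min_le_right S (s₀ + r), le_max_right 0 (s₀ - r)]
    linarith
  have h1 := abs_integral_le_of_forall_exists_abs_integral_le hF hM hε hL₀ hLmax hp0
    fun s hs => h s ⟨hs.1, by linarith [hs.2]⟩ (by
      have : s < min S (s₀ - r) := by
        rcases lt_max_iff.1 hs.2 with h | h
        · exact absurd hs.1 (not_le.2 h)
        · exact h
      rw [abs_sub_comm]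
      exact le_trans (by linarith [min_le_right S (s₀ - r)]) (le_abs_self _))
  have h2 := abs_integral_le_of_forall_exists_abs_integral_le hF hM hε hL₀ hLmax hqS
    fun s hs => h s ⟨by linarith [hs.1], hs.2⟩ (by
      have h3 : min S (s₀ + r) ≤ s := (le_max_right _ _).trans hs.1
      rcases min_le_iff.1 h3 with h | h
      · exact absurd hs.2 (not_lt.2 h)
      · exact le_trans (by linarith) (le_abs_self _))
  have h3 := intervalIntegral.norm_integral_le_of_norm_le_const (a := p) (b := q) (C := M)
        (f := F) fun s _ => hM s
  rw [Real.norm_eq_abs, abs_of_nonneg (sub_nonneg.2 hpq)] at h3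
  have h4 : M * (q - p) ≤ M * (2 * r) := mul_le_mul_of_nonneg_left hqp hM0
  have h5 : ε * (q - p) ≥ 0 := mul_nonneg hε (by linarith)
  have hi : ∀ a b, IntervalIntegrable F volume a b := fun a b => hF.intervalIntegrable a b
  rw [← intervalIntegral.integral_add_adjacent_intervals (hi 0 q) (hi q S),
    ← intervalIntegral.integral_add_adjacent_intervals (hi 0 p) (hi p q)]
  rw [abs_le] at *
  constructor <;> linarith [h1.1, h1.2, h2.1, h2.2, h3.1, h3.2]

theorem mk_mul_eq_of_mem_SL2Z (A : SL2) {γ : SL2} (hγ : γ ∈ SL2Z) :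
    ((A * γ : SL2) : SL2 ⧸ SL2Z) = A :=
  QuotientGroup.eq.2 (by simpa using inv_mem hγ)

theorem mkSL_intCast_mem_SL2Z (a b c d : ℤ) (h : (a : ℝ) * d - b * c = 1) :
    mkSL a b c d h ∈ SL2Z := by
  refine ⟨⟨!![a, b; c, d], by rw [Matrix.det_fin_two_of]; exact_mod_cast h⟩, ?_⟩
  apply SL2_ext <;> rfl

theorem exists_int_of_mem_SL2Z {γ : SL2} (h : γ ∈ SL2Z) (i j : Fin 2) :
    ∃ m : ℤ, γ i j = m := by
  obtain ⟨A, rfl⟩ := h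
  exact ⟨A i j, rfl⟩

theorem isCompact_setOf_abs_le (D : ℝ) : IsCompact {A : SL2 | ∀ i j, |A i j| ≤ D} := by
  have : IsCompact (Set.univ.pi fun _ : Fin 2 => Set.univ.pi fun _ : Fin 2 => Set.Icc (-D) D) :=
    isCompact_univ_pi fun _ => isCompact_univ_pi fun _ => isCompact_Icc
  convert isClosedEmbedding_SL2_val.isCompact_preimage this using 1
  ext A
  simp only [Set.mem_ofPred_eq, abs_le]
  exact ⟨fun h i _ j _ => h i j, fun h i j => h i trivial j trivial⟩

/-- Dirichlet approximation: the coset `gΓ` has representatives with controlled first column. -/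
theorem exists_representative_short_column {g : SL2} (hg : g 0 1 ≠ 0) :
    ∃ C : ℝ, 0 < C ∧ ∀ R : ℝ, 1 ≤ R → ∃ δ : SL2, (δ : SL2 ⧸ SL2Z) = g ∧
      |δ 0 0| ≤ C / R ∧ |δ 1 0| ≤ C * R := by
  set ξ := g 0 0 / g 0 1 with hξ
  set C₁ := |g 1 0| + (|ξ| + 1) * |g 1 1| with hC₁
  have hC₁0 : 0 ≤ C₁ := by positivity
  refine ⟨max |g 0 1| C₁, lt_max_of_lt_left (abs_pos.2 hg), fun R hR => ?_⟩
  have hN : 0 < ⌊R⌋₊ := Nat.floor_pos.2 hR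
  have hR0 : 0 < R := by linarith
  obtain ⟨q, h1, h2⟩ := Real.exists_rat_abs_sub_le_and_den_le ξ hN
  have hd : (0 : ℝ) < q.den := by exact_mod_cast q.pos
  obtain ⟨x, y, hxy⟩ := q.isCoprime_num_den
  have hxy' : (x : ℝ) * q.num + y * q.den = 1 := by exact_mod_cast hxy
  have hdet : ((q.den : ℤ) : ℝ) * (y : ℤ) - (x : ℤ) * ((-q.num : ℤ) : ℝ) = 1 := by
    push_cast; linarith
  have hqn : (q : ℝ) * q.den = q.num := by exact_mod_cast Rat.mul_den_eq_num q
  have hdR : (q.den : ℝ) ≤ R := (Nat.cast_le.2 h2).trans (Nat.floor_le hR0.le)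
  refine ⟨g * mkSL _ _ _ _ hdet, mk_mul_eq_of_mem_SL2Z _ (mkSL_intCast_mem_SL2Z _ _ _ _ hdet),
    ?_, ?_⟩
  · rw [SL2_mul_apply, mkSL_00, mkSL_10]
    have h3 : g 0 0 * ((q.den : ℤ) : ℝ) + g 0 1 * ((-q.num : ℤ) : ℝ) =
        g 0 1 * ((ξ - q) * q.den) := by
      push_cast
      rw [sub_mul, hqn, hξ]
      field_simp
      ring
    have h4 : |ξ - q| * q.den ≤ 1 / R := by
      calc |ξ - q| * q.den ≤ 1 / ((⌊R⌋₊ + 1) * q.den) * q.den := by gcongr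
        _ = 1 / (⌊R⌋₊ + 1) := by field_simp
        _ ≤ 1 / R := one_div_le_one_div_of_le hR0 (Nat.lt_floor_add_one R).le
    rw [h3, abs_mul, abs_mul, abs_of_pos hd, div_eq_mul_one_div]
    exact mul_le_mul (le_max_left _ _) h4 (by positivity) (by positivity)
  · rw [SL2_mul_apply, mkSL_00, mkSL_10]
    have h5 : |ξ - q| ≤ 1 := by
      refine h1.trans ((div_le_one (by positivity)).2 ?_)
      have : (1 : ℝ) ≤ q.den := by exact_mod_cast q.pos
      nlinarith [Nat.cast_nonneg (α := ℝ) ⌊R⌋₊]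
    have h6 : |(q : ℝ)| ≤ |ξ| + 1 := by
      have := abs_sub_abs_le_abs_sub (q : ℝ) ξ
      rw [abs_sub_comm] at this
      linarith
    have h3 : g 1 0 * ((q.den : ℤ) : ℝ) + g 1 1 * ((-q.num : ℤ) : ℝ) =
        (g 1 0 - q * g 1 1) * q.den := by
      push_cast
      rw [← hqn]
      ring
    rw [h3, abs_mul, abs_of_pos hd]
    refine mul_le_mul ?_ hdR hd.le (by positivity)
    refine (abs_sub _ _).trans (le_trans ?_ (le_max_right _ _))
    rw [abs_mul, hC₁]
    gcongr

theorem exists_pos_forall_representative_column {g : SL2}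
    (hg : ∀ m n : ℤ, g 0 0 * m + g 0 1 * n = 0 → m = 0 ∧ n = 0) (B : ℝ) :
    ∃ ρ : ℝ, 0 < ρ ∧ ∀ δ : SL2, (δ : SL2 ⧸ SL2Z) = g → |δ 0 0| < ρ → B ≤ |δ 1 0| := by
  set D := |g 1 1| + |g 0 1| * |B| + (|g 1 0| + |g 0 0| * |B|) with hD
  set N : ℤ := ⌈D⌉
  have hfin : ∀ᶠ ρ : ℝ in 𝓝[>] 0, ∀ p ∈ (Finset.Icc (-N) N ×ˢ Finset.Icc (-N) N),
      g 0 0 * p.1 + g 0 1 * p.2 ≠ 0 → ρ < |g 0 0 * p.1 + g 0 1 * p.2| := by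
    rw [Filter.eventually_all_finset]
    intro p _
    by_cases hp : g 0 0 * p.1 + g 0 1 * p.2 = 0
    · exact Eventually.of_forall fun _ h => absurd hp h
    · exact mem_of_superset (Ioo_mem_nhdsGT (abs_pos.2 hp)) fun ρ hρ _ => hρ.2
  obtain ⟨ρ, ⟨hρ, hρ1⟩, hρ0 : 0 < ρ⟩ := ((hfin.and (Ioo_mem_nhdsGT one_pos)).and
    self_mem_nhdsWithin).exists
  refine ⟨ρ, hρ0, fun δ hδ h00 => ?_⟩
  by_contra! hB
  have hB' : |δ 1 0| ≤ |B| := hB.le.trans (le_abs_self B)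
  have h1 : |δ 0 0| ≤ 1 := (h00.trans hρ1.2).le
  have hmem : g⁻¹ * δ ∈ SL2Z := QuotientGroup.eq.1 hδ.symm
  obtain ⟨m, hm⟩ := exists_int_of_mem_SL2Z hmem 0 0
  obtain ⟨n, hn⟩ := exists_int_of_mem_SL2Z hmem 1 0
  have hδg : δ = g * (g⁻¹ * δ) := by group
  have e0 : δ 0 0 = g 0 0 * m + g 0 1 * n := by rw [hδg, SL2_mul_apply, hm, hn]
  have e1 : δ 1 0 = g 1 0 * m + g 1 1 * n := by rw [hδg, SL2_mul_apply, hm, hn]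
  have hdet := SL2_det g
  have em : (m : ℝ) = g 1 1 * δ 0 0 - g 0 1 * δ 1 0 := by
    rw [e0, e1]; linear_combination (-(m : ℝ)) * hdet
  have en : (n : ℝ) = g 0 0 * δ 1 0 - g 1 0 * δ 0 0 := by
    rw [e0, e1]; linear_combination (-(n : ℝ)) * hdet
  have bm : |(m : ℝ)| ≤ D := by
    rw [em]
    refine (abs_sub _ _).trans ?_
    rw [abs_mul, abs_mul]
    have := mul_le_mul_of_nonneg_left h1 (abs_nonneg (g 1 1))
    have := mul_le_mul_of_nonneg_left hB' (abs_nonneg (g 0 1))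
    have : 0 ≤ |g 1 0| + |g 0 0| * |B| := by positivity
    linarith
  have bn : |(n : ℝ)| ≤ D := by
    rw [en]
    refine (abs_sub _ _).trans ?_
    rw [abs_mul, abs_mul]
    have := mul_le_mul_of_nonneg_left h1 (abs_nonneg (g 1 0))
    have := mul_le_mul_of_nonneg_left hB' (abs_nonneg (g 0 0))
    have : 0 ≤ |g 1 1| + |g 0 1| * |B| := by positivity
    linarith
  have bint : ∀ k : ℤ, |(k : ℝ)| ≤ D → k ∈ Finset.Icc (-N) N := by
    intro k hk
    rw [Finset.mem_Icc, ← abs_le]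
    exact_mod_cast hk.trans (Int.le_ceil D)
  have hne : g 0 0 * m + g 0 1 * n ≠ 0 := by
    intro h0
    obtain ⟨rfl, rfl⟩ := hg m n h0
    have := SL2_det (g⁻¹ * δ)
    rw [hm, hn] at this
    simp at this
  have := hρ (m, n) (Finset.mk_mem_product (bint m bm) (bint n bn)) hne
  rw [← e0] at this
  linarith

/-- Points of the horocycle orbit renormalize into a fixed compact set. -/
theorem exists_isCompact_renormalization (κ C : ℝ) (hκ : 0 < κ) :
    ∃ K : Set SL2, IsCompact K ∧ ∀ (δ : SL2) (s : ℝ), δ 1 0 - s * δ 0 0 ≠ 0 →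
      |(δ 1 0 - s * δ 0 0) * δ 0 0| ≤ C → ∃ A ∈ K,
        hSL s • (δ : SL2 ⧸ SL2Z) =
          aSL (-Real.log (κ * |δ 1 0 - s * δ 0 0|)) • (A : SL2 ⧸ SL2Z) := by
  set D := κ * C + 1 / κ + κ * (1 + C)
  refine ⟨_, isCompact_setOf_abs_le D, fun δ s hB hC => ?_⟩
  set B := δ 1 0 - s * δ 0 0 with hBdef
  have hC0 : 0 ≤ C := (abs_nonneg _).trans hC
  have hBp : 0 < |B| := abs_pos.2 hB
  set t := Real.log (κ * |B|) with ht
  have het : Real.exp t = κ * |B| := Real.exp_log (by positivity)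
  have hent : Real.exp (-t) = (κ * |B|)⁻¹ := by rw [Real.exp_neg, het]
  set P := aSL t * hSL s * δ with hP
  have p00 : P 0 0 = κ * |B| * δ 0 0 := by
    simp only [hP, SL2_mul_apply, hSL_00, hSL_01, hSL_10, hSL_11]
    show (Real.exp t * 1 + 0 * -s) * δ 0 0 + (Real.exp t * 0 + 0 * 1) * δ 1 0 = _
    rw [het]; ring
  have p10 : P 1 0 = (κ * |B|)⁻¹ * B := by
    simp only [hP, SL2_mul_apply, hSL_00, hSL_01, hSL_10, hSL_11]
    show (0 * 1 + Real.exp (-t) * -s) * δ 0 0 + (0 * 0 + Real.exp (-t) * 1) * δ 1 0 = _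
    rw [hent]; ring
  have a10 : |P 1 0| = 1 / κ := by
    rw [p10, abs_mul, abs_inv, abs_mul, abs_abs, abs_of_pos hκ]
    field_simp
  have a00 : |P 0 0| ≤ κ * C := by
    rw [p00, mul_assoc, abs_mul, abs_mul, abs_abs, ← abs_mul, abs_of_pos hκ]
    gcongr
  have h10 : P 1 0 ≠ 0 := by
    intro h; rw [h, abs_zero] at a10; exact absurd a10.symm (by positivity)
  set k : ℤ := -round (P 1 1 / P 1 0) with hk
  have hdet : ((1 : ℤ) : ℝ) * ((1 : ℤ) : ℝ) - (k : ℝ) * ((0 : ℤ) : ℝ) = 1 := by simp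
  set A := P * mkSL _ _ _ _ hdet with hA
  have q00 : A 0 0 = P 0 0 := by rw [hA, SL2_mul_apply, mkSL_00, mkSL_10]; push_cast; ring
  have q10 : A 1 0 = P 1 0 := by rw [hA, SL2_mul_apply, mkSL_00, mkSL_10]; push_cast; ring
  have q11 : A 1 1 = P 1 0 * (P 1 1 / P 1 0 - round (P 1 1 / P 1 0)) := by
    rw [hA, SL2_mul_apply, mkSL_01, mkSL_11, hk]; push_cast; field_simp; ring
  have b11 : |A 1 1| ≤ 1 / κ := by
    rw [q11, abs_mul, a10]
    exact mul_le_of_le_one_right (by positivity) ((abs_sub_round _).trans (by norm_num))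
  have b01 : |A 0 1| ≤ κ * (1 + C) := by
    have hd := SL2_det A
    have e : A 0 1 * A 1 0 = A 0 0 * A 1 1 - 1 := by linarith
    have e' : |A 0 1| * (1 / κ) ≤ C + 1 := by
      rw [← a10, ← q10, ← abs_mul, e]
      refine (abs_sub _ _).trans ?_
      rw [abs_mul, abs_one, q00]
      have := mul_le_mul a00 b11 (abs_nonneg _) (by positivity)
      rw [show κ * C * (1 / κ) = C by field_simp] at this
      linarith
    rw [mul_one_div, div_le_iff₀ hκ] at e'
    linarith
  have hD1 : 0 ≤ κ * C := by positivity
  have hD2 : 0 ≤ 1 / κ := by positivity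
  have hD3 : 0 ≤ κ * (1 + C) := by positivity
  refine ⟨A, ?_, ?_⟩
  · intro i j
    fin_cases i <;> fin_cases j
    · show |A 0 0| ≤ _
      rw [q00]; linarith
    · show |A 0 1| ≤ _
      linarith
    · show |A 1 0| ≤ _
      rw [q10, a10]; linarith
    · show |A 1 1| ≤ _
      linarith
  · rw [mk_mul_eq_of_mem_SL2Z _ (mkSL_intCast_mem_SL2Z _ _ _ _ hdet)]
    show ((hSL s * δ : SL2) : SL2 ⧸ SL2Z) = ((aSL (-t) * P : SL2) : SL2 ⧸ SL2Z)
    rw [hP, ← mul_assoc, ← mul_assoc, ← aSL_add, neg_add_cancel, aSL_zero, one_mul]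

theorem eventually_abs_integral_horocycle_le [MeasurableSpace (SL2 ⧸ SL2Z)]
    [BorelSpace (SL2 ⧸ SL2Z)] (μ : Measure (SL2 ⧸ SL2Z)) [IsProbabilityMeasure μ]
    [SMulInvariantMeasure SL2 (SL2 ⧸ SL2Z) μ] {g : SL2}
    (hg : ∀ m n : ℤ, g 0 0 * m + g 0 1 * n = 0 → m = 0 ∧ n = 0)
    {f : SL2 ⧸ SL2Z → ℝ} (hf : Continuous f) (hcs : HasCompactSupport f) {M ε : ℝ}
    (hM : ∀ x, |f x| ≤ M) (hε : 0 < ε) :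
    ∀ᶠ S : ℝ in atTop, |∫ s in (0 : ℝ)..S, (f (hSL s • (g : SL2 ⧸ SL2Z)) - ∫ y, f y ∂μ)| ≤
      ε * S := by
  have hM0 : 0 ≤ M := (abs_nonneg _).trans (hM (1 : SL2))
  have hg01 : g 0 1 ≠ 0 := fun h => by simpa using (hg 0 1 (by simp [h])).2
  obtain ⟨C, hC, hshort⟩ := exists_representative_short_column hg01
  set c := ∫ y, f y ∂μ with hc
  set M' := M + |c| + 1 with hM'
  have hM'0 : 0 < M' := by positivity
  have hFM : ∀ x, |f x - c| ≤ M' := fun x => by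
    have := abs_sub (f x) c
    linarith [hM x]
  obtain ⟨κ, hκ, hκε⟩ : ∃ κ : ℝ, 0 < κ ∧ 2 * (M' * (κ ^ 2 * (2 * C) ^ 2)) ≤ ε / 3 := by
    have : Tendsto (fun κ : ℝ => 2 * (M' * (κ ^ 2 * (2 * C) ^ 2))) (𝓝[>] 0) (𝓝 0) := by
      have h : Continuous fun κ : ℝ => 2 * (M' * (κ ^ 2 * (2 * C) ^ 2)) := by fun_prop
      simpa using (h.tendsto 0).mono_left nhdsWithin_le_nhds
    obtain ⟨κ, h1, h2⟩ := ((this.eventually (gt_mem_nhds (by positivity : 0 < ε / 3))).and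
      self_mem_nhdsWithin).exists
    exact ⟨κ, h2, h1.le⟩
  obtain ⟨K, hK, hKren⟩ := exists_isCompact_renormalization κ (2 * C ^ 2) hκ
  obtain ⟨T, hT, hTavg⟩ := exists_uniform_horocycle_average μ hK hf hcs hM
    (ε := ε / 3) (by positivity)
  set η := ε / (6 * M') with hη
  have hη0 : 0 < η := by positivity
  set A₀ := Real.exp T / κ with hA₀
  have hA₀0 : 0 < A₀ := by positivity
  obtain ⟨ρ, hρ, hρg⟩ := exists_pos_forall_representative_column hg (A₀ + A₀ / η)
  filter_upwards [eventually_ge_atTop 1, eventually_gt_atTop (A₀ / η / ρ)] with S hS1 hSρ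
  have hS0 : 0 < S := by linarith
  obtain ⟨δ, hδg, h00, h10⟩ := hshort (√S) (Real.one_le_sqrt.2 hS1)
  have hsS : 0 < √S := Real.sqrt_pos.2 hS0
  have hSS : √S * √S = S := Real.mul_self_sqrt hS0.le
  have hFc : Continuous fun s => f (hSL s • (g : SL2 ⧸ SL2Z)) - c :=
    (continuous_hSL_orbit hf _).sub continuous_const
  have hgood : ∀ s ∈ Set.Ico 0 S, A₀ ≤ |δ 1 0 - s * δ 0 0| →
      ∃ L, Real.exp (2 * T) ≤ L ∧ L ≤ κ ^ 2 * (2 * C) ^ 2 * S ∧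
        |∫ x in s..s + L, (f (hSL x • (g : SL2 ⧸ SL2Z)) - c)| ≤ ε / 3 * L := by
    intro s hs hAs
    set B := δ 1 0 - s * δ 0 0 with hB
    have hBp : 0 < |B| := hA₀0.trans_le hAs
    have hs00 : |s * δ 0 0| ≤ C * √S := by
      rw [abs_mul, abs_of_nonneg hs.1]
      calc s * |δ 0 0| ≤ S * (C / √S) := mul_le_mul hs.2.le h00 (abs_nonneg _) hS0.le
        _ = C * √S := by
          rw [mul_div_assoc', div_eq_iff hsS.ne', mul_assoc, hSS, mul_comm]
    have hBle : |B| ≤ 2 * C * √S := by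
      have := abs_sub (δ 1 0) (s * δ 0 0)
      rw [← hB] at this
      linarith
    have hBC : |B * δ 0 0| ≤ 2 * C ^ 2 := by
      rw [abs_mul]
      calc |B| * |δ 0 0| ≤ (2 * C * √S) * (C / √S) :=
            mul_le_mul hBle h00 (abs_nonneg _) (by positivity)
        _ = 2 * C ^ 2 := by field_simp
    obtain ⟨A, hA, hAeq⟩ := hKren δ s (abs_pos.1 hBp) hBC
    set t := Real.log (κ * |B|) with ht
    have hTt : T ≤ t := by
      rw [ht, Real.le_log_iff_exp_le (by positivity)]
      rw [hA₀, div_le_iff₀ hκ] at hAs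
      linarith
    have hL := hTavg t hTt A hA
    have hexp : Real.exp (2 * t) = κ ^ 2 * |B| ^ 2 := by
      rw [two_mul, Real.exp_add, ht, Real.exp_log (by positivity)]; ring
    refine ⟨Real.exp (2 * t), Real.exp_le_exp.2 (by linarith), ?_, ?_⟩
    · rw [hexp, mul_assoc]
      refine mul_le_mul_of_nonneg_left ?_ (by positivity)
      calc |B| ^ 2 ≤ (2 * C * √S) ^ 2 := pow_le_pow_left₀ (abs_nonneg _) hBle 2
        _ = (2 * C) ^ 2 * S := by rw [mul_pow, Real.sq_sqrt hS0.le]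
    · rw [← hAeq, hδg] at hL
      have hsh : ∫ x in s..s + Real.exp (2 * t), (f (hSL x • (g : SL2 ⧸ SL2Z)) - c) =
          (∫ x in (0 : ℝ)..Real.exp (2 * t), f (hSL x • hSL s • (g : SL2 ⧸ SL2Z))) -
            Real.exp (2 * t) * c := by
        rw [intervalIntegral.integral_sub ((continuous_hSL_orbit hf _).intervalIntegrable _ _)
          (continuous_const.intervalIntegrable _ _), intervalIntegral.integral_const,
          add_sub_cancel_left, smul_eq_mul]
        congr 1
        have := intervalIntegral.integral_comp_add_right (a := 0) (b := Real.exp (2 * t))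
          (fun x => f (hSL x • (g : SL2 ⧸ SL2Z))) s
        rw [zero_add, add_comm (Real.exp _) s] at this
        rw [← this]
        simp only [hSL_add, mul_smul]
      rw [hsh]
      exact hL
  obtain ⟨s₀, r, hr, hrS, hout⟩ : ∃ s₀ r : ℝ, 0 ≤ r ∧ r ≤ η * S ∧ ∀ s ∈ Set.Ico 0 S,
      r ≤ |s - s₀| → A₀ ≤ |δ 1 0 - s * δ 0 0| := by
    rcases le_or_gt (A₀ / (η * S)) |δ 0 0| with hw | hw
    · have hw0 : 0 < |δ 0 0| := lt_of_lt_of_le (by positivity) hw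
      have hne : δ 0 0 ≠ 0 := abs_pos.1 hw0
      refine ⟨δ 1 0 / δ 0 0, A₀ / |δ 0 0|, by positivity, ?_, fun s _ hs => ?_⟩
      · rw [div_le_iff₀ (by positivity)] at hw ⊢
        linarith
      · rw [div_le_iff₀ hw0, ← abs_mul, sub_mul, div_mul_cancel₀ _ hne, abs_sub_comm] at hs
        exact hs
    · refine ⟨0, 0, le_rfl, by positivity, fun s hs _ => ?_⟩
      have h1 : A₀ / (η * S) < ρ := by
        rw [div_lt_iff₀ hρ] at hSρ
        rw [← div_div, div_lt_iff₀ hS0]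
        linarith
      have h2 := hρg δ hδg (hw.trans h1)
      have h3 : |s * δ 0 0| ≤ A₀ / η := by
        rw [abs_mul, abs_of_nonneg hs.1]
        calc s * |δ 0 0| ≤ S * (A₀ / (η * S)) := mul_le_mul hs.2.le hw.le (abs_nonneg _) hS0.le
          _ = A₀ / η := by field_simp
      have := abs_sub_abs_le_abs_sub (δ 1 0) (s * δ 0 0)
      linarith
  have hfin := abs_integral_le_of_exists_outside hFc (fun s => hFM _)
    (by positivity : 0 ≤ ε / 3) (Real.exp_pos (2 * T))
    (by positivity : 0 ≤ κ ^ 2 * (2 * C) ^ 2 * S) hS0.le hr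
    fun s hs h => hgood s hs (hout s hs h)
  have e1 : 2 * (M' * (κ ^ 2 * (2 * C) ^ 2 * S)) ≤ ε / 3 * S := by
    have := mul_le_mul_of_nonneg_right hκε hS0.le
    linarith
  have e2 : 2 * (M' * r) ≤ ε / 3 * S := by
    calc 2 * (M' * r) ≤ 2 * (M' * (η * S)) := by gcongr
      _ = ε / 3 * S := by rw [hη]; field_simp; ring
  linarith

theorem tendsto_horocycle_average_of_hasCompactSupport [MeasurableSpace (SL2 ⧸ SL2Z)]
    [BorelSpace (SL2 ⧸ SL2Z)] (μ : Measure (SL2 ⧸ SL2Z)) [IsProbabilityMeasure μ]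
    [SMulInvariantMeasure SL2 (SL2 ⧸ SL2Z) μ] {g : SL2}
    (hg : ∀ m n : ℤ, g 0 0 * m + g 0 1 * n = 0 → m = 0 ∧ n = 0)
    {f : SL2 ⧸ SL2Z → ℝ} (hf : Continuous f) (hcs : HasCompactSupport f) :
    Tendsto (fun S : ℝ => (∫ s in (0 : ℝ)..S, f (hSL s • (g : SL2 ⧸ SL2Z))) / S)
      atTop (𝓝 (∫ y, f y ∂μ)) := by
  obtain ⟨M, hM⟩ := hf.bounded_above_of_compact_support hcs
  rw [Metric.tendsto_nhds]
  intro ε hε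
  filter_upwards [eventually_abs_integral_horocycle_le μ hg hf hcs hM (half_pos hε),
    eventually_gt_atTop 0] with S hS hS0
  rw [intervalIntegral.integral_sub ((continuous_hSL_orbit hf _).intervalIntegrable _ _)
    (continuous_const.intervalIntegrable _ _), intervalIntegral.integral_const, sub_zero,
    smul_eq_mul] at hS
  rw [Real.dist_eq, ← mul_div_cancel_left₀ (∫ y, f y ∂μ) hS0.ne', ← sub_div, abs_div,
    abs_of_pos hS0, div_lt_iff₀ hS0]
  nlinarith

theorem exists_continuous_compactSupport_integral_gt {X : Type*} [TopologicalSpace X]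
    [LocallyCompactSpace X] [T2Space X] [MeasurableSpace X] [BorelSpace X] (μ : Measure X)
    [IsProbabilityMeasure μ] [μ.InnerRegular] {ε : ℝ} (hε : 0 < ε) :
    ∃ χ : X → ℝ, Continuous χ ∧ HasCompactSupport χ ∧ (∀ x, 0 ≤ χ x) ∧ (∀ x, χ x ≤ 1) ∧
      1 - ε < ∫ x, χ x ∂μ := by
  obtain ⟨K, -, hK, hμK⟩ := (MeasurableSet.univ (α := X)).exists_lt_isCompact (μ := μ)
    (r := ENNReal.ofReal (1 - ε)) (by
      rw [measure_univ]
      exact (ENNReal.ofReal_lt_one).2 (by linarith))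
  obtain ⟨χ, h1, -, hcs, h01⟩ := exists_continuous_one_zero_of_isCompact hK isClosed_empty
    (Set.disjoint_empty K)
  refine ⟨χ, χ.continuous, hcs, fun x => (h01 x).1, fun x => (h01 x).2, ?_⟩
  have hi : Integrable χ μ := χ.continuous.integrable_of_hasCompactSupport hcs
  have h2 : μ.real K ≤ ∫ x, χ x ∂μ := by
    rw [← integral_indicator_one hK.measurableSet]
    refine integral_mono ((integrable_indicator_iff hK.measurableSet).2
      (integrableOn_const (measure_ne_top _ _))) hi fun x => ?_
    by_cases hx : x ∈ K
    · rw [Set.indicator_of_mem hx, h1 hx]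
    · rw [Set.indicator_of_notMem hx]; exact (h01 x).1
  refine lt_of_lt_of_le ?_ h2
  rcases le_or_gt 0 (1 - ε) with h | h
  · exact (ENNReal.ofReal_lt_iff_lt_toReal h (measure_ne_top _ _)).1 hμK
  · exact h.trans_le measureReal_nonneg

theorem tendsto_horocycle_average_of_bounded [MeasurableSpace (SL2 ⧸ SL2Z)]
    [BorelSpace (SL2 ⧸ SL2Z)] (μ : Measure (SL2 ⧸ SL2Z)) [IsProbabilityMeasure μ]
    [SMulInvariantMeasure SL2 (SL2 ⧸ SL2Z) μ] {g : SL2}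
    (hg : ∀ m n : ℤ, g 0 0 * m + g 0 1 * n = 0 → m = 0 ∧ n = 0)
    {f : SL2 ⧸ SL2Z → ℝ} (hf : Continuous f) {M : ℝ} (hM : ∀ x, |f x| ≤ M) :
    Tendsto (fun S : ℝ => (∫ s in (0 : ℝ)..S, f (hSL s • (g : SL2 ⧸ SL2Z))) / S)
      atTop (𝓝 (∫ y, f y ∂μ)) := by
  have hM0 : 0 ≤ M := (abs_nonneg _).trans (hM (1 : SL2))
  rw [Metric.tendsto_nhds]
  intro ε hε
  set θ := ε / (4 * (M + 1)) with hθ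
  have hθ0 : 0 < θ := by positivity
  have hMθ : M * θ ≤ ε / 4 := by
    calc M * θ ≤ (M + 1) * θ := by gcongr; linarith
      _ = ε / 4 := by rw [hθ]; field_simp
  obtain ⟨χ, hχ, hχs, hχ0, hχ1, hχμ⟩ := exists_continuous_compactSupport_integral_gt μ hθ0
  have hfχ : Continuous fun x => f x * χ x := hf.mul hχ
  have hfχs : HasCompactSupport fun x => f x * χ x := hχs.mul_left
  have l1 := tendsto_horocycle_average_of_hasCompactSupport μ hg hχ hχs
  have l2 := tendsto_horocycle_average_of_hasCompactSupport μ hg hfχ hfχs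
  have hpt : ∀ x, |f x - f x * χ x| ≤ M * (1 - χ x) := fun x => by
    rw [← mul_one_sub, abs_mul, abs_of_nonneg (sub_nonneg.2 (hχ1 x))]
    exact mul_le_mul_of_nonneg_right (hM x) (sub_nonneg.2 (hχ1 x))
  have iχ : Integrable χ μ := hχ.integrable_of_hasCompactSupport hχs
  have ifχ : Integrable (fun x => f x * χ x) μ := hfχ.integrable_of_hasCompactSupport hfχs
  have iF : Integrable f μ := Integrable.of_bound hf.aestronglyMeasurable M
    (Eventually.of_forall hM)
  have hμ : |(∫ x, f x ∂μ) - ∫ x, f x * χ x ∂μ| ≤ M * (1 - ∫ x, χ x ∂μ) := by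
    rw [← integral_sub iF ifχ]
    refine (abs_integral_le_integral_abs).trans ((integral_mono (iF.sub ifχ).abs
      (((integrable_const 1).sub iχ).const_mul M) hpt).trans_eq ?_)
    rw [integral_const_mul]
    simp only [Pi.sub_apply]
    rw [integral_sub (integrable_const 1) iχ]
    simp
  filter_upwards [l1.eventually (lt_mem_nhds hχμ), Metric.tendsto_nhds.1 l2 (ε / 2) (half_pos hε),
    eventually_gt_atTop 0] with S h1 h2 hS
  have ci : ∀ {k : SL2 ⧸ SL2Z → ℝ}, Continuous k →
      IntervalIntegrable (fun s => k (hSL s • (g : SL2 ⧸ SL2Z))) volume 0 S := fun hk =>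
    (continuous_hSL_orbit hk _).intervalIntegrable _ _
  have horb : |(∫ s in (0 : ℝ)..S, f (hSL s • (g : SL2 ⧸ SL2Z))) -
      ∫ s in (0 : ℝ)..S, f (hSL s • (g : SL2 ⧸ SL2Z)) * χ (hSL s • (g : SL2 ⧸ SL2Z))| ≤
      M * (S - ∫ s in (0 : ℝ)..S, χ (hSL s • (g : SL2 ⧸ SL2Z))) := by
    rw [← intervalIntegral.integral_sub (ci hf) (ci hfχ)]
    refine (intervalIntegral.abs_integral_le_integral_abs hS.le).trans
      ((intervalIntegral.integral_mono_on hS.le ((ci hf).sub (ci hfχ)).abs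
        ((intervalIntegrable_const.sub (ci hχ)).const_mul M)
        fun s _ => hpt (hSL s • (g : SL2 ⧸ SL2Z))).trans_eq ?_)
    rw [intervalIntegral.integral_const_mul,
      intervalIntegral.integral_sub intervalIntegrable_const (ci hχ)]
    simp
  rw [Real.dist_eq] at h2 ⊢
  set I := ∫ s in (0 : ℝ)..S, f (hSL s • (g : SL2 ⧸ SL2Z))
  set J := ∫ s in (0 : ℝ)..S, f (hSL s • (g : SL2 ⧸ SL2Z)) * χ (hSL s • (g : SL2 ⧸ SL2Z))
  set H := ∫ s in (0 : ℝ)..S, χ (hSL s • (g : SL2 ⧸ SL2Z))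
  have h3 : |I / S - J / S| ≤ M * (1 - H / S) := by
    rw [← sub_div, abs_div, abs_of_pos hS, div_le_iff₀ hS]
    refine horb.trans_eq ?_
    field_simp
  have h4 : M * (1 - H / S) ≤ M * θ := mul_le_mul_of_nonneg_left (by linarith) hM0
  have h5 : M * (1 - ∫ x, χ x ∂μ) ≤ M * θ := mul_le_mul_of_nonneg_left (by linarith) hM0
  rw [abs_lt] at h2 ⊢
  rw [abs_le] at h3 hμ
  constructor <;> linarith [h2.1, h2.2, h3.1, h3.2, hμ.1, hμ.2]

/-- Equidistribution of long horocycle orbits: if the lattice `g·ℤ²` has no vertical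
vectors, then the time averages of any bounded continuous function on
`SL(2,ℝ)/SL(2,ℤ)` along the horocycle orbit of `gΓ` converge to its average against
the `SL(2,ℝ)`-invariant (Haar) probability measure. -/
theorem horocycle_equidistribution
    [MeasurableSpace (SL2 ⧸ SL2Z)] [BorelSpace (SL2 ⧸ SL2Z)]
    (μ : Measure (SL2 ⧸ SL2Z)) [IsProbabilityMeasure μ]
    (hinv : ∀ g : SL2, MeasurePreserving (fun y : SL2 ⧸ SL2Z => g • y) μ μ)
    (g : SL2)
    (hvert : ¬ ∃ v : ℝ, v ≠ 0 ∧ ![0, v] ∈ lattOf (g : Matrix (Fin 2) (Fin 2) ℝ)) :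
    ∀ f : BoundedContinuousFunction (SL2 ⧸ SL2Z) ℝ,
      Tendsto (fun S : ℝ =>
          (∫ s in (0 : ℝ)..S, f (hSL s • (QuotientGroup.mk g : SL2 ⧸ SL2Z))) / S)
        atTop (𝓝 (∫ y, f y ∂μ)) := by
  intro f
  have : SMulInvariantMeasure SL2 (SL2 ⧸ SL2Z) μ :=
    ⟨fun c _ hs => (hinv c).measure_preimage hs.nullMeasurableSet⟩
  refine tendsto_horocycle_average_of_bounded μ (fun m n h => ?_) f.continuous
    (M := ‖f‖) fun x => f.norm_coe_le_norm x
  have hdet := SL2_det g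
  have hv : g 1 0 * m + g 1 1 * n = 0 := by
    by_contra hne
    refine hvert ⟨_, hne, m, n, ?_⟩
    ext i
    fin_cases i <;> simp [Matrix.mulVec, dotProduct, Fin.sum_univ_two, h]
  constructor
  · have : (m : ℝ) = 0 := by linear_combination g 1 1 * h - g 0 1 * hv - m * hdet
    exact_mod_cast this
  · have : (n : ℝ) = 0 := by linear_combination g 0 0 * hv - g 1 0 * h - n * hdet
    exact_mod_cast this
end
end
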